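/- arXiv:2210.15174 — 3 statements merged into one kernel-verified Lean document; each statement's English description precedes it below -/
import Mathlib

section
/- Let p, q, r be distinct primes and n a positive integer, and set N = p^n·q·r. A nonempty subset A of Z_N is spectral if and only if A tiles Z_N. -/
open Finset

/-- `chi N A b = ∑_{a ∈ A} e^{2πi·ab/N}`. -/
noncomputable def chi (N : ℕ) (A : Finset (ZMod N)) (b : ZMod N) : ℂ :=
  ∑ a ∈ A, Complex.exp (2 * Real.pi * Complex.I * ((a * b).val : ℕ) / N)

/-- `(A, B)` is a spectral pair in `Z_N`. -/
def IsSpectralPair (N : ℕ) (A B : Finset (ZMod N)) : Prop :=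
  A.card = B.card ∧ ∀ b ∈ B, ∀ b' ∈ B, b ≠ b' → chi N A (b - b') = 0

/-- `A` is a spectral set in `Z_N`. -/
def IsSpectral (N : ℕ) (A : Finset (ZMod N)) : Prop :=
  ∃ B : Finset (ZMod N), IsSpectralPair N A B

/-- `A` tiles `Z_N` by translation. -/
def Tiles (N : ℕ) (A : Finset (ZMod N)) : Prop :=
  ∃ T : Finset (ZMod N), ∀ g : ZMod N,
    ∃! x : ZMod N × ZMod N, x.1 ∈ A ∧ x.2 ∈ T ∧ x.1 + x.2 = g

set_option linter.unusedSectionVars false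

section Masses

variable {Y Z : Type*} [DecidableEq Y] [DecidableEq Z]

/-- Indicator function of the residue class of `x` modulo `p ^ k`. -/
def resInd (p k : ℕ) (x t : ℤ) : ℤ := if (p : ℤ) ^ k ∣ t - x then 1 else 0

/-- Indicator function of a point. -/
def ptInd (y t : Y) : ℤ := if t = y then 1 else 0

/-- The sum of a product function over a finite subset of `ℤ × Y × Z`. -/
def mass (A : Finset (ℤ × Y × Z)) (φ : ℤ → ℤ) (ψ : Y → ℤ) (θ : Z → ℤ) : ℤ :=
  ∑ a ∈ A, φ a.1 * ψ a.2.1 * θ a.2.2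

/-- Test functions on the `p`-part: integer combinations of characters of order `p ^ k`. -/
def LevelTest (p : ℕ) : ℕ → (ℤ → ℤ) → Prop
  | 0, φ => φ = 1
  | k + 1, φ => ∃ x x', (p : ℤ) ^ k ∣ x - x' ∧ φ = resInd p (k + 1) x - resInd p (k + 1) x'

/-- Test functions on a prime factor: constant, or a difference of two point masses. -/
def FiberTest (ε : Prop) (ψ : Y → ℤ) : Prop :=
  (ε → ∃ y y', ψ = ptInd y - ptInd y') ∧ (¬ε → ψ = 1)

/-- Combinatorial form of the vanishing of `1_A` at the characters of a given order. -/
def Vanishes (p : ℕ) (A : Finset (ℤ × Y × Z)) (k : ℕ) (ε δ : Prop) : Prop :=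
  ∀ φ ψ θ, LevelTest p k φ → FiberTest ε ψ → FiberTest δ θ → mass A φ ψ θ = 0

/-- `x - x'` has order `p ^ k` modulo `p ^ n`. -/
def Level (p n : ℕ) : ℕ → ℤ → ℤ → Prop
  | 0, x, x' => (p : ℤ) ^ n ∣ x - x'
  | k + 1, x, x' => k + 1 ≤ n ∧ (p : ℤ) ^ (n - (k + 1)) ∣ x - x' ∧ ¬(p : ℤ) ^ (n - k) ∣ x - x'

/-- `B` vanishes at all differences of distinct elements of `A`. -/
def HalfPair (p n : ℕ) (A B : Finset (ℤ × Y × Z)) : Prop :=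
  ∀ a ∈ A, ∀ a' ∈ A, a ≠ a' → ∀ k, Level p n k a.1 a'.1 →
    Vanishes p B k (a.2.1 ≠ a'.2.1) (a.2.2 ≠ a'.2.2)

/-- Combinatorial form of a spectral pair. -/
def CombPair (p n : ℕ) (A B : Finset (ℤ × Y × Z)) : Prop :=
  A.card = B.card ∧ HalfPair p n A B ∧ HalfPair p n B A

theorem CombPair.symm {p n : ℕ} {A B : Finset (ℤ × Y × Z)} (h : CombPair p n A B) :
    CombPair p n B A := ⟨h.1.symm, h.2.2, h.2.1⟩

/-! ### Masses -/

theorem mass_sub_left (A : Finset (ℤ × Y × Z)) (φ φ' ψ θ) :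
    mass A (φ - φ') ψ θ = mass A φ ψ θ - mass A φ' ψ θ := by
  simp [mass, sub_mul, Finset.sum_sub_distrib]

theorem mass_sub_mid (A : Finset (ℤ × Y × Z)) (φ ψ ψ' θ) :
    mass A φ (ψ - ψ') θ = mass A φ ψ θ - mass A φ ψ' θ := by
  simp [mass, sub_mul, mul_sub, Finset.sum_sub_distrib]

theorem mass_sub_right (A : Finset (ℤ × Y × Z)) (φ ψ θ θ') :
    mass A φ ψ (θ - θ') = mass A φ ψ θ - mass A φ ψ θ' := by
  simp [mass, mul_sub, Finset.sum_sub_distrib]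

theorem mass_one (A : Finset (ℤ × Y × Z)) : mass A 1 1 1 = A.card := by
  simp [mass]

theorem mass_congr {A : Finset (ℤ × Y × Z)} {φ φ' : ℤ → ℤ} {ψ ψ' : Y → ℤ} {θ θ' : Z → ℤ}
    (h : ∀ a ∈ A, φ a.1 * ψ a.2.1 * θ a.2.2 = φ' a.1 * ψ' a.2.1 * θ' a.2.2) :
    mass A φ ψ θ = mass A φ' ψ' θ' := Finset.sum_congr rfl h

theorem sum_mass_mid [Fintype Y] (A : Finset (ℤ × Y × Z)) (φ θ) :
    ∑ y, mass A φ (ptInd y) θ = mass A φ 1 θ := by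
  unfold mass
  rw [Finset.sum_comm]
  refine Finset.sum_congr rfl fun a _ => ?_
  simp [ptInd]

theorem sum_mass_right [Fintype Z] (A : Finset (ℤ × Y × Z)) (φ ψ) :
    ∑ z, mass A φ ψ (ptInd z) = mass A φ ψ 1 := by
  unfold mass
  rw [Finset.sum_comm]
  refine Finset.sum_congr rfl fun a _ => ?_
  simp [ptInd]

theorem exists_dvd_sub_of_range {p : ℕ} (hp : 0 < p) (k : ℕ) {x t : ℤ} (h : (p : ℤ) ^ k ∣ t - x) :
    ∃! i, i ∈ Finset.range p ∧ (p : ℤ) ^ (k + 1) ∣ t - (x + i * (p : ℤ) ^ k) := by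
  obtain ⟨c, hc⟩ := h
  have hpk : (p : ℤ) ^ k ≠ 0 := by positivity
  have key : ∀ i : ℕ, (p : ℤ) ^ (k + 1) ∣ t - (x + i * (p : ℤ) ^ k) ↔ (p : ℤ) ∣ c - i := by
    intro i
    rw [show t - (x + i * (p : ℤ) ^ k) = (p : ℤ) ^ k * (c - i) by linear_combination hc, pow_succ]
    exact mul_dvd_mul_iff_left hpk
  have hp' : (0 : ℤ) < p := by exact_mod_cast hp
  refine ⟨(c % p).toNat, ?_, ?_⟩
  · have h1 := Int.emod_nonneg c hp'.ne'
    have h2 := Int.emod_lt_of_pos c hp'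
    refine ⟨by simp; omega, (key _).2 ?_⟩
    rw [Int.toNat_of_nonneg h1]
    exact Int.dvd_self_sub_emod
  · rintro j ⟨hj, hd⟩
    rw [key] at hd
    have h3 : c % p = j := by
      have := (Int.emod_emod_of_dvd c (dvd_refl (p : ℤ)))
      have h4 : c % p = (j : ℤ) % p := Int.emod_eq_emod_iff_emod_sub_eq_zero.2
        (Int.emod_eq_zero_of_dvd hd)
      rw [h4]
      exact Int.emod_eq_of_lt (by positivity) (by simpa using hj)
    rw [h3]; simp

theorem sum_resInd {p : ℕ} (hp : 0 < p) (k : ℕ) (x t : ℤ) :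
    ∑ i ∈ Finset.range p, resInd p (k + 1) (x + i * (p : ℤ) ^ k) t = resInd p k x t := by
  unfold resInd
  split_ifs with h
  · obtain ⟨i, ⟨hi, hd⟩, hu⟩ := exists_dvd_sub_of_range hp k h
    rw [Finset.sum_eq_single i]
    · simp [hd]
    · intro j hj hji
      rw [if_neg]
      exact fun hd' => hji (hu j ⟨hj, hd'⟩)
    · exact fun h => absurd hi h
  · refine Finset.sum_eq_zero fun i _ => if_neg fun hd => h ?_
    have := (pow_dvd_pow (p : ℤ) (Nat.le_succ k)).trans hd
    have h2 : (p : ℤ) ^ k ∣ i * (p : ℤ) ^ k := dvd_mul_left _ _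
    rw [show t - x = (t - (x + i * (p : ℤ) ^ k)) + i * (p : ℤ) ^ k by ring]
    exact dvd_add this h2

theorem sum_mass_left {p : ℕ} (hp : 0 < p) (A : Finset (ℤ × Y × Z)) (k : ℕ) (x : ℤ) (ψ θ) :
    ∑ i ∈ Finset.range p, mass A (resInd p (k + 1) (x + i * (p : ℤ) ^ k)) ψ θ
      = mass A (resInd p k x) ψ θ := by
  unfold mass
  rw [Finset.sum_comm]
  refine Finset.sum_congr rfl fun a _ => ?_
  rw [← Finset.sum_mul, ← Finset.sum_mul, sum_resInd hp]

theorem resInd_zero (p : ℕ) (x : ℤ) : resInd p 0 x = 1 := by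
  funext t; simp [resInd]

/-- Functions with values in `{0, 1}`. -/
def IsInd {X : Type*} (φ : X → ℤ) : Prop := ∀ t, φ t = 0 ∨ φ t = 1

theorem isInd_resInd (p k x) : IsInd (resInd p k x) := fun t => by
  unfold resInd; split_ifs <;> simp

theorem isInd_ptInd (y : Y) : IsInd (ptInd y) := fun t => by
  unfold ptInd; split_ifs <;> simp

theorem isInd_one {X : Type*} : IsInd (1 : X → ℤ) := fun _ => Or.inr rfl

theorem resInd_eq_one {p k x t} : resInd p k x t = 1 ↔ (p : ℤ) ^ k ∣ t - x := by
  simp [resInd]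

theorem ptInd_eq_one {y t : Y} : ptInd y t = 1 ↔ t = y := by
  simp [ptInd]

theorem mass_term_nonneg {φ : ℤ → ℤ} {ψ : Y → ℤ} {θ : Z → ℤ} (hφ : IsInd φ) (hψ : IsInd ψ)
    (hθ : IsInd θ) (a : ℤ × Y × Z) : 0 ≤ φ a.1 * ψ a.2.1 * θ a.2.2 := by
  rcases hφ a.1 with h | h <;> rcases hψ a.2.1 with h' | h' <;> rcases hθ a.2.2 with h'' | h'' <;>
    simp [h, h', h'']

theorem mass_nonneg (A : Finset (ℤ × Y × Z)) {φ : ℤ → ℤ} {ψ : Y → ℤ} {θ : Z → ℤ}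
    (hφ : IsInd φ) (hψ : IsInd ψ) (hθ : IsInd θ) : 0 ≤ mass A φ ψ θ :=
  Finset.sum_nonneg fun a _ => mass_term_nonneg hφ hψ hθ a

theorem one_le_mass {A : Finset (ℤ × Y × Z)} {φ : ℤ → ℤ} {ψ : Y → ℤ} {θ : Z → ℤ}
    (hφ : IsInd φ) (hψ : IsInd ψ) (hθ : IsInd θ) {a : ℤ × Y × Z} (ha : a ∈ A)
    (h1 : φ a.1 = 1) (h2 : ψ a.2.1 = 1) (h3 : θ a.2.2 = 1) : 1 ≤ mass A φ ψ θ := by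
  have := Finset.single_le_sum (f := fun a : ℤ × Y × Z => φ a.1 * ψ a.2.1 * θ a.2.2)
    (fun a _ => mass_term_nonneg hφ hψ hθ a) ha
  unfold mass
  simpa [h1, h2, h3] using this

theorem exists_of_mass_ne_zero {A : Finset (ℤ × Y × Z)} {φ : ℤ → ℤ} {ψ : Y → ℤ} {θ : Z → ℤ}
    (hφ : IsInd φ) (hψ : IsInd ψ) (hθ : IsInd θ) (h : mass A φ ψ θ ≠ 0) :
    ∃ a ∈ A, φ a.1 = 1 ∧ ψ a.2.1 = 1 ∧ θ a.2.2 = 1 := by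
  obtain ⟨a, ha, hne⟩ := Finset.exists_ne_zero_of_sum_ne_zero h
  refine ⟨a, ha, ?_, ?_, ?_⟩
  · exact (hφ a.1).resolve_left fun h0 => hne (by simp [h0])
  · exact (hψ _).resolve_left fun h0 => hne (by simp [h0])
  · exact (hθ _).resolve_left fun h0 => hne (by simp [h0])

theorem mass_eq_zero {A : Finset (ℤ × Y × Z)} {φ : ℤ → ℤ} {ψ : Y → ℤ} {θ : Z → ℤ}
    (hφ : IsInd φ) (hψ : IsInd ψ) (hθ : IsInd θ)
    (h : ∀ a ∈ A, φ a.1 = 1 → ψ a.2.1 = 1 → θ a.2.2 ≠ 1) : mass A φ ψ θ = 0 := by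
  by_contra hne
  obtain ⟨a, ha, h1, h2, h3⟩ := exists_of_mass_ne_zero hφ hψ hθ hne
  exact h a ha h1 h2 h3

theorem mass_le_one {A : Finset (ℤ × Y × Z)} {φ : ℤ → ℤ} {ψ : Y → ℤ} {θ : Z → ℤ}
    (hφ : IsInd φ) (hψ : IsInd ψ) (hθ : IsInd θ)
    (h : ∀ a ∈ A, ∀ a' ∈ A, φ a.1 = 1 → ψ a.2.1 = 1 → θ a.2.2 = 1 →
      φ a'.1 = 1 → ψ a'.2.1 = 1 → θ a'.2.2 = 1 → a = a') : mass A φ ψ θ ≤ 1 := by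
  by_cases hz : mass A φ ψ θ = 0
  · rw [hz]; exact zero_le_one
  obtain ⟨a, ha, h1, h2, h3⟩ := exists_of_mass_ne_zero hφ hψ hθ hz
  unfold mass
  rw [Finset.sum_eq_single a]
  · simp [h1, h2, h3]
  · intro b hb hba
    by_contra hne
    refine hba (h b hb a ha ?_ ?_ ?_ h1 h2 h3)
    · exact (hφ _).resolve_left fun h0 => hne (by simp [h0])
    · exact (hψ _).resolve_left fun h0 => hne (by simp [h0])
    · exact (hθ _).resolve_left fun h0 => hne (by simp [h0])
  · exact fun h => absurd ha h

/-! ### Levels -/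

theorem exists_level {p : ℕ} (n : ℕ) (x x' : ℤ) : ∃ k ≤ n, Level p n k x x' := by
  by_contra hcon
  push Not at hcon
  have : ∀ j ≤ n, (p : ℤ) ^ j ∣ x - x' := by
    intro j
    induction j with
    | zero => simp
    | succ j ih =>
      intro hj
      by_contra hd
      refine hcon (n - j) (by omega) ?_
      obtain ⟨i, hi⟩ : ∃ i, n - j = i + 1 := ⟨n - j - 1, by omega⟩
      rw [hi]
      refine ⟨by omega, ?_, ?_⟩
      · rw [show n - (i + 1) = j by omega]; exact ih (by omega)
      · rw [show n - i = j + 1 by omega]; exact hd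
  exact hcon 0 (Nat.zero_le _) (this n le_rfl)

theorem Level.le {p n k : ℕ} {x x' : ℤ} (h : Level p n k x x') : k ≤ n := by
  cases k with
  | zero => exact Nat.zero_le _
  | succ k => exact h.1

theorem level_iff {p n k : ℕ} {x x' : ℤ} (hk : k ≠ 0) : Level p n k x x' ↔
    k ≤ n ∧ (p : ℤ) ^ (n - k) ∣ x - x' ∧ ¬(p : ℤ) ^ (n - k + 1) ∣ x - x' := by
  cases k with
  | zero => exact absurd rfl hk
  | succ k =>
    refine and_congr_right fun h => ?_
    rw [show n - (k + 1) + 1 = n - k by omega]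

theorem level_zero {p n : ℕ} {x x' : ℤ} : Level p n 0 x x' ↔ (p : ℤ) ^ n ∣ x - x' := Iff.rfl

theorem level_top {p n : ℕ} {x x' : ℤ} : Level p (n + 1) (n + 1) x x' ↔ ¬(p : ℤ) ∣ x - x' := by
  rw [level_iff (Nat.succ_ne_zero n)]; simp

theorem level_one {p n : ℕ} {x x' : ℤ} : Level p (n + 1) 1 x x' ↔
    (p : ℤ) ^ n ∣ x - x' ∧ ¬(p : ℤ) ^ (n + 1) ∣ x - x' := by
  rw [level_iff one_ne_zero]; simp

theorem level_mul {p : ℕ} (hp : p ≠ 0) {n k : ℕ} {i x x' : ℤ} :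
    Level p (n + 1) k (i + p * x) (i + p * x') ∧ k ≤ n ↔ Level p n k x x' := by
  have hp' : (p : ℤ) ≠ 0 := by exact_mod_cast hp
  have key : ∀ j, (p : ℤ) ^ (j + 1) ∣ (i + p * x) - (i + p * x') ↔ (p : ℤ) ^ j ∣ x - x' := by
    intro j
    rw [show (i + p * x) - (i + p * x') = (x - x') * p by ring, pow_succ]
    exact mul_dvd_mul_iff_right hp'
  rcases Nat.eq_zero_or_pos k with rfl | hk
  · rw [level_zero, level_zero, key]; simp
  · rw [level_iff hk.ne', level_iff hk.ne']
    constructor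
    · rintro ⟨⟨h1, h2, h3⟩, h4⟩
      refine ⟨h4, ?_, ?_⟩
      · rw [← key]; rwa [show n + 1 - k = n - k + 1 by omega] at h2
      · rw [← key]; rwa [show n + 1 - k = n - k + 1 by omega] at h3
    · rintro ⟨h1, h2, h3⟩
      refine ⟨⟨by omega, ?_, ?_⟩, h1⟩
      · rw [show n + 1 - k = n - k + 1 by omega]; exact (key _).2 h2
      · rw [show n + 1 - k = n - k + 1 by omega]; exact fun h => h3 ((key _).1 h)

theorem level_succ {p n k : ℕ} (hk : k ≠ 0) {x x' : ℤ} :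
    Level p (n + 1) (k + 1) x x' ↔ Level p n k x x' := by
  rw [level_iff hk, level_iff (Nat.succ_ne_zero k)]
  simp

theorem Level.congr {p n k : ℕ} (hk : k ≠ 0) {x x' y y' : ℤ}
    (hx : (p : ℤ) ^ (n - k + 1) ∣ x - y) (hx' : (p : ℤ) ^ (n - k + 1) ∣ x' - y')
    (h : Level p n k x x') : Level p n k y y' := by
  rw [level_iff hk] at h ⊢
  have e : y - y' = (x - x') - ((x - y) - (x' - y')) := by ring
  have hd := dvd_sub hx hx'
  refine ⟨h.1, ?_, fun hc => h.2.2 ?_⟩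
  · rw [e]; exact dvd_sub h.2.1 ((pow_dvd_pow _ (Nat.le_succ _)).trans hd)
  · rw [e] at hc; exact (dvd_sub_left hd).1 hc

/-! ### Consequences of vanishing -/

theorem fiberTest_of {ε : Prop} (h : ε) (y y' : Y) : FiberTest ε (ptInd y - ptInd y') :=
  ⟨fun _ => ⟨y, y', rfl⟩, fun h' => absurd h h'⟩

theorem fiberTest_of_not {ε : Prop} (h : ¬ε) : FiberTest ε (1 : Y → ℤ) :=
  ⟨fun h' => absurd h' h, fun _ => rfl⟩

theorem levelTest_succ (p : ℕ) {k : ℕ} {x x' : ℤ} (h : (p : ℤ) ^ k ∣ x - x') :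
    LevelTest p (k + 1) (resInd p (k + 1) x - resInd p (k + 1) x') := ⟨x, x', h, rfl⟩

theorem Vanishes.congr {p : ℕ} {A : Finset (ℤ × Y × Z)} {k : ℕ} {ε δ ε' δ' : Prop}
    (h : Vanishes p A k ε δ) (h1 : ε ↔ ε') (h2 : δ ↔ δ') : Vanishes p A k ε' δ' := by
  rwa [← propext h1, ← propext h2]

variable {p : ℕ} {A : Finset (ℤ × Y × Z)}

theorem Vanishes.card_eq_zero (h : Vanishes p A 0 False False) : A.card = 0 := by
  have := h 1 1 1 rfl (fiberTest_of_not not_false) (fiberTest_of_not not_false)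
  rw [mass_one] at this
  exact_mod_cast this

theorem Vanishes.mid_eq (h : Vanishes p A 0 True False) (y y' : Y) :
    mass A 1 (ptInd y) 1 = mass A 1 (ptInd y') 1 := by
  have := h 1 _ 1 rfl (fiberTest_of trivial y y') (fiberTest_of_not not_false)
  rw [mass_sub_mid] at this
  linarith

theorem Vanishes.right_eq (h : Vanishes p A 0 False True) (z z' : Z) :
    mass A 1 1 (ptInd z) = mass A 1 1 (ptInd z') := by
  have := h 1 1 _ rfl (fiberTest_of_not not_false) (fiberTest_of trivial z z')
  rw [mass_sub_right] at this
  linarith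

theorem Vanishes.mid_right_eq (h : Vanishes p A 0 True True) (y y' : Y) (z z' : Z) :
    mass A 1 (ptInd y) (ptInd z) + mass A 1 (ptInd y') (ptInd z')
      = mass A 1 (ptInd y) (ptInd z') + mass A 1 (ptInd y') (ptInd z) := by
  have := h 1 _ _ rfl (fiberTest_of trivial y y') (fiberTest_of trivial z z')
  simp only [mass_sub_right, mass_sub_mid] at this
  linarith

theorem Vanishes.left_eq {k : ℕ} (h : Vanishes p A (k + 1) False False) {x x' : ℤ}
    (hx : (p : ℤ) ^ k ∣ x - x') :
    mass A (resInd p (k + 1) x) 1 1 = mass A (resInd p (k + 1) x') 1 1 := by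
  have := h _ 1 1 (levelTest_succ p hx) (fiberTest_of_not not_false) (fiberTest_of_not not_false)
  rw [mass_sub_left] at this
  linarith

theorem Vanishes.left_mid_eq {k : ℕ} (h : Vanishes p A (k + 1) True False) {x x' : ℤ}
    (hx : (p : ℤ) ^ k ∣ x - x') (y y' : Y) :
    mass A (resInd p (k + 1) x) (ptInd y) 1 + mass A (resInd p (k + 1) x') (ptInd y') 1
      = mass A (resInd p (k + 1) x) (ptInd y') 1 + mass A (resInd p (k + 1) x') (ptInd y) 1 := by
  have := h _ _ 1 (levelTest_succ p hx) (fiberTest_of trivial y y') (fiberTest_of_not not_false)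
  simp only [mass_sub_left, mass_sub_mid] at this
  linarith

theorem Vanishes.left_right_eq {k : ℕ} (h : Vanishes p A (k + 1) False True) {x x' : ℤ}
    (hx : (p : ℤ) ^ k ∣ x - x') (z z' : Z) :
    mass A (resInd p (k + 1) x) 1 (ptInd z) + mass A (resInd p (k + 1) x') 1 (ptInd z')
      = mass A (resInd p (k + 1) x) 1 (ptInd z') + mass A (resInd p (k + 1) x') 1 (ptInd z) := by
  have := h _ 1 _ (levelTest_succ p hx) (fiberTest_of_not not_false) (fiberTest_of trivial z z')
  simp only [mass_sub_left, mass_sub_right] at this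
  linarith

theorem Vanishes.left_mid_right_eq {k : ℕ} (h : Vanishes p A (k + 1) True True) {x x' : ℤ}
    (hx : (p : ℤ) ^ k ∣ x - x') (y y' : Y) (z z' : Z) :
    (mass A (resInd p (k + 1) x) (ptInd y) (ptInd z)
        - mass A (resInd p (k + 1) x') (ptInd y) (ptInd z))
      - (mass A (resInd p (k + 1) x) (ptInd y') (ptInd z)
        - mass A (resInd p (k + 1) x') (ptInd y') (ptInd z))
      = (mass A (resInd p (k + 1) x) (ptInd y) (ptInd z')
        - mass A (resInd p (k + 1) x') (ptInd y) (ptInd z'))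
      - (mass A (resInd p (k + 1) x) (ptInd y') (ptInd z')
        - mass A (resInd p (k + 1) x') (ptInd y') (ptInd z')) := by
  have := h _ _ _ (levelTest_succ p hx) (fiberTest_of trivial y y') (fiberTest_of trivial z z')
  simp only [mass_sub_left, mass_sub_mid, mass_sub_right] at this
  linarith

theorem Vanishes.card_dvd_mid [Fintype Y] (h : Vanishes p A 0 True False) (y : Y) :
    (A.card : ℤ) = Fintype.card Y * mass A 1 (ptInd y) 1 := by
  rw [← mass_one, ← sum_mass_mid, Finset.sum_congr rfl fun y' _ => h.mid_eq y' y]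
  simp

theorem Vanishes.card_dvd_right [Fintype Z] (h : Vanishes p A 0 False True) (z : Z) :
    (A.card : ℤ) = Fintype.card Z * mass A 1 1 (ptInd z) := by
  rw [← mass_one, ← sum_mass_right, Finset.sum_congr rfl fun y' _ => h.right_eq y' z]
  simp

theorem Vanishes.card_dvd_left (hp : 0 < p) (h : Vanishes p A 1 False False) (x : ℤ) :
    (A.card : ℤ) = p * mass A (resInd p 1 x) 1 1 := by
  rw [← mass_one, ← resInd_zero p x, ← sum_mass_left hp,
    Finset.sum_congr rfl fun i _ => h.left_eq (x := _) (x' := x) (by simp)]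
  simp

end Masses

section Reductions

variable {Y Z : Type*} [DecidableEq Y] [DecidableEq Z] {p n : ℕ} {A B : Finset (ℤ × Y × Z)}

theorem CombPair.ext_of_dvd (h : CombPair p n A B) {a a' : ℤ × Y × Z} (ha : a ∈ A) (ha' : a' ∈ A)
    (hx : (p : ℤ) ^ n ∣ a.1 - a'.1) (h2 : a.2 = a'.2) : a = a' := by
  by_contra hne
  have h0 := (h.2.1 a ha a' ha' hne 0 hx).congr (ε' := False) (δ' := False) (by simp [h2])
    (by simp [h2])
  have := Finset.card_pos.2 ⟨a, ha⟩
  rw [h.1, h0.card_eq_zero] at this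
  exact lt_irrefl _ this

/-- The part of `A` in the residue class of `i` modulo `p`, rescaled by `1 / p`. -/
def classPart (p : ℕ) (i : ℤ) (A : Finset (ℤ × Y × Z)) : Finset (ℤ × Y × Z) :=
  (A.filter fun a => (p : ℤ) ∣ a.1 - i).image fun a => ((a.1 - i) / p, a.2)

theorem mem_classPart (hp : 0 < p) {i : ℤ} {a : ℤ × Y × Z} :
    a ∈ classPart p i A ↔ (i + p * a.1, a.2) ∈ A := by
  have hp' : (p : ℤ) ≠ 0 := by exact_mod_cast hp.ne'
  simp only [classPart, Finset.mem_image, Finset.mem_filter]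
  constructor
  · rintro ⟨b, ⟨hb, c, hc⟩, rfl⟩
    have : i + p * ((b.1 - i) / p) = b.1 := by
      rw [hc, Int.mul_ediv_cancel_left _ hp']; linarith
    simpa [this] using hb
  · intro h
    refine ⟨_, ⟨h, by simp⟩, Prod.ext ?_ rfl⟩
    simp only [add_sub_cancel_left]
    exact Int.mul_ediv_cancel_left _ hp'

theorem sum_classPart (hp : 0 < p) (i : ℤ) (A : Finset (ℤ × Y × Z)) (f : ℤ × Y × Z → ℤ) :
    ∑ a ∈ classPart p i A, f a
      = ∑ a ∈ A.filter (fun a => (p : ℤ) ∣ a.1 - i), f ((a.1 - i) / p, a.2) := by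
  unfold classPart
  rw [Finset.sum_image]
  rintro a ha b hb hab
  simp only [Finset.coe_filter, Set.mem_ofPred_eq] at ha hb
  obtain ⟨c, hc⟩ := ha.2
  obtain ⟨d, hd⟩ := hb.2
  have hp' : (p : ℤ) ≠ 0 := by exact_mod_cast hp.ne'
  simp only [hc, hd, Int.mul_ediv_cancel_left _ hp', Prod.mk.injEq] at hab
  refine Prod.ext ?_ hab.2
  have := hab.1
  subst this
  linarith

theorem mass_classPart (hp : 0 < p) (i : ℤ) (A : Finset (ℤ × Y × Z)) (k : ℕ) (x : ℤ) (ψ θ) :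
    mass (classPart p i A) (resInd p k x) ψ θ = mass A (resInd p (k + 1) (i + p * x)) ψ θ := by
  have hp' : (p : ℤ) ≠ 0 := by exact_mod_cast hp.ne'
  unfold mass
  rw [sum_classPart hp, Finset.sum_filter]
  refine Finset.sum_congr rfl fun a _ => ?_
  split_ifs with h
  · obtain ⟨c, hc⟩ := h
    have : resInd p k x ((a.1 - i) / p) = resInd p (k + 1) (i + p * x) a.1 := by
      unfold resInd
      rw [hc, Int.mul_ediv_cancel_left _ hp',
        show a.1 - (i + p * x) = (c - x) * p by linear_combination hc, pow_succ]
      simp only [mul_dvd_mul_iff_right hp']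
    simp [this]
  · have : resInd p (k + 1) (i + p * x) a.1 = 0 := by
      refine if_neg fun hd => h ?_
      have h1 : (p : ℤ) ∣ a.1 - (i + p * x) := (dvd_pow_self _ (Nat.succ_ne_zero k)).trans hd
      rw [show a.1 - i = a.1 - (i + p * x) + p * x by ring]
      exact dvd_add h1 (dvd_mul_right _ _)
    simp [this]

theorem card_classPart (hp : 0 < p) (i : ℤ) (A : Finset (ℤ × Y × Z)) :
    ((classPart p i A).card : ℤ) = mass A (resInd p 1 i) 1 1 := by
  rw [← mass_one, ← resInd_zero p 0, mass_classPart hp]; simp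

theorem Vanishes.shrink (hp : 0 < p) {k : ℕ} (hk : k ≠ 0) {ε δ : Prop} (i : ℤ)
    (h : Vanishes p A (k + 1) ε δ) : Vanishes p (classPart p i A) k ε δ := by
  obtain ⟨j, rfl⟩ := Nat.exists_eq_succ_of_ne_zero hk
  rintro φ ψ θ ⟨x, x', hx, rfl⟩ hψ hθ
  rw [mass_sub_left, mass_classPart hp, mass_classPart hp, ← mass_sub_left]
  refine h _ ψ θ (levelTest_succ p ?_) hψ hθ
  rw [show (i + p * x) - (i + p * x') = (x - x') * p by ring, pow_succ]
  exact mul_dvd_mul_right hx _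

theorem vanishes_of_shrink (hp : 0 < p) {k : ℕ} (hk : k ≠ 0) {ε δ : Prop}
    (h : ∀ i, Vanishes p (classPart p i A) k ε δ) : Vanishes p A (k + 1) ε δ := by
  obtain ⟨j, rfl⟩ := Nat.exists_eq_succ_of_ne_zero hk
  rintro φ ψ θ ⟨x, x', hx, rfl⟩ hψ hθ
  obtain ⟨c, hc⟩ := hx
  have e : x' = x + p * (-(p : ℤ) ^ j * c) := by rw [pow_succ] at hc; linear_combination -hc
  have := h x (resInd p (j + 1) 0 - resInd p (j + 1) (-(p : ℤ) ^ j * c)) ψ θ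
    (levelTest_succ p ⟨c, by ring⟩) hψ hθ
  rw [mass_sub_left, mass_classPart hp, mass_classPart hp, ← mass_sub_left, ← e] at this
  simpa using this

theorem Vanishes.mass_class {ε δ : Prop} (h : Vanishes p A 1 ε δ) {ψ : Y → ℤ}
    {θ : Z → ℤ} (hψ : FiberTest ε ψ) (hθ : FiberTest δ θ) (i j : ℤ) :
    mass A (resInd p 1 i) ψ θ = mass A (resInd p 1 j) ψ θ := by
  have := h _ ψ θ (levelTest_succ p (k := 0) (x := i) (x' := j) (by simp)) hψ hθ
  rw [mass_sub_left] at this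
  linarith

theorem Vanishes.shrink_zero (hp : 0 < p) {ε δ : Prop} (h0 : Vanishes p A 0 ε δ)
    (h1 : Vanishes p A 1 ε δ) (i : ℤ) : Vanishes p (classPart p i A) 0 ε δ := by
  rintro φ ψ θ rfl hψ hθ
  have h := h0 1 ψ θ rfl hψ hθ
  rw [← resInd_zero p i, ← sum_mass_left hp,
    Finset.sum_congr rfl fun j _ => h1.mass_class hψ hθ _ i] at h
  rw [← resInd_zero p 0, mass_classPart hp]
  simpa [hp.ne'] using h

theorem mass_class_eq {i : ℤ} (hA : ∀ a ∈ A, (p : ℤ) ∣ a.1 - i) (ψ : Y → ℤ) (θ : Z → ℤ) :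
    mass A (resInd p 1 i) ψ θ = mass A 1 ψ θ := by
  refine mass_congr fun a ha => ?_
  have : resInd p 1 i a.1 = 1 := resInd_eq_one.2 (by simpa using hA a ha)
  simp [this]

theorem HalfPair.shrink (hp : 0 < p) {B' : Finset (ℤ × Y × Z)} (h : HalfPair p (n + 1) A B)
    (hB : ∀ k ≤ n, ∀ ε δ, Vanishes p B k ε δ → Vanishes p B' k ε δ) (i : ℤ) :
    HalfPair p n (classPart p i A) B' := by
  intro a ha a' ha' hne k hk
  have hk' := (level_mul hp.ne' (i := i)).2 hk
  refine hB k hk'.2 _ _ (h _ ((mem_classPart hp).1 ha) _ ((mem_classPart hp).1 ha') ?_ k hk'.1)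
  intro he
  have hp' : (p : ℤ) ≠ 0 := by exact_mod_cast hp.ne'
  simp only [Prod.mk.injEq, add_right_inj, mul_eq_mul_left_iff, hp', or_false] at he
  exact hne (Prod.ext he.1 he.2)

theorem HalfPair.shrink_right (hp : 0 < p) {B' : Finset (ℤ × Y × Z)} (h : HalfPair p (n + 1) B A)
    (hB : B' ⊆ B) (i : ℤ)
    (h0 : ∀ b ∈ B', ∀ b' ∈ B', b ≠ b' → (p : ℤ) ^ n ∣ b.1 - b'.1 →
      Vanishes p (classPart p i A) 0 (b.2.1 ≠ b'.2.1) (b.2.2 ≠ b'.2.2)) :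
    HalfPair p n B' (classPart p i A) := by
  intro b hb b' hb' hne k hk
  rcases Nat.eq_zero_or_pos k with rfl | hpos
  · exact h0 b hb b' hb' hne hk
  · exact (h b (hB hb) b' (hB hb') hne (k + 1) ((level_succ hpos.ne').2 hk)).shrink hp hpos.ne' i

theorem CombPair.shrink (hp : 0 < p) (h : CombPair p (n + 1) A B) {i : ℤ}
    (hA : ∀ a ∈ A, (p : ℤ) ∣ a.1 - i) : CombPair p n (classPart p i A) B := by
  refine ⟨?_, h.2.1.shrink hp (fun _ _ _ _ h => h) i, h.2.2.shrink_right hp subset_rfl i ?_⟩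
  · have := card_classPart hp i A
    rw [mass_class_eq hA, mass_one] at this
    rw [← h.1]; exact_mod_cast this
  · rintro b hb b' hb' hne hd φ ψ θ rfl hψ hθ
    rw [← resInd_zero p 0, mass_classPart hp]
    simp only [zero_add, mul_zero, add_zero]
    by_cases h0 : (p : ℤ) ^ (n + 1) ∣ b.1 - b'.1
    · rw [mass_class_eq hA]
      exact h.2.2 b hb b' hb' hne 0 h0 1 ψ θ rfl hψ hθ
    · by_cases hp1 : p = 1
      · subst hp1; simp at h0
      have h1 := h.2.2 b hb b' hb' hne 1 (level_one.2 ⟨hd, h0⟩)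
      rw [h1.mass_class hψ hθ i (i + 1)]
      unfold mass
      refine Finset.sum_eq_zero fun a ha => ?_
      have : resInd p 1 (i + 1) a.1 = 0 := by
        refine if_neg fun hd => hp1 ?_
        have h2 := dvd_sub (hA a ha) (by simpa using hd)
        rw [show a.1 - i - (a.1 - (i + 1)) = 1 by ring] at h2
        exact Int.natAbs_of_isUnit (isUnit_of_dvd_one h2)
      simp [this]

/-- `A` is a union of cosets of the subgroup of order `p` modulo `p ^ n`. -/
def IsPUnion (p n : ℕ) (A : Finset (ℤ × Y × Z)) : Prop :=
  ∀ a ∈ A, ∀ x, (p : ℤ) ^ (n - 1) ∣ a.1 - x → ∃ a' ∈ A, (p : ℤ) ^ n ∣ a'.1 - x ∧ a'.2 = a.2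

theorem IsPUnion.exists_reps (hp : 0 < p) (hU : IsPUnion p (n + 1) A)
    (hA : ∀ a ∈ A, ∀ a' ∈ A, (p : ℤ) ^ (n + 1) ∣ a.1 - a'.1 → a.2 = a'.2 → a = a') :
    ∃ R ⊆ A, (∀ a ∈ A, ∃ b ∈ R, (p : ℤ) ^ n ∣ a.1 - b.1 ∧ a.2 = b.2) ∧
      (∀ b ∈ R, ∀ b' ∈ R, (p : ℤ) ^ n ∣ b.1 - b'.1 → b.2 = b'.2 → b = b') ∧
      ∀ φ ψ θ, (∀ t x, (p : ℤ) ^ n ∣ t - x → φ t = φ x) → mass A φ ψ θ = p * mass R φ ψ θ := by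
  classical
  let f : ℤ × Y × Z → ZMod (p ^ n) × Y × Z := fun a => (a.1, a.2)
  have hf : ∀ a b, f a = f b ↔ (p : ℤ) ^ n ∣ a.1 - b.1 ∧ a.2 = b.2 := by
    intro a b
    simp only [f, Prod.mk.injEq]
    rw [eq_comm, ZMod.intCast_eq_intCast_iff_dvd_sub]
    simp
  obtain ⟨R, hRA, himg, hinj⟩ : ∃ R ⊆ A, R.image f = A.image f ∧ Set.InjOn f R := by
    obtain ⟨R, h1, h2, h3⟩ := Finset.exists_subset_injOn_image_eq_of_surjOn (A : Set _)
      (A.image f) (by rw [Finset.coe_image]; exact Set.surjOn_image f A)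
    exact ⟨R, by exact_mod_cast h1, h3, h2⟩
  have hrep : ∀ a ∈ A, ∃ b ∈ R, (p : ℤ) ^ n ∣ a.1 - b.1 ∧ a.2 = b.2 := by
    intro a ha
    have : f a ∈ R.image f := by rw [himg]; exact Finset.mem_image_of_mem f ha
    obtain ⟨b, hb, hab⟩ := Finset.mem_image.1 this
    exact ⟨b, hb, (hf a b).1 hab.symm⟩
  have huniq : ∀ b ∈ R, ∀ b' ∈ R, (p : ℤ) ^ n ∣ b.1 - b'.1 → b.2 = b'.2 → b = b' :=
    fun b hb b' hb' h h2 => hinj hb hb' ((hf b b').2 ⟨h, h2⟩)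
  refine ⟨R, hRA, hrep, huniq, fun φ ψ θ hφ => ?_⟩
  have hex : ∀ b : R, ∀ i : ℕ, ∃ a ∈ A, (p : ℤ) ^ (n + 1) ∣ a.1 - (b.1.1 + i * (p : ℤ) ^ n) ∧
      a.2 = b.1.2 := fun b i => hU b (hRA b.2) _ (by simp)
  choose s hsA hs hs2 using hex
  have hsn : ∀ b i, (p : ℤ) ^ n ∣ (s b i).1 - b.1.1 := fun b i => by
    have := dvd_add ((pow_dvd_pow (p : ℤ) (Nat.le_succ n)).trans (hs b i))
      (dvd_mul_left ((p : ℤ) ^ n) i)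
    rwa [show (s b i).1 - (b.1.1 + i * (p : ℤ) ^ n) + i * (p : ℤ) ^ n = (s b i).1 - b.1.1 by ring]
      at this
  have key : mass A φ ψ θ = ∑ x ∈ R.attach ×ˢ Finset.range p,
      φ x.1.1.1 * ψ x.1.1.2.1 * θ x.1.1.2.2 := by
    unfold mass
    symm
    refine Finset.sum_bij (fun x _ => s x.1 x.2) (fun x _ => hsA _ _) ?_ ?_ ?_
    · rintro ⟨b, i⟩ hb ⟨b', i'⟩ hb' he
      simp only at he
      have h1 : b = b' := by
        refine Subtype.ext (huniq _ b.2 _ b'.2 ?_ ?_)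
        · have := dvd_sub (hsn b' i') (he ▸ hsn b i)
          rwa [show (s b' i').1 - b'.1.1 - ((s b' i').1 - b.1.1) = b.1.1 - b'.1.1 by ring] at this
        · rw [← hs2 b i, ← hs2 b' i', he]
      subst h1
      have h3 := hs b i'
      rw [← he] at h3
      simp only [Finset.mem_product] at hb hb'
      have := (exists_dvd_sub_of_range hp n (hsn b i)).unique ⟨hb.2, hs b i⟩ ⟨hb'.2, h3⟩
      rw [this]
    · intro a ha
      obtain ⟨b, hb, hab, hab2⟩ := hrep a ha
      obtain ⟨i, ⟨hi, hd⟩, -⟩ := exists_dvd_sub_of_range hp n hab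
      refine ⟨(⟨b, hb⟩, i), by simp_all, ?_⟩
      refine hA _ (hsA _ _) _ ha ?_ (by rw [hs2, hab2])
      have := dvd_sub (hs ⟨b, hb⟩ i) hd
      rwa [sub_sub_sub_cancel_right] at this
    · rintro ⟨b, i⟩ _
      simp only [hs2]
      rw [hφ _ _ (hsn b i)]
  rw [key, Finset.sum_product]
  simp only [Finset.sum_const, Finset.card_range, nsmul_eq_mul]
  rw [← Finset.mul_sum, Finset.sum_attach R fun b => φ b.1 * ψ b.2.1 * θ b.2.2]
  rfl

theorem levelTest_periodic {k : ℕ} (hk : k ≤ n) {φ : ℤ → ℤ} (hφ : LevelTest p k φ) (t x : ℤ)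
    (h : (p : ℤ) ^ n ∣ t - x) : φ t = φ x := by
  cases k with
  | zero => cases hφ; rfl
  | succ k =>
    obtain ⟨u, v, -, rfl⟩ := hφ
    have hd : (p : ℤ) ^ (k + 1) ∣ t - x := (pow_dvd_pow _ hk).trans h
    have : ∀ w, resInd p (k + 1) w t = resInd p (k + 1) w x := fun w => by
      unfold resInd
      rw [show t - w = (t - x) + (x - w) by ring]
      simp only [dvd_add_right hd]
    simp [this]

theorem IsPUnion.exists_level_one (hp : 1 < p) (hU : IsPUnion p (n + 1) A) {a : ℤ × Y × Z}
    (ha : a ∈ A) : ∃ a' ∈ A, Level p (n + 1) 1 a.1 a'.1 ∧ a.2 = a'.2 := by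
  obtain ⟨a', ha', hd, h2⟩ := hU a ha (a.1 + (p : ℤ) ^ n) (by simp)
  have hpn : (p : ℤ) ^ n ≠ 0 := pow_ne_zero _ (by exact_mod_cast (by omega : p ≠ 0))
  refine ⟨a', ha', level_one.2 ⟨?_, fun h => ?_⟩, h2.symm⟩
  · have := (pow_dvd_pow (p : ℤ) (Nat.le_succ n)).trans hd
    have := dvd_add this (dvd_refl ((p : ℤ) ^ n))
    rw [show a'.1 - (a.1 + (p : ℤ) ^ n) + (p : ℤ) ^ n = a'.1 - a.1 by ring] at this
    exact (dvd_sub_comm).1 this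
  · have := dvd_add h hd
    rw [show a.1 - a'.1 + (a'.1 - (a.1 + (p : ℤ) ^ n)) = (-1) * (p : ℤ) ^ n by ring, pow_succ',
      mul_dvd_mul_iff_right hpn] at this
    have h4 := Int.natAbs_dvd_natAbs.2 this
    simp at h4
    omega

theorem CombPair.vanishes_one (hp : 1 < p) (h : CombPair p (n + 1) A B) (hA : A.Nonempty)
    (hU : IsPUnion p (n + 1) A) : Vanishes p B 1 False False := by
  obtain ⟨a, ha⟩ := hA
  obtain ⟨a', ha', hl, h2⟩ := hU.exists_level_one hp ha
  refine (h.2.1 a ha a' ha' ?_ 1 hl).congr (by simp [h2]) (by simp [h2])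
  rintro rfl
  exact (level_one.1 hl).2 (by simp)

theorem CombPair.exists_reps (hp : 1 < p) (h : CombPair p (n + 1) A B) (hA : A.Nonempty)
    (hU : IsPUnion p (n + 1) A) :
    ∃ R ⊆ A, (∀ a ∈ A, ∃ b ∈ R, (p : ℤ) ^ n ∣ a.1 - b.1 ∧ a.2 = b.2) ∧ A.card = p * R.card ∧
      (∀ k ≤ n, ∀ ε δ, Vanishes p A k ε δ ↔ Vanishes p R k ε δ) ∧
      ∀ i, CombPair p n R (classPart p i B) := by
  have hp0 : 0 < p := by omega
  have hp' : (p : ℤ) ≠ 0 := by exact_mod_cast hp0.ne'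
  obtain ⟨R, hRA, hrep, huniq, hmass⟩ := hU.exists_reps hp0
    fun a ha a' ha' => h.ext_of_dvd ha ha'
  have hcard : A.card = p * R.card := by
    have := hmass 1 1 1 fun _ _ _ => rfl
    rw [mass_one, mass_one] at this
    exact_mod_cast this
  have hV : ∀ k ≤ n, ∀ ε δ, Vanishes p A k ε δ ↔ Vanishes p R k ε δ := by
    intro k hk ε δ
    refine forall_congr' fun φ => forall_congr' fun ψ => forall_congr' fun θ =>
      forall_congr' fun hφ => forall_congr' fun hψ => forall_congr' fun hθ => ?_
    rw [hmass φ ψ θ (levelTest_periodic hk hφ)]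
    simp [hp0.ne']
  have hB1 := h.vanishes_one hp hA hU
  refine ⟨R, hRA, hrep, hcard, hV, fun i => ⟨?_, ?_, ?_⟩⟩
  · have h1 := hB1.card_dvd_left hp0 i
    rw [← card_classPart hp0, ← h.1, hcard] at h1
    push_cast at h1
    exact_mod_cast mul_left_cancel₀ hp' h1
  · refine h.2.1.shrink_right hp0 hRA i fun b hb b' hb' hne hd => ?_
    have hne2 : b.2 ≠ b'.2 := fun h2 => hne (huniq b hb b' hb' hd h2)
    refine Vanishes.shrink_zero hp0 ?_ ?_ i
    · obtain ⟨c, hc, hcd, hc2⟩ := hU b' (hRA hb') b.1 (dvd_sub_comm.1 hd)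
      have := h.2.1 b (hRA hb) c hc (fun e => hne2 (by rw [e, hc2])) 0 (dvd_sub_comm.1 hcd)
      rwa [hc2] at this
    · obtain ⟨e, he, hel, he2⟩ := hU.exists_level_one hp (hRA hb)
      obtain ⟨c, hc, hcd, hc2⟩ := hU b' (hRA hb') e.1 (by
        have := dvd_add (dvd_sub_comm.1 hd) (level_one.1 hel).1
        rwa [show b'.1 - b.1 + (b.1 - e.1) = b'.1 - e.1 by ring] at this)
      have := h.2.1 b (hRA hb) c hc (fun e => hne2 (by rw [e, hc2])) 1
        (hel.congr one_ne_zero (by simp) (by simpa using dvd_sub_comm.1 hcd))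
      rwa [hc2] at this
  · exact h.2.2.shrink hp0 (fun k hk ε δ => (hV k hk ε δ).1) i

theorem IsPUnion.vanishes_top (hU : IsPUnion p (n + 1) A)
    (hA : ∀ a ∈ A, ∀ a' ∈ A, (p : ℤ) ^ (n + 1) ∣ a.1 - a'.1 → a.2 = a'.2 → a = a') :
    Vanishes p A (n + 1) False False := by
  have hle : ∀ x x', (p : ℤ) ^ n ∣ x - x' → mass A (resInd p (n + 1) x) 1 1
      ≤ mass A (resInd p (n + 1) x') 1 1 := by
    intro x x' hx
    have hm : ∀ x, mass A (resInd p (n + 1) x) 1 1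
        = ((A.filter fun a => (p : ℤ) ^ (n + 1) ∣ a.1 - x).card : ℤ) := fun x => by
      simp [mass, resInd]
    rw [hm, hm, Nat.cast_le]
    have hex : ∀ a : ℤ × Y × Z, a ∈ A ∧ (p : ℤ) ^ (n + 1) ∣ a.1 - x → ∃ a' ∈ A,
        (p : ℤ) ^ (n + 1) ∣ a'.1 - x' ∧ a'.2 = a.2 := by
      rintro a ⟨ha, hd⟩
      refine hU a ha x' ?_
      have := dvd_add ((pow_dvd_pow (p : ℤ) (Nat.le_succ n)).trans hd) hx
      simpa using this
    choose! s hs1 hs2 hs3 using hex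
    refine Finset.card_le_card_of_injOn s (fun a ha => ?_) fun a ha b hb he => ?_
    · simp only [Finset.coe_filter, Set.mem_ofPred_eq] at ha ⊢
      exact ⟨hs1 a ha, hs2 a ha⟩
    · simp only [Finset.coe_filter, Set.mem_ofPred_eq] at ha hb
      refine hA a ha.1 b hb.1 ?_ (by rw [← hs3 a ha, ← hs3 b hb, he])
      simpa using dvd_sub ha.2 hb.2
  rintro φ ψ θ ⟨x, x', hx, rfl⟩ hψ hθ
  rw [hψ.2 not_false, hθ.2 not_false, mass_sub_left,
    le_antisymm (hle x x' hx) (hle x' x (dvd_sub_comm.1 hx)), sub_self]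

/-! ### Exchanging and removing coordinates -/

/-- Exchange of the last two coordinates. -/
def swapYZ (A : Finset (ℤ × Y × Z)) : Finset (ℤ × Z × Y) :=
  A.image fun a => (a.1, a.2.2, a.2.1)

theorem mem_swapYZ {a : ℤ × Z × Y} : a ∈ swapYZ A ↔ (a.1, a.2.2, a.2.1) ∈ A := by
  simp only [swapYZ, Finset.mem_image]
  constructor
  · rintro ⟨b, hb, rfl⟩; exact hb
  · exact fun h => ⟨_, h, rfl⟩

theorem swap_injective : Function.Injective fun a : ℤ × Y × Z => (a.1, a.2.2, a.2.1) := by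
  rintro ⟨a, b, c⟩ ⟨a', b', c'⟩ h
  simp_all

theorem card_swapYZ (A : Finset (ℤ × Y × Z)) : (swapYZ A).card = A.card :=
  Finset.card_image_of_injective _ swap_injective

theorem mass_swapYZ (A : Finset (ℤ × Y × Z)) (φ ψ θ) :
    mass (swapYZ A) φ θ ψ = mass A φ ψ θ := by
  unfold mass swapYZ
  rw [Finset.sum_image swap_injective.injOn]
  exact Finset.sum_congr rfl fun a _ => by ring

theorem vanishes_swapYZ {k : ℕ} {ε δ : Prop} :
    Vanishes p (swapYZ A) k δ ε ↔ Vanishes p A k ε δ := by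
  constructor
  · intro h φ ψ θ hφ hψ hθ
    rw [← mass_swapYZ]; exact h φ θ ψ hφ hθ hψ
  · intro h φ ψ θ hφ hψ hθ
    rw [mass_swapYZ]; exact h φ θ ψ hφ hθ hψ

theorem HalfPair.swapYZ (h : HalfPair p n A B) : HalfPair p n (swapYZ A) (swapYZ B) := by
  intro a ha a' ha' hne k hk
  refine vanishes_swapYZ.2 (h _ (mem_swapYZ.1 ha) _ (mem_swapYZ.1 ha') (fun he => hne ?_) k hk)
  obtain ⟨x, y, z⟩ := a
  obtain ⟨x', y', z'⟩ := a'
  simp_all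

theorem CombPair.swapYZ (h : CombPair p n A B) : CombPair p n (swapYZ A) (swapYZ B) :=
  ⟨by rw [card_swapYZ, card_swapYZ, h.1], h.2.1.swapYZ, h.2.2.swapYZ⟩

theorem Vanishes.of_const_mid [Nontrivial Y] {k : ℕ} {ε δ : Prop} {y₀ : Y}
    (hA : ∀ a ∈ A, a.2.1 = y₀) (h : Vanishes p A k ε δ) : Vanishes p A k False δ := by
  rintro φ ψ θ hφ hψ hθ
  by_cases hε : ε
  · obtain ⟨y₁, hy⟩ := exists_ne y₀
    rw [hψ.2 not_false, ← h φ _ θ hφ (fiberTest_of hε y₀ y₁) hθ]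
    refine mass_congr fun a ha => ?_
    simp [ptInd, hA a ha, hy.symm]
  · exact h φ ψ θ hφ ⟨fun h => absurd h hε, fun _ => hψ.2 not_false⟩ hθ

theorem Vanishes.of_const_right [Nontrivial Z] {k : ℕ} {ε δ : Prop} {z₀ : Z}
    (hA : ∀ a ∈ A, a.2.2 = z₀) (h : Vanishes p A k ε δ) : Vanishes p A k ε False :=
  vanishes_swapYZ.1 ((vanishes_swapYZ.2 h).of_const_mid fun _ ha => hA _ (mem_swapYZ.1 ha))

/-- Replacement of all second coordinates by a given one. -/
def setMid (y₀ : Y) (A : Finset (ℤ × Y × Z)) : Finset (ℤ × Y × Z) :=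
  A.image fun a => (a.1, y₀, a.2.2)

theorem CombPair.flattenY_injOn [Nontrivial Y] (h : CombPair p n A B) {y₀ : Y}
    (hB : ∀ b ∈ B, b.2.1 = y₀) (y₁ : Y) :
    Set.InjOn (fun a : ℤ × Y × Z => (a.1, y₁, a.2.2)) A := by
  intro a ha a' ha' he
  by_contra hne
  simp only [Prod.mk.injEq, true_and] at he
  have := (h.2.1 a ha a' ha' hne 0 (by rw [level_zero, he.1, sub_self]; exact dvd_zero _)).of_const_mid hB
  have := (this.congr Iff.rfl (δ' := False) (by simp [he.2])).card_eq_zero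
  rw [← h.1, Finset.card_eq_zero] at this
  simp [this] at ha

theorem CombPair.mass_flattenY [Nontrivial Y] (h : CombPair p n A B) {y₀ : Y}
    (hB : ∀ b ∈ B, b.2.1 = y₀) (y₁ : Y) (φ θ) :
    mass (setMid y₁ A) φ 1 θ = mass A φ 1 θ := by
  unfold mass setMid
  rw [Finset.sum_image (h.flattenY_injOn hB y₁)]
  rfl

theorem CombPair.flattenY [Nontrivial Y] (h : CombPair p n A B) {y₀ : Y}
    (hB : ∀ b ∈ B, b.2.1 = y₀) (y₁ : Y) : CombPair p n (setMid y₁ A) B := by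
  refine ⟨?_, ?_, ?_⟩
  · rw [← h.1]; exact Finset.card_image_of_injOn (h.flattenY_injOn hB y₁)
  · intro a ha a' ha' hne k hk
    obtain ⟨b, hb, rfl⟩ := Finset.mem_image.1 ha
    obtain ⟨b', hb', rfl⟩ := Finset.mem_image.1 ha'
    refine ((h.2.1 b hb b' hb' (fun e => hne (by rw [e])) k hk).of_const_mid hB).congr ?_ Iff.rfl
    simp
  · rintro b hb b' hb' hne k hk φ ψ θ hφ hψ hθ
    have e : ¬(b.2.1 ≠ b'.2.1) := by simp [hB b hb, hB b' hb']
    rw [hψ.2 e, h.mass_flattenY hB]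
    exact h.2.2 b hb b' hb' hne k hk φ 1 θ hφ (fiberTest_of_not e) hθ

theorem CombPair.vanishes_of_flattenY [Nontrivial Y] (h : CombPair p n A B) {y₀ : Y}
    (hB : ∀ b ∈ B, b.2.1 = y₀) (y₁ : Y) {k : ℕ} {δ : Prop} :
    Vanishes p (setMid y₁ A) k False δ ↔ Vanishes p A k False δ := by
  refine forall_congr' fun φ => forall_congr' fun ψ => forall_congr' fun θ =>
      forall_congr' fun hφ => forall_congr' fun hψ => forall_congr' fun hθ => ?_
  rw [hψ.2 not_false, h.mass_flattenY hB]

end Reductions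

section Good

variable {Y Z : Type*} [DecidableEq Y] [DecidableEq Z] {p n : ℕ} {A B : Finset (ℤ × Y × Z)}
  {C : Y × Z → Y × Z → Prop}

/-- For distinct elements of `A` with `C`-related fibers, `B` vanishes at the `p`-part of their
difference, which is nonzero. -/
def Good (p n : ℕ) (C : Y × Z → Y × Z → Prop) (A B : Finset (ℤ × Y × Z)) : Prop :=
  ∀ a ∈ A, ∀ a' ∈ A, a ≠ a' → C a.2 a'.2 → ∀ k, Level p n k a.1 a'.1 →
    k ≠ 0 ∧ Vanishes p B k False False

theorem CombPair.good_of_snd_eq (h : CombPair p n A B) {a a' : ℤ × Y × Z} (ha : a ∈ A)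
    (ha' : a' ∈ A) (hne : a ≠ a') (h2 : a.2 = a'.2) {k : ℕ} (hk : Level p n k a.1 a'.1) :
    k ≠ 0 ∧ Vanishes p B k False False := by
  refine ⟨?_, (h.2.1 a ha a' ha' hne k hk).congr (by simp [h2]) (by simp [h2])⟩
  rintro rfl
  exact hne (h.ext_of_dvd ha ha' hk h2)

theorem CombPair.not_level_zero [Fintype Z] (h : CombPair p n A B)
    (hr : ¬Fintype.card Z ∣ A.card) {a a' : ℤ × Y × Z} (ha : a ∈ A) (ha' : a' ∈ A) (hne : a ≠ a')
    (hy : a.2.1 = a'.2.1) : ¬(p : ℤ) ^ n ∣ a.1 - a'.1 := by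
  intro hd
  by_cases hz : a.2.2 = a'.2.2
  · exact hne (h.ext_of_dvd ha ha' hd (Prod.ext hy hz))
  · have h0 := (h.2.1 a ha a' ha' hne 0 hd).congr (ε' := False) (δ' := True) (by simp [hy])
      (by simp [hz])
    refine hr ?_
    rw [h.1]
    exact_mod_cast Dvd.intro _ (h0.card_dvd_right a.2.2).symm

theorem vanishes_of_shrink_of_class (hp : 0 < p) {k : ℕ} (hk : k ≠ 0) {ε δ : Prop} {i : ℤ}
    (hA : ∀ a ∈ A, (p : ℤ) ∣ a.1 - i) (h : Vanishes p (classPart p i A) k ε δ) :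
    Vanishes p A (k + 1) ε δ := by
  obtain ⟨j, rfl⟩ := Nat.exists_eq_succ_of_ne_zero hk
  have hpj : (p : ℤ) ∣ (p : ℤ) ^ (j + 1) := dvd_pow_self _ (Nat.succ_ne_zero j)
  rintro φ ψ θ ⟨x, x', hx, rfl⟩ hψ hθ
  by_cases hi : (p : ℤ) ∣ x - i
  · obtain ⟨c, hc⟩ := hi
    obtain ⟨d, hd⟩ : (p : ℤ) ∣ x' - i := by
      have := dvd_sub ⟨c, hc⟩ (hpj.trans hx)
      rwa [show x - i - (x - x') = x' - i by ring] at this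
    have e : x = i + p * c := by linarith
    have e' : x' = i + p * d := by linarith
    rw [e, e', mass_sub_left, ← mass_classPart hp, ← mass_classPart hp, ← mass_sub_left]
    refine h _ ψ θ (levelTest_succ p ?_) hψ hθ
    have hp' : (p : ℤ) ≠ 0 := by exact_mod_cast hp.ne'
    rw [e, e', pow_succ, show (i + p * c) - (i + p * d) = (c - d) * p by ring] at hx
    exact (mul_dvd_mul_iff_right hp').1 hx
  · unfold mass
    refine Finset.sum_eq_zero fun a ha => ?_
    have key : ∀ w, ¬(p : ℤ) ∣ w - i → resInd p (j + 2) w a.1 = 0 := by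
      refine fun w hw => if_neg fun hd => hw ?_
      have := dvd_sub (hA a ha) ((dvd_pow_self _ (Nat.succ_ne_zero _)).trans hd)
      rwa [show a.1 - i - (a.1 - w) = w - i by ring] at this
    have hi' : ¬(p : ℤ) ∣ x' - i := fun hd => hi <| by
      have := dvd_add hd (hpj.trans hx)
      rwa [show x' - i + (x - x') = x - i by ring] at this
    simp [key x hi, key x' hi']

theorem CombPair.good_of_class_left (hp : 0 < p) (h : CombPair p (n + 1) A B) {i : ℤ}
    (hA : ∀ a ∈ A, (p : ℤ) ∣ a.1 - i) (hg : CombPair p n (classPart p i A) B →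
      Good p n C (classPart p i A) B) : Good p (n + 1) C A B := by
  intro a ha a' ha' hne hC k hk
  have hp' : (p : ℤ) ≠ 0 := by exact_mod_cast hp.ne'
  obtain ⟨x, u⟩ := a
  obtain ⟨x', u'⟩ := a'
  obtain ⟨c, hc⟩ := hA _ ha
  obtain ⟨c', hc'⟩ := hA _ ha'
  obtain rfl : x = i + p * c := by simp only at hc; linarith
  obtain rfl : x' = i + p * c' := by simp only at hc'; linarith
  refine hg (h.shrink hp hA) (c, u) ((mem_classPart hp).2 ha) (c', u') ((mem_classPart hp).2 ha') ?_ hC k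
    (level_mul hp.ne'|>.1 ⟨hk, ?_⟩)
  · intro he
    simp only [Prod.mk.injEq] at he
    exact hne (by rw [he.1, he.2])
  · by_contra hkn
    obtain rfl : k = n + 1 := le_antisymm hk.le (by omega)
    refine level_top.1 hk ?_
    simp only
    rw [show (i + p * c) - (i + p * c') = p * (c - c') by ring]
    exact dvd_mul_right _ _

theorem CombPair.good_of_class_right (hp : 0 < p) (h : CombPair p (n + 1) A B) {i : ℤ}
    (hB : ∀ b ∈ B, (p : ℤ) ∣ b.1 - i) (hg : CombPair p n A (classPart p i B) →
      Good p n C A (classPart p i B)) : Good p (n + 1) C A B := by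
  intro a ha a' ha' hne hC k hk
  have hg' := hg (h.symm.shrink hp hB).symm a ha a' ha' hne hC
  match k, hk with
  | 0, hk => exact absurd rfl (hg' 0 ((pow_dvd_pow _ (Nat.le_succ n)).trans hk)).1
  | 1, hk => exact absurd rfl (hg' 0 (level_one.1 hk).1).1
  | k + 2, hk =>
    exact ⟨Nat.succ_ne_zero _, vanishes_of_shrink_of_class hp k.succ_ne_zero hB
      (hg' (k + 1) ((level_succ k.succ_ne_zero).1 hk)).2⟩

theorem CombPair.good_of_isPUnion_left (hp : 1 < p) (h : CombPair p (n + 1) A B)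
    (hU : IsPUnion p (n + 1) A) (hg : ∀ R ⊆ A, ∀ B', R.Nonempty → A.card = p * R.card →
      (∀ b ∈ B', ∃ x, (x, b.2) ∈ B) → CombPair p n R B' → Good p n C R B') : Good p (n + 1) C A B := by
  intro a ha a' ha' hne hC k hk
  by_cases h2 : a.2 = a'.2
  · exact h.good_of_snd_eq ha ha' hne h2 hk
  have hp0 : 0 < p := by omega
  obtain ⟨R, hRA, hrep, hcard, -, hpair⟩ := h.exists_reps hp ⟨a, ha⟩ hU
  obtain ⟨b, hb, hbd, hb2⟩ := hrep a ha
  obtain ⟨b', hb', hbd', hb2'⟩ := hrep a' ha'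
  have hg' := fun i => hg R hRA (classPart p i B) ⟨b, hb⟩ hcard
    (fun c hc => ⟨_, (mem_classPart hp0).1 hc⟩) (hpair i) b hb b' hb'
    (fun e => h2 (by rw [hb2, hb2', e])) (by rwa [← hb2, ← hb2'])
  match k, hk with
  | 0, hk =>
    refine absurd rfl (hg' 0 0 ?_).1
    have := dvd_sub ((pow_dvd_pow _ (Nat.le_succ n)).trans hk) (dvd_sub hbd hbd')
    rwa [show a.1 - a'.1 - (a.1 - b.1 - (a'.1 - b'.1)) = b.1 - b'.1 by ring] at this
  | 1, hk => exact ⟨one_ne_zero, h.vanishes_one hp ⟨a, ha⟩ hU⟩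
  | k + 2, hk =>
    refine ⟨Nat.succ_ne_zero _, vanishes_of_shrink hp0 k.succ_ne_zero fun i =>
      (hg' i (k + 1) ((level_succ k.succ_ne_zero).1 (hk.congr (Nat.succ_ne_zero _) ?_ ?_))).2⟩
    · exact (pow_dvd_pow _ (by have := hk.le; omega)).trans hbd
    · exact (pow_dvd_pow _ (by have := hk.le; omega)).trans hbd'

theorem CombPair.good_of_isPUnion_right (hp : 1 < p) (h : CombPair p (n + 1) A B)
    (hU : IsPUnion p (n + 1) B) (hg : ∀ A' R, R.Nonempty → A.card = p * R.card →
      CombPair p n A' R → Good p n C A' R) : Good p (n + 1) C A B := by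
  intro a ha a' ha' hne hC k hk
  have hp0 : 0 < p := by omega
  have hB : B.Nonempty := by
    rw [← Finset.card_pos, ← h.1]; exact Finset.card_pos.2 ⟨a, ha⟩
  by_cases hd : (p : ℤ) ∣ a.1 - a'.1
  · obtain ⟨R, -, hrep, hcard, hV, hpair⟩ := h.symm.exists_reps hp hB hU
    obtain ⟨b, hb⟩ := hB
    obtain ⟨c, hc, -⟩ := hrep b hb
    obtain ⟨d, hd⟩ := hd
    obtain ⟨x, u⟩ := a
    obtain ⟨x', u'⟩ := a'
    obtain rfl : x = x' + p * d := by simp only at hd; linarith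
    have hk' := (level_mul hp0.ne' (i := x') (x := d) (x' := 0) (n := n) (k := k)).1 ⟨by simpa using hk, by
      by_contra hkn
      obtain rfl : k = n + 1 := le_antisymm hk.le (by omega)
      exact level_top.1 hk (by simp)⟩
    have := hg (classPart p x' A) R ⟨c, hc⟩ (h.1.trans hcard) (hpair x').symm (d, u)
      ((mem_classPart hp0).2 ha) (0, u') ((mem_classPart hp0).2 (by simpa using ha'))
      (fun e => hne (by simp only [Prod.mk.injEq] at e; simp [e.1, e.2])) hC k hk'
    exact ⟨this.1, (hV k hk'.le _ _).2 this.2⟩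
  · have hl := (level_top (n := n)).2 hd
    obtain rfl : k = n + 1 := by
      by_contra hkn
      refine hd ?_
      have hkn : k ≤ n := by have := hk.le; omega
      rcases Nat.eq_zero_or_pos k with rfl | hk0
      · exact (dvd_pow_self _ (Nat.succ_ne_zero n)).trans hk
      · rw [level_iff hk0.ne'] at hk
        exact (dvd_pow_self _ (by omega)).trans hk.2.1
    exact ⟨Nat.succ_ne_zero n, hU.vanishes_top fun b hb b' hb' => h.symm.ext_of_dvd hb hb'⟩

theorem exists_cross {α β γ : Type*} {B : Finset α} {f : α → β} {g : α → γ}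
    (hf : ∃ b ∈ B, ∃ b' ∈ B, f b ≠ f b') (hg : ∃ b ∈ B, ∃ b' ∈ B, g b ≠ g b') :
    ∃ b ∈ B, ∃ b' ∈ B, f b ≠ f b' ∧ g b ≠ g b' := by
  obtain ⟨b, hb, b', hb', h⟩ := hf
  obtain ⟨c, hc, c', hc', h'⟩ := hg
  by_cases hgb : g b = g b'
  · obtain ⟨d, hd, hdg⟩ : ∃ d ∈ B, g d ≠ g b := by
      by_cases h1 : g c = g b
      · exact ⟨c', hc', fun h2 => h' (h1.trans h2.symm)⟩
      · exact ⟨c, hc, h1⟩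
    by_cases h1 : f d = f b
    · exact ⟨d, hd, b', hb', h1 ▸ h, hgb ▸ hdg⟩
    · exact ⟨d, hd, b, hb, h1, hdg⟩
  · exact ⟨b, hb, b', hb', h, hgb⟩

theorem exists_ne_of_not_const {α β : Type*} {B : Finset α} {f : α → β}
    (h : ¬∃ y, ∀ b ∈ B, f b = y) [Nonempty β] : ∃ b ∈ B, ∃ b' ∈ B, f b ≠ f b' := by
  push Not at h
  obtain ⟨b, hb, -⟩ := h (Classical.arbitrary β)
  obtain ⟨b', hb', hne⟩ := h (f b)
  exact ⟨b', hb', b, hb, hne⟩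

theorem exists_not_dvd_of_not_class (h : ¬∃ i, ∀ b ∈ B, (p : ℤ) ∣ b.1 - i) :
    ∃ b ∈ B, ∃ b' ∈ B, ((b.1 : ZMod p)) ≠ b'.1 := by
  push Not at h
  obtain ⟨b, hb, -⟩ := h 0
  obtain ⟨b', hb', hne⟩ := h b.1
  exact ⟨b, hb, b', hb', fun e => hne ((ZMod.intCast_eq_intCast_iff_dvd_sub _ _ _).1 e)⟩

theorem exists_cross_of_not_class {β : Type*} [Nonempty β] {f : ℤ × Y × Z → β}
    (h : ¬∃ i, ∀ b ∈ B, (p : ℤ) ∣ b.1 - i) (hf : ¬∃ y, ∀ b ∈ B, f b = y) :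
    ∃ b ∈ B, ∃ b' ∈ B, ¬(p : ℤ) ∣ b.1 - b'.1 ∧ f b ≠ f b' := by
  obtain ⟨b, hb, b', hb', h1, h2⟩ :=
    exists_cross (exists_not_dvd_of_not_class h) (exists_ne_of_not_const hf)
  exact ⟨b, hb, b', hb', fun hd => h1 ((ZMod.intCast_eq_intCast_iff_dvd_sub _ _ _).2 hd).symm, h2⟩

theorem CombPair.good_of_const_mid [Fintype Z] [Nontrivial Z] (hp : 1 < p)
    (h : CombPair p n A B) (hr : ¬Fintype.card Z ∣ A.card) {y y' : Y}
    (hA : ∀ a ∈ A, a.2.1 = y) (hB : ∀ b ∈ B, b.2.1 = y') : Good p n (fun _ _ => True) A B := by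
  have hp0 : 0 < p := by omega
  induction n generalizing A B with
  | zero =>
    intro a ha a' ha' hne _ k hk
    obtain rfl : k = 0 := by have := hk.le; omega
    exact absurd hk (h.not_level_zero hr ha ha' hne (by rw [hA a ha, hA a' ha']))
  | succ n ih =>
    have hcr : ∀ {m}, A.card = p * m → ¬Fintype.card Z ∣ m :=
      fun hm hd => hr (hm ▸ hd.mul_left p)
    by_cases hz : ∃ z, ∀ b ∈ B, b.2.2 = z
    · obtain ⟨z, hz⟩ := hz
      intro a ha a' ha' hne _ k hk
      refine ⟨?_, ((h.2.1 a ha a' ha' hne k hk).of_const_right hz).congr ?_ Iff.rfl⟩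
      · rintro rfl
        exact h.not_level_zero hr ha ha' hne (by rw [hA a ha, hA a' ha']) hk
      · simp [hA a ha, hA a' ha']
    by_cases hi : ∃ i, ∀ b ∈ B, (p : ℤ) ∣ b.1 - i
    · obtain ⟨i, hi⟩ := hi
      exact h.good_of_class_right hp0 hi fun h' => ih h' hr hA
        fun b hb => hB (i + p * b.1, b.2) ((mem_classPart hp0).1 hb)
    by_cases hU : IsPUnion p (n + 1) A
    · exact h.good_of_isPUnion_left hp hU fun R hRA B' _ hcard hB' hRB =>
        ih hRB (hcr hcard) (fun a ha => hA a (hRA ha)) fun b hb => by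
          obtain ⟨x, hx⟩ := hB' b hb
          exact hB (x, b.2) hx
    exfalso
    obtain ⟨b, hb, b', hb', hbi, hbz⟩ := exists_cross_of_not_class hi hz
    have hV := (h.2.2 b hb b' hb' (fun e => hbz (by rw [e])) _ (level_top.2 hbi)).congr
      (ε' := False) (δ' := True) (by simp [hB b hb, hB b' hb']) (by simp [hbz])
    simp only [IsPUnion, not_forall] at hU
    obtain ⟨a, ha, x, hx, hno⟩ := hU
    obtain ⟨z', hz'⟩ := exists_ne a.2.2
    have key := hV.left_right_eq hx a.2.2 z'
    have h1 : 1 ≤ mass A (resInd p (n + 1) a.1) 1 (ptInd a.2.2) :=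
      one_le_mass (isInd_resInd _ _ _) isInd_one (isInd_ptInd _) ha (by simp [resInd]) rfl
        (by simp [ptInd])
    have h2 : mass A (resInd p (n + 1) x) 1 (ptInd a.2.2) = 0 := by
      refine mass_eq_zero (isInd_resInd _ _ _) isInd_one (isInd_ptInd _) fun c hc hcx _ hcz =>
        hno ⟨c, hc, resInd_eq_one.1 hcx, Prod.ext (by rw [hA c hc, hA a ha]) (ptInd_eq_one.1 hcz)⟩
    have h3 : mass A (resInd p (n + 1) a.1) 1 (ptInd z') = 0 := by
      refine mass_eq_zero (isInd_resInd _ _ _) isInd_one (isInd_ptInd _) fun c hc hcx _ hcz =>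
        h.not_level_zero hr hc ha (fun e => hz' ?_) (by rw [hA c hc, hA a ha])
          (resInd_eq_one.1 hcx)
      rw [← ptInd_eq_one.1 hcz, e]
    have h4 : 0 ≤ mass A (resInd p (n + 1) x) 1 (ptInd z') :=
      mass_nonneg A (isInd_resInd _ _ _) isInd_one (isInd_ptInd _)
    linarith

end Good

section Slices

variable {Y Z : Type*} [DecidableEq Y] [DecidableEq Z] {p n : ℕ} {A B : Finset (ℤ × Y × Z)}

/-- `(x, y, z)` belongs to `A` modulo `p ^ n`. -/
def MemMod (p n : ℕ) (A : Finset (ℤ × Y × Z)) (x : ℤ) (y : Y) (z : Z) : Prop :=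
  ∃ a ∈ A, (p : ℤ) ^ n ∣ a.1 - x ∧ a.2 = (y, z)

theorem memMod_of_mem {a : ℤ × Y × Z} (ha : a ∈ A) : MemMod p n A a.1 a.2.1 a.2.2 :=
  ⟨a, ha, by simp, rfl⟩

theorem HalfPair.vanishes_of_memMod (h : HalfPair p n A B) {x x' : ℤ} {y y' : Y} {z z' : Z}
    (h1 : MemMod p n A x y z) (h2 : MemMod p n A x' y' z') {k : ℕ} (hk : Level p n k x x')
    (hne : k ≠ 0 ∨ y ≠ y' ∨ z ≠ z') {ε δ : Prop} (hε : y ≠ y' ↔ ε) (hδ : z ≠ z' ↔ δ) :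
    Vanishes p B k ε δ := by
  obtain ⟨a, ha, hd, hy⟩ := h1
  obtain ⟨a', ha', hd', hy'⟩ := h2
  have hl : Level p n k a.1 a'.1 := by
    rcases Nat.eq_zero_or_pos k with rfl | hk0
    · have := dvd_add (dvd_sub hd hd') (level_zero.1 hk)
      rwa [show a.1 - x - (a'.1 - x') + (x - x') = a.1 - a'.1 by ring] at this
    · exact hk.congr hk0.ne'
        ((pow_dvd_pow _ (by have := hk.le; omega)).trans (dvd_sub_comm.1 hd))
        ((pow_dvd_pow _ (by have := hk.le; omega)).trans (dvd_sub_comm.1 hd'))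
  refine (h a ha a' ha' ?_ k hl).congr (by simp [← hε, hy, hy']) (by simp [← hδ, hy, hy'])
  rintro rfl
  rw [hy, Prod.mk.injEq] at hy'
  rcases hne with hne | hne | hne
  · rw [level_iff hne] at hl
    exact hl.2.2 (by simp)
  · exact hne hy'.1
  · exact hne hy'.2

/-- The indicator function of `A` modulo `p ^ n`, as a mass. -/
def cell (p n : ℕ) (A : Finset (ℤ × Y × Z)) (x : ℤ) (y : Y) (z : Z) : ℤ :=
  mass A (resInd p n x) (ptInd y) (ptInd z)

theorem cell_nonneg (x : ℤ) (y : Y) (z : Z) : 0 ≤ cell p n A x y z :=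
  mass_nonneg A (isInd_resInd _ _ _) (isInd_ptInd _) (isInd_ptInd _)

theorem CombPair.cell_le_one (h : CombPair p n A B) (x : ℤ) (y : Y) (z : Z) :
    cell p n A x y z ≤ 1 := by
  refine mass_le_one (isInd_resInd _ _ _) (isInd_ptInd _) (isInd_ptInd _) ?_
  intro a ha a' ha' h1 h2 h3 h1' h2' h3'
  refine h.ext_of_dvd ha ha' ?_ (Prod.ext ?_ ?_)
  · simpa using dvd_sub (resInd_eq_one.1 h1) (resInd_eq_one.1 h1')
  · rw [ptInd_eq_one.1 h2, ptInd_eq_one.1 h2']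
  · rw [ptInd_eq_one.1 h3, ptInd_eq_one.1 h3']

theorem CombPair.cell_eq_one (h : CombPair p n A B) {x : ℤ} {y : Y} {z : Z}
    (hm : MemMod p n A x y z) : cell p n A x y z = 1 := by
  refine le_antisymm (h.cell_le_one x y z) ?_
  obtain ⟨a, ha, hd, h2⟩ := hm
  exact one_le_mass (isInd_resInd _ _ _) (isInd_ptInd _) (isInd_ptInd _) ha (resInd_eq_one.2 hd)
    (ptInd_eq_one.2 (by rw [h2])) (ptInd_eq_one.2 (by rw [h2]))

theorem memMod_of_cell_ne_zero {x : ℤ} {y : Y} {z : Z} (h : cell p n A x y z ≠ 0) :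
    MemMod p n A x y z := by
  obtain ⟨a, ha, h1, h2, h3⟩ := exists_of_mass_ne_zero (isInd_resInd _ _ _) (isInd_ptInd _)
    (isInd_ptInd _) h
  exact ⟨a, ha, resInd_eq_one.1 h1, Prod.ext (ptInd_eq_one.1 h2) (ptInd_eq_one.1 h3)⟩

theorem cell_eq_zero {x : ℤ} {y : Y} {z : Z} (h : ¬MemMod p n A x y z) : cell p n A x y z = 0 := by
  by_contra hne
  exact h (memMod_of_cell_ne_zero hne)

theorem CombPair.memMod_right_unique [Fintype Z] (h : CombPair p n A B)
    (hr : ¬Fintype.card Z ∣ A.card) {x : ℤ} {y : Y} {z z' : Z} (h1 : MemMod p n A x y z)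
    (h2 : MemMod p n A x y z') : z = z' := by
  by_contra hz
  have h0 := h.2.1.vanishes_of_memMod h1 h2 (k := 0) (by simp [level_zero]) (Or.inr (Or.inr hz))
    (ε := False) (δ := True) (by simp) (by simp [hz])
  refine hr ?_
  rw [h.1]
  exact_mod_cast Dvd.intro _ (h0.card_dvd_right z).symm

theorem exists_memMod_of_not_isPUnion (hU : ¬IsPUnion p (n + 1) A) :
    ∃ x x' y z, (p : ℤ) ^ n ∣ x - x' ∧ MemMod p (n + 1) A x y z ∧ ¬MemMod p (n + 1) A x' y z := by
  simp only [IsPUnion, not_forall] at hU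
  obtain ⟨a, ha, x, hx, hno⟩ := hU
  exact ⟨a.1, x, a.2.1, a.2.2, hx, memMod_of_mem ha, hno⟩

theorem level_one_of_memMod {x x' : ℤ} {y : Y} {z : Z} (hx : (p : ℤ) ^ n ∣ x - x')
    (h1 : MemMod p (n + 1) A x y z) (h2 : ¬MemMod p (n + 1) A x' y z) :
    Level p (n + 1) 1 x x' := by
  refine level_one.2 ⟨hx, fun hd => h2 ?_⟩
  obtain ⟨a, ha, had, ha2⟩ := h1
  refine ⟨a, ha, ?_, ha2⟩
  have := dvd_add had hd
  rwa [sub_add_sub_cancel] at this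

theorem sum_cell_right [Fintype Z] (x : ℤ) (y : Y) :
    ∑ z, cell p n A x y z = mass A (resInd p n x) (ptInd y) 1 := sum_mass_right _ _ _

theorem sum_cell_mid [Fintype Y] (x : ℤ) (z : Z) :
    ∑ y, cell p n A x y z = mass A (resInd p n x) 1 (ptInd z) := sum_mass_mid _ _ _

theorem cell_le_row (x : ℤ) (y : Y) (z : Z) :
    cell p n A x y z ≤ mass A (resInd p n x) (ptInd y) 1 :=
  Finset.sum_le_sum fun a _ => by
    rcases isInd_resInd p n x a.1 with h | h <;> rcases isInd_ptInd y a.2.1 with h' | h' <;>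
      rcases isInd_ptInd z a.2.2 with h'' | h'' <;> simp [h, h', h'']

theorem CombPair.row_le_one [Fintype Z] (h : CombPair p n A B)
    (hr : ¬Fintype.card Z ∣ A.card) (x : ℤ) (y : Y) :
    mass A (resInd p n x) (ptInd y) 1 ≤ 1 := by
  refine mass_le_one (isInd_resInd _ _ _) (isInd_ptInd _) isInd_one ?_
  intro a ha a' ha' h1 h2 _ h1' h2' _
  have hd := dvd_sub (resInd_eq_one.1 h1) (resInd_eq_one.1 h1')
  rw [sub_sub_sub_cancel_right] at hd
  by_contra hne
  exact h.not_level_zero hr ha ha' hne (by rw [ptInd_eq_one.1 h2, ptInd_eq_one.1 h2']) hd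

theorem exists_of_row_ne_zero {x : ℤ} {y : Y} (h : mass A (resInd p n x) (ptInd y) 1 ≠ 0) :
    ∃ z, MemMod p n A x y z := by
  obtain ⟨a, ha, h1, h2, -⟩ := exists_of_mass_ne_zero (isInd_resInd _ _ _) (isInd_ptInd _)
    isInd_one h
  exact ⟨a.2.2, a, ha, resInd_eq_one.1 h1, Prod.ext (ptInd_eq_one.1 h2) rfl⟩

theorem exists_of_column_ne_zero {x : ℤ} {z : Z}
    (h : mass A (resInd p n x) 1 (ptInd z) ≠ 0) : ∃ y, MemMod p n A x y z := by
  obtain ⟨a, ha, h1, -, h3⟩ := exists_of_mass_ne_zero (isInd_resInd _ _ _) isInd_one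
    (isInd_ptInd _) h
  exact ⟨a.2.1, a, ha, resInd_eq_one.1 h1, Prod.ext rfl (ptInd_eq_one.1 h3)⟩

variable [Fintype Y] [Fintype Z]

theorem CombPair.vanishes_of_sum_tests (h : CombPair p (n + 1) A B)
    (hqr : ¬Fintype.card Z ∣ Fintype.card Y) (hr : ¬Fintype.card Z ∣ A.card)
    (hU : ¬IsPUnion p (n + 1) A) (hFT : Vanishes p A (n + 1) False True)
    (hTF : Vanishes p A (n + 1) True False) :
    Vanishes p B 1 False True ∧ Vanishes p B 0 True True ∧ Vanishes p B 1 True False := by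
  obtain ⟨x, x', y, z, hx, hm, hm'⟩ := exists_memMod_of_not_isPUnion hU
  have hrow : ∀ x, ∑ z, mass A (resInd p (n + 1) x) 1 (ptInd z)
      = ∑ y, mass A (resInd p (n + 1) x) (ptInd y) 1 := fun x => by
    rw [sum_mass_right, sum_mass_mid]
  set R := fun x y => mass A (resInd p (n + 1) x) (ptInd y) 1
  set C := fun x z => mass A (resInd p (n + 1) x) 1 (ptInd z)
  have hR : ∀ y₁, R x y₁ = R x' y₁ + (R x y - R x' y) := fun y₁ => by
    have := hTF.left_mid_eq hx y y₁
    simp only [R]; linarith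
  have hC : ∀ z₁, C x z₁ = C x' z₁ + (C x z - C x' z) := fun z₁ => by
    have := hFT.left_right_eq hx z z₁
    simp only [C]; linarith
  have hR1 : ∀ x y, R x y ≤ 1 := h.row_le_one hr
  have hR0 : ∀ x y, 0 ≤ R x y := fun x y =>
    mass_nonneg A (isInd_resInd _ _ _) (isInd_ptInd _) isInd_one
  have hRxy : R x y = 1 := le_antisymm (hR1 _ _) ((h.cell_eq_one hm).symm.le.trans (cell_le_row _ _ _))
  have hsum : (Fintype.card Z : ℤ) * (C x z - C x' z) = Fintype.card Y * (R x y - R x' y) := by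
    have h1 := hrow x
    have h2 := hrow x'
    have e1 : ∑ z, C x z = ∑ z, C x' z + Fintype.card Z * (C x z - C x' z) := by
      rw [Finset.sum_congr rfl fun z₁ _ => hC z₁, Finset.sum_add_distrib]; simp [mul_sub]
    have e2 : ∑ y, R x y = ∑ y, R x' y + Fintype.card Y * (R x y - R x' y) := by
      rw [Finset.sum_congr rfl fun z₁ _ => hR z₁, Finset.sum_add_distrib]; simp [mul_sub]
    simp only [R, C] at *
    linarith
  have hRx'y : R x' y = 1 := by
    by_contra hne
    have h0 : R x' y = 0 := by have := hR1 x' y; have := hR0 x' y; omega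
    rw [hRxy, h0] at hsum
    have : (Fintype.card Z : ℤ) ∣ Fintype.card Y := ⟨C x z - C x' z, by rw [hsum]; ring⟩
    exact hqr (by exact_mod_cast this)
  obtain ⟨z', hz'⟩ := exists_of_row_ne_zero (show R x' y ≠ 0 by rw [hRx'y]; exact one_ne_zero)
  have hzz : z ≠ z' := by rintro rfl; exact hm' hz'
  rw [hRxy, hRx'y, sub_self, mul_zero, mul_eq_zero] at hsum
  have hcC : C x z - C x' z = 0 := by
    refine hsum.resolve_left fun h0 => ?_
    have := Fintype.card_pos_iff.2 ⟨z⟩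
    omega
  have hCpos : 1 ≤ C x' z' := by
    obtain ⟨a, ha, hd, h2⟩ := hz'
    exact one_le_mass (isInd_resInd _ _ _) isInd_one (isInd_ptInd _) ha (resInd_eq_one.2 hd)
      rfl (ptInd_eq_one.2 (by rw [h2]))
  obtain ⟨y', hy'⟩ := exists_of_column_ne_zero (show C x z' ≠ 0 by rw [hC z', hcC]; omega)
  have hyy : y ≠ y' := by
    rintro rfl
    exact hzz (h.memMod_right_unique hr hm hy')
  have hl := level_one_of_memMod hx hm hm'
  have hl' : Level p (n + 1) 1 x' x := by
    rw [level_one] at hl ⊢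
    rwa [dvd_sub_comm, dvd_sub_comm (b := x')]
  exact ⟨h.2.1.vanishes_of_memMod hm hz' hl (Or.inl one_ne_zero) (by simp) (by simp [hzz]),
    h.2.1.vanishes_of_memMod hm hy' (k := 0) (by simp [level_zero]) (Or.inr (Or.inr hzz))
      (by simp [hyy]) (by simp [hzz]),
    h.2.1.vanishes_of_memMod hz' hy' hl' (Or.inl one_ne_zero) (by simp [hyy]) (by simp)⟩

end Slices

section Counting

variable {Y Z : Type*} [DecidableEq Y] [DecidableEq Z] {p n : ℕ} {A B : Finset (ℤ × Y × Z)}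

theorem exists_third_class (hp : 3 ≤ p) (i j : ℤ) :
    ∃ k : ℤ, ¬(p : ℤ) ∣ k - i ∧ ¬(p : ℤ) ∣ k - j := by
  have h1 : ¬(p : ℤ) ∣ 1 := fun h => by have := Int.le_of_dvd one_pos h; omega
  have h2 : ¬(p : ℤ) ∣ 2 := fun h => by have := Int.le_of_dvd two_pos h; omega
  by_cases h : (p : ℤ) ∣ i + 1 - j
  · refine ⟨i + 2, by simpa using h2, fun h' => h1 ?_⟩
    have := dvd_sub h' h
    rwa [show i + 2 - j - (i + 1 - j) = 1 by ring] at this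
  · exact ⟨i + 1, by simpa using h1, h⟩

theorem exists_third {X : Type*} [DecidableEq X] [Fintype X] (h : 3 ≤ Fintype.card X) (x y : X) :
    ∃ z, z ≠ x ∧ z ≠ y := by
  by_contra hcon
  push Not at hcon
  have : (Finset.univ : Finset X) ⊆ {x, y} := fun z _ => by
    by_cases hz : z = x
    · simp [hz]
    · simp [hcon z hz]
  have := (Finset.card_le_card this).trans Finset.card_le_two
  rw [Finset.card_univ] at this
  omega

variable [Fintype Y] [Fintype Z]

/-- Counts supported on a `2 × 2 × 2` box cannot satisfy the additive relations. -/
theorem false_of_box (h3 : (3 ≤ p ∧ 3 ≤ Fintype.card Y) ∨ (3 ≤ p ∧ 3 ≤ Fintype.card Z) ∨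
      (3 ≤ Fintype.card Y ∧ 3 ≤ Fintype.card Z))
    (hFT : Vanishes p B 1 False True) (hTT : Vanishes p B 0 True True)
    (hTF : Vanishes p B 1 True False) (hne : B.Nonempty) {i j : ℤ} {y₀ y₁ : Y} {z₀ z₁ : Z}
    (hB : ∀ b ∈ B, ((p : ℤ) ∣ b.1 - i ∨ (p : ℤ) ∣ b.1 - j) ∧ (b.2.1 = y₀ ∨ b.2.1 = y₁) ∧
      (b.2.2 = z₀ ∨ b.2.2 = z₁)) : False := by
  obtain ⟨b, hb⟩ := hne
  have hclass : ∀ k, ¬(p : ℤ) ∣ k - i → ¬(p : ℤ) ∣ k - j → ∀ c ∈ B, resInd p 1 k c.1 ≠ 1 := by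
    intro k hki hkj c hc h1
    have h2 : (p : ℤ) ∣ c.1 - k := by simpa using resInd_eq_one.1 h1
    rcases (hB c hc).1 with h | h
    · exact hki (by simpa using dvd_sub h h2)
    · exact hkj (by simpa using dvd_sub h h2)
  rcases h3 with ⟨h1, h2⟩ | ⟨h1, h2⟩ | ⟨h1, h2⟩
  · obtain ⟨k, hki, hkj⟩ := exists_third_class h1 i j
    obtain ⟨y, hy0, hy1⟩ := exists_third h2 y₀ y₁
    have key := hTF.left_mid_eq (x := b.1) (x' := k) (by simp) b.2.1 y
    rw [mass_eq_zero (isInd_resInd p (0 + 1) k) (isInd_ptInd y) isInd_one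
        fun c hc h _ _ => hclass k hki hkj c hc h,
      mass_eq_zero (isInd_resInd p (0 + 1) k) (isInd_ptInd b.2.1) isInd_one
        fun c hc h _ _ => hclass k hki hkj c hc h,
      mass_eq_zero (isInd_resInd p (0 + 1) b.1) (isInd_ptInd y) isInd_one ?_] at key
    · have := one_le_mass (isInd_resInd p (0 + 1) b.1) (isInd_ptInd b.2.1)
        (isInd_one (X := Z)) hb (by simp [resInd]) (by simp [ptInd]) rfl
      omega
    · intro c hc _ h _
      have := ptInd_eq_one.1 h
      rcases (hB c hc).2.1 with h' | h'
      · exact absurd (this.symm.trans h') hy0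
      · exact absurd (this.symm.trans h') hy1
  · obtain ⟨k, hki, hkj⟩ := exists_third_class h1 i j
    obtain ⟨z, hz0, hz1⟩ := exists_third h2 z₀ z₁
    have key := hFT.left_right_eq (x := b.1) (x' := k) (by simp) b.2.2 z
    rw [mass_eq_zero (isInd_resInd p (0 + 1) k) isInd_one (isInd_ptInd z)
        fun c hc h _ _ => hclass k hki hkj c hc h,
      mass_eq_zero (isInd_resInd p (0 + 1) k) isInd_one (isInd_ptInd b.2.2)
        fun c hc h _ _ => hclass k hki hkj c hc h,
      mass_eq_zero (isInd_resInd p (0 + 1) b.1) isInd_one (isInd_ptInd z) ?_] at key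
    · have := one_le_mass (isInd_resInd p (0 + 1) b.1) (isInd_one (X := Y))
        (isInd_ptInd b.2.2) hb (by simp [resInd]) rfl (by simp [ptInd])
      omega
    · intro c hc _ _ h
      have := ptInd_eq_one.1 h
      rcases (hB c hc).2.2 with h' | h'
      · exact hz0 (this.symm.trans h')
      · exact hz1 (this.symm.trans h')
  · obtain ⟨y, hy0, hy1⟩ := exists_third h1 y₀ y₁
    obtain ⟨z, hz0, hz1⟩ := exists_third h2 z₀ z₁
    have key := hTT.mid_right_eq b.2.1 y b.2.2 z
    have hY : ∀ z, mass B 1 (ptInd y) (ptInd z) = 0 := fun z =>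
      mass_eq_zero isInd_one (isInd_ptInd y) (isInd_ptInd z) fun c hc _ h _ => by
        have := ptInd_eq_one.1 h
        rcases (hB c hc).2.1 with h' | h'
        · exact absurd (this.symm.trans h') hy0
        · exact absurd (this.symm.trans h') hy1
    rw [hY, hY, mass_eq_zero isInd_one (isInd_ptInd b.2.1) (isInd_ptInd z) ?_] at key
    · have := one_le_mass isInd_one (isInd_ptInd b.2.1)
        (isInd_ptInd b.2.2) hb rfl (by simp [ptInd]) (by simp [ptInd])
      omega
    · intro c hc _ _ h
      have := ptInd_eq_one.1 h
      rcases (hB c hc).2.2 with h' | h'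
      · exact hz0 (this.symm.trans h')
      · exact hz1 (this.symm.trans h')

/-- Counts supported on a cross through `w` outside of which only one class is occupied. -/
theorem card_dvd_of_cross [Nontrivial Y] [Nontrivial Z]
    (hFT : Vanishes p B 1 False True) (hTT : Vanishes p B 0 True True)
    (hTF : Vanishes p B 1 True False) {i : ℤ} {w : ℤ × Y × Z} (hwB : w ∈ B)
    (hwi : ¬(p : ℤ) ∣ w.1 - i) (hout : ∀ b ∈ B, ¬(p : ℤ) ∣ b.1 - i → b.2 = w.2)
    (hin : ∀ b ∈ B, b.2.1 = w.2.1 ∨ b.2.2 = w.2.2) : Fintype.card Z ∣ B.card := by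
  obtain ⟨j, ys, zs⟩ := w
  simp only at hwi hout hin
  have hpj : ∀ b ∈ B, resInd p (0 + 1) j b.1 = 1 → b.2 = (ys, zs) := fun b hb h1 =>
    hout b hb fun hi => hwi <| by
      have := resInd_eq_one.1 h1
      simp only [zero_add, pow_one] at this
      simpa using dvd_sub hi this
  set γ := mass B (resInd p (0 + 1) j) 1 1 with hγ
  set δ := mass B (resInd p (0 + 1) i) 1 (ptInd zs) - γ with hδ
  set δ' := mass B (resInd p (0 + 1) i) (ptInd ys) 1 - γ with hδ'
  have hCj : mass B (resInd p (0 + 1) j) 1 (ptInd zs) = γ := by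
    rw [hγ]
    refine Finset.sum_congr rfl fun b hb => ?_
    rcases isInd_resInd p (0 + 1) j b.1 with h | h
    · simp [h]
    · simp [ptInd, hpj b hb h]
  have hRj : mass B (resInd p (0 + 1) j) (ptInd ys) 1 = γ := by
    rw [hγ]
    refine Finset.sum_congr rfl fun b hb => ?_
    rcases isInd_resInd p (0 + 1) j b.1 with h | h
    · simp [h]
    · simp [ptInd, hpj b hb h]
  have hC : ∀ z ≠ zs, mass B (resInd p (0 + 1) i) 1 (ptInd z) = δ := by
    intro z hz
    have key := hFT.left_right_eq (x := i) (x' := j) (by simp) z zs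
    rw [mass_eq_zero (isInd_resInd p (0 + 1) j) isInd_one (isInd_ptInd z) fun b hb h _ h' => by
      rw [hpj b hb h] at h'; exact hz (ptInd_eq_one.1 h').symm, hCj] at key
    linarith
  have hR : ∀ y ≠ ys, mass B (resInd p (0 + 1) i) (ptInd y) 1 = δ' := by
    intro y hy
    have key := hTF.left_mid_eq (x := i) (x' := j) (by simp) y ys
    rw [mass_eq_zero (isInd_resInd p (0 + 1) j) (isInd_ptInd y) isInd_one fun b hb h h' _ => by
      rw [hpj b hb h] at h'; exact hy (ptInd_eq_one.1 h').symm, hRj] at key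
    linarith
  have hsumC : mass B (resInd p (0 + 1) i) 1 1 = γ + Fintype.card Z * δ := by
    rw [← sum_mass_right, Fintype.sum_eq_add_sum_compl zs,
      Finset.sum_congr rfl fun z hz => hC z (by simpa using hz), Finset.sum_const,
      Finset.card_compl, Finset.card_singleton, nsmul_eq_mul,
      Nat.cast_sub (Fintype.card_pos_iff.2 ⟨zs⟩)]
    push_cast; rw [hδ]; ring
  have hsumR : mass B (resInd p (0 + 1) i) 1 1 = γ + Fintype.card Y * δ' := by
    rw [← sum_mass_mid, Fintype.sum_eq_add_sum_compl ys,
      Finset.sum_congr rfl fun z hz => hR z (by simpa using hz), Finset.sum_const,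
      Finset.card_compl, Finset.card_singleton, nsmul_eq_mul,
      Nat.cast_sub (Fintype.card_pos_iff.2 ⟨ys⟩)]
    push_cast; rw [hδ']; ring
  have hNz : ∀ z ≠ zs, mass B 1 (ptInd ys) (ptInd z) = δ := by
    intro z hz
    rw [← hC z hz]
    refine Finset.sum_congr rfl fun b hb => ?_
    by_cases hbz : b.2.2 = z
    · have h1 : b.2.1 = ys := (hin b hb).resolve_right fun h => hz (hbz ▸ h)
      have h2 : resInd p (0 + 1) i b.1 = 1 := by
        refine resInd_eq_one.2 ?_
        by_contra h
        exact hz (by rw [← hbz, hout b hb (by simpa using h)])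
      simp [h1, h2, ptInd]
    · simp [ptInd, hbz]
  have hNy : ∀ y ≠ ys, mass B 1 (ptInd y) (ptInd zs) = δ' := by
    intro y hy
    rw [← hR y hy]
    refine Finset.sum_congr rfl fun b hb => ?_
    by_cases hby : b.2.1 = y
    · have h1 : b.2.2 = zs := (hin b hb).resolve_left fun h => hy (hby ▸ h)
      have h2 : resInd p (0 + 1) i b.1 = 1 := by
        refine resInd_eq_one.2 ?_
        by_contra h
        exact hy (by rw [← hby, hout b hb (by simpa using h)])
      simp [h1, h2, ptInd]
    · simp [ptInd, hby]
  have hCz : ∀ z ≠ zs, mass B 1 1 (ptInd z) = δ := by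
    intro z hz
    rw [← hNz z hz]
    refine Finset.sum_congr rfl fun b hb => ?_
    by_cases hbz : b.2.2 = z
    · have h1 : b.2.1 = ys := (hin b hb).resolve_right fun h => hz (hbz ▸ h)
      simp [h1, ptInd]
    · simp [ptInd, hbz]
  obtain ⟨y, hy⟩ := exists_ne ys
  obtain ⟨z, hz⟩ := exists_ne zs
  have hyz : mass B 1 (ptInd y) (ptInd z) = 0 :=
    mass_eq_zero isInd_one (isInd_ptInd y) (isInd_ptInd z) fun b hb _ h1 h2 => by
      rcases hin b hb with h | h
      · exact hy ((ptInd_eq_one.1 h1).symm.trans h)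
      · exact hz ((ptInd_eq_one.1 h2).symm.trans h)
  have key := hTT.mid_right_eq y ys z zs
  rw [hyz, hNz z hz, hNy y hy] at key
  have hm : (B.card : ℤ) = Fintype.card Z * (2 * δ) := by
    have h1 : mass B 1 1 (ptInd zs) = mass B 1 (ptInd ys) (ptInd zs) +
        (Fintype.card Y - 1) * δ' := by
      rw [← sum_mass_mid, Fintype.sum_eq_add_sum_compl ys,
        Finset.sum_congr rfl fun z hz => hNy z (by simpa using hz), Finset.sum_const,
        Finset.card_compl, Finset.card_singleton, nsmul_eq_mul,
        Nat.cast_sub (Fintype.card_pos_iff.2 ⟨ys⟩)]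
      push_cast; ring
    rw [← mass_one, ← sum_mass_right, Fintype.sum_eq_add_sum_compl zs,
      Finset.sum_congr rfl fun z hz => hCz z (by simpa using hz), Finset.sum_const,
      Finset.card_compl, Finset.card_singleton, nsmul_eq_mul,
      Nat.cast_sub (Fintype.card_pos_iff.2 ⟨zs⟩), h1]
    push_cast
    linear_combination key + hsumC - hsumR
  exact_mod_cast Dvd.intro _ hm.symm

/-- In a nondegenerate pair, the left hand set vanishes at some full order characters. -/
theorem CombPair.vanishes_top_true_true [Nontrivial Y] [Nontrivial Z] (h : CombPair p (n + 1) A B)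
    (h3 : (3 ≤ p ∧ 3 ≤ Fintype.card Y) ∨ (3 ≤ p ∧ 3 ≤ Fintype.card Z) ∨
      (3 ≤ Fintype.card Y ∧ 3 ≤ Fintype.card Z))
    (hqr : ¬Fintype.card Z ∣ Fintype.card Y) (hr : ¬Fintype.card Z ∣ A.card)
    (hU : ¬IsPUnion p (n + 1) A) (hi : ¬∃ i, ∀ b ∈ B, (p : ℤ) ∣ b.1 - i)
    (hy : ¬∃ y, ∀ b ∈ B, b.2.1 = y) (hz : ¬∃ z, ∀ b ∈ B, b.2.2 = z) :
    Vanishes p A (n + 1) True True := by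
  by_contra hno
  have hshare : ∀ b ∈ B, ∀ b' ∈ B, ¬(p : ℤ) ∣ b.1 - b'.1 → b.2.1 = b'.2.1 ∨ b.2.2 = b'.2.2 := by
    intro b hb b' hb' hd
    by_contra hcon
    push Not at hcon
    exact hno ((h.2.2 b hb b' hb' (fun e => hcon.1 (by rw [e])) _ (level_top.2 hd)).congr
      (by simp [hcon.1]) (by simp [hcon.2]))
  obtain ⟨b₀, hb₀, b₁, hb₁, hy01, hz01⟩ :=
    exists_cross (exists_ne_of_not_const hy) (exists_ne_of_not_const hz)
  have h01 : (p : ℤ) ∣ b₀.1 - b₁.1 := by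
    by_contra hd
    rcases hshare b₀ hb₀ b₁ hb₁ hd with h | h
    · exact hy01 h
    · exact hz01 h
  obtain ⟨w, hw, hwi⟩ : ∃ w ∈ B, ¬(p : ℤ) ∣ w.1 - b₀.1 := by
    by_contra hcon
    push Not at hcon
    exact hi ⟨_, hcon⟩
  wlog hw2 : w.2.1 = b₀.2.1 ∧ w.2.2 = b₁.2.2 generalizing b₀ b₁
  · have e1 : ¬(p : ℤ) ∣ w.1 - b₁.1 := fun hd => hwi (by simpa using dvd_sub hd h01)
    refine this b₁ hb₁ b₀ hb₀ hy01.symm hz01.symm (by rwa [dvd_sub_comm]) e1 ?_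
    rcases hshare w hw b₀ hb₀ hwi with h | h <;> rcases hshare w hw b₁ hb₁ e1 with h' | h'
    · exact absurd (h.symm.trans h') hy01
    · exact absurd ⟨h, h'⟩ hw2
    · exact ⟨h', h⟩
    · exact absurd (h.symm.trans h') hz01
  have hwi1 : ¬(p : ℤ) ∣ w.1 - b₁.1 := fun hd => hwi (by simpa using dvd_sub hd h01)
  have hFT : Vanishes p A (n + 1) False True :=
    (h.2.2 w hw b₀ hb₀ (fun e => hwi (by simp [e])) _ (level_top.2 hwi)).congr
      (by simp [hw2.1]) (by simp [hw2.2, hz01.symm])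
  have hTF : Vanishes p A (n + 1) True False :=
    (h.2.2 w hw b₁ hb₁ (fun e => hwi1 (by simp [e])) _ (level_top.2 hwi1)).congr
      (by simp [hw2.1, hy01]) (by simp [hw2.2])
  obtain ⟨vFT, vTT, vTF⟩ := h.vanishes_of_sum_tests hqr hr hU hFT hTF
  have hout : ∀ b ∈ B, ¬(p : ℤ) ∣ b.1 - b₀.1 →
      b.2 = w.2 ∨ b.2.1 = b₁.2.1 ∧ b.2.2 = b₀.2.2 := by
    intro b hb hbi
    rcases hshare b hb b₀ hb₀ hbi with h | h <;>
      rcases hshare b hb b₁ hb₁ (fun hd => hbi (by simpa using dvd_sub hd h01)) with h' | h'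
    · exact absurd (h.symm.trans h') hy01
    · exact Or.inl (Prod.ext (h.trans hw2.1.symm) (h'.trans hw2.2.symm))
    · exact Or.inr ⟨h', h⟩
    · exact absurd (h.symm.trans h') hz01
  by_cases hu : ∃ u ∈ B, ¬(p : ℤ) ∣ u.1 - b₀.1 ∧ u.2 ≠ w.2
  · obtain ⟨u, huB, hui, hu2⟩ := hu
    obtain ⟨hu1, hu2⟩ := (hout u huB hui).resolve_left hu2
    have hui1 : ¬(p : ℤ) ∣ u.1 - b₁.1 := fun hd => hui (by simpa using dvd_sub hd h01)
    refine false_of_box h3 vFT vTT vTF ⟨w, hw⟩ (i := b₀.1) (j := w.1) (y₀ := b₀.2.1) (y₁ := b₁.2.1)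
      (z₀ := b₀.2.2) (z₁ := b₁.2.2) fun b hb => ?_
    have huw : (p : ℤ) ∣ u.1 - w.1 := by
      by_contra hd
      rcases hshare u huB w hw hd with h | h
      · exact hy01 (by rw [← hw2.1, ← h, hu1])
      · exact hz01 (by rw [← hw2.2, ← h, hu2])
    by_cases hbi : (p : ℤ) ∣ b.1 - b₀.1
    · refine ⟨Or.inl hbi, ?_⟩
      have n1 : ¬(p : ℤ) ∣ b.1 - w.1 := fun hd => hwi (by simpa using dvd_sub hbi hd)
      have n2 : ¬(p : ℤ) ∣ b.1 - u.1 := fun hd => hui (by simpa using dvd_sub hbi hd)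
      rcases hshare b hb w hw n1 with h | h <;> rcases hshare b hb u huB n2 with h' | h'
      · exact absurd (by rw [← hw2.1, ← h, h', hu1]) hy01
      · exact ⟨Or.inl (h.trans hw2.1), Or.inl (h'.trans hu2)⟩
      · exact ⟨Or.inr (h'.trans hu1), Or.inr (h.trans hw2.2)⟩
      · exact absurd (by rw [← hw2.2, ← h, h', hu2]) hz01
    · rcases hout b hb hbi with h | ⟨h, h'⟩
      · refine ⟨Or.inr ?_, by rw [h, hw2.1]; exact Or.inl rfl, by rw [h, hw2.2]; exact Or.inr rfl⟩
        by_contra hd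
        have hd' : ¬(p : ℤ) ∣ b.1 - u.1 := fun hd' => hd (by simpa using dvd_add hd' huw)
        rcases hshare b hb u huB hd' with h' | h'
        · exact hy01 (by rw [← hw2.1, ← h, h', hu1])
        · exact hz01 (by rw [← hw2.2, ← h, h', hu2])
      · refine ⟨Or.inr ?_, Or.inr h, Or.inl h'⟩
        by_contra hd
        rcases hshare b hb w hw hd with h'' | h''
        · exact hy01 (by rw [← hw2.1, ← h'', h])
        · exact hz01 (by rw [← hw2.2, ← h'', h'])
  · push Not at hu
    refine hr (h.1 ▸ card_dvd_of_cross vFT vTT vTF hw hwi hu fun b hb => ?_)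
    by_cases hbi : (p : ℤ) ∣ b.1 - b₀.1
    · exact hshare b hb w hw fun hd => hwi (by simpa using dvd_sub hbi hd)
    · exact Or.inl (by rw [hu b hb hbi])

end Counting

section Boxes

variable {Y Z : Type*} [DecidableEq Y] [DecidableEq Z] {p n : ℕ} {A B : Finset (ℤ × Y × Z)}
  [Fintype Y] [Fintype Z]

theorem CombPair.cell_add_le_one (h : CombPair p n A B) (hr : ¬Fintype.card Z ∣ A.card) (x : ℤ)
    (y : Y) {z z' : Z} (hz : z ≠ z') : cell p n A x y z + cell p n A x y z' ≤ 1 := by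
  have h1 := h.cell_le_one x y z
  have h2 := h.cell_le_one x y z'
  by_contra hcon
  exact hz (h.memMod_right_unique hr (x := x) (y := y) (memMod_of_cell_ne_zero (by omega))
    (memMod_of_cell_ne_zero (by omega)))

theorem memMod_of_cell_eq_one {x : ℤ} {y : Y} {z : Z} (h : cell p n A x y z = 1) :
    MemMod p n A x y z := memMod_of_cell_ne_zero (by rw [h]; exact one_ne_zero)

theorem not_memMod_of_cell_eq_zero (h : CombPair p n A B) {x : ℤ} {y : Y} {z : Z}
    (h0 : cell p n A x y z = 0) : ¬MemMod p n A x y z := fun hm => by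
  rw [h.cell_eq_one hm] at h0; exact one_ne_zero h0

/-- A point of a coset different from two given ones. -/
theorem exists_third_in_coset (hp : 3 ≤ p) {x x' : ℤ} (hx : (p : ℤ) ^ n ∣ x - x') :
    ∃ t, (p : ℤ) ^ n ∣ x - t ∧ ¬(p : ℤ) ^ (n + 1) ∣ t - x ∧ ¬(p : ℤ) ^ (n + 1) ∣ t - x' := by
  obtain ⟨c, hc⟩ := hx
  obtain ⟨k, hk0, hkc⟩ := exists_third_class hp 0 (-c)
  have hpn : (p : ℤ) ^ n ≠ 0 := pow_ne_zero _ (by omega)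
  refine ⟨x + p ^ n * k, ⟨-k, by ring⟩, fun hd => hk0 ?_, fun hd => hkc ?_⟩
  · rw [show x + (p : ℤ) ^ n * k - x = p ^ n * k by ring, pow_succ,
      mul_dvd_mul_iff_left hpn] at hd
    simpa using hd
  · rwa [show x + (p : ℤ) ^ n * k - x' = p ^ n * (k - -c) by linear_combination hc, pow_succ,
      mul_dvd_mul_iff_left hpn] at hd

/-- The exceptional configuration for `|Z| = 2` does not occur. -/
theorem CombPair.false_of_exceptional (hp : 3 ≤ p) (h : CombPair p (n + 1) A B)
    (hr : ¬Fintype.card Z ∣ A.card) (hY : ¬2 ∣ Fintype.card Y)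
    (hTT : Vanishes p A (n + 1) True True) {x x' : ℤ} (hx : (p : ℤ) ^ n ∣ x - x')
    {y y' : Y} {z z' : Z} (hz : z ≠ z') (hZ : ∀ w, w = z ∨ w = z')
    (h1 : cell p (n + 1) A x y z = 1) (h2 : cell p (n + 1) A x' y z = 0)
    (h3 : cell p (n + 1) A x' y z' = 0) (h4 : cell p (n + 1) A x' y' z' = 1)
    (h5 : cell p (n + 1) A x y' z = 0) (h6 : cell p (n + 1) A x y' z' = 0) : False := by
  have hle := h.cell_add_le_one hr
  have h7 : cell p (n + 1) A x y z' = 0 := by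
    have := hle x y hz; have := cell_nonneg (p := p) (n := n + 1) (A := A) x y z'; omega
  have h8 : cell p (n + 1) A x' y' z = 0 := by
    have := hle x' y' hz; have := cell_nonneg (p := p) (n := n + 1) (A := A) x' y' z; omega
  have hrow : ∀ x y, mass A (resInd p (n + 1) x) (ptInd y) 1
      = cell p (n + 1) A x y z + cell p (n + 1) A x y z' := fun x y => by
    rw [← sum_cell_right, Fintype.sum_eq_add z z' hz fun w hw => by
      rcases hZ w with e | e
      · exact absurd e hw.1
      · exact absurd e hw.2]
  have hdiff : ∀ y₁, cell p (n + 1) A x y₁ z - cell p (n + 1) A x' y₁ z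
      - (cell p (n + 1) A x y₁ z' - cell p (n + 1) A x' y₁ z') = 1 := fun y₁ => by
    have : _ = cell p (n + 1) A x y z' - cell p (n + 1) A x' y z'
      - (cell p (n + 1) A x y₁ z' - cell p (n + 1) A x' y₁ z') := hTT.left_mid_right_eq hx y y₁ z z'
    change cell p (n + 1) A x y z - cell p (n + 1) A x' y z
      - (cell p (n + 1) A x y₁ z - cell p (n + 1) A x' y₁ z) = _ at this
    omega
  have nTF : ¬Vanishes p A (n + 1) True False := fun hV => by
    have := hV.left_mid_eq hx y y'
    simp only [hrow] at this
    omega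
  have nFT : ¬Vanishes p A (n + 1) False True := fun hV => by
    have := hV.left_right_eq hx z z'
    simp only [← sum_cell_mid] at this
    have hs := Finset.sum_congr rfl fun y₁ (_ : y₁ ∈ Finset.univ) => hdiff y₁
    simp only [Finset.sum_sub_distrib, Finset.sum_const, Finset.card_univ, nsmul_eq_mul,
      mul_one] at hs
    have := Fintype.card_pos_iff.2 ⟨y⟩
    omega
  have nFF : ¬Vanishes p A (n + 1) False False := fun hV => by
    have := hV.left_eq hx
    rw [← sum_mass_mid, ← sum_mass_mid A (resInd p (n + 1) x')] at this
    simp only [hrow, Finset.sum_add_distrib] at this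
    have hs := Finset.sum_congr rfl fun y₁ (_ : y₁ ∈ Finset.univ) => hdiff y₁
    simp only [Finset.sum_sub_distrib, Finset.sum_const, Finset.card_univ, nsmul_eq_mul,
      mul_one] at hs
    omega
  have hV1 : Vanishes p B 1 False False := by
    obtain ⟨t, ht, htx, htx'⟩ := exists_third_in_coset hp hx
    have key : _ = cell p (n + 1) A x y z' - cell p (n + 1) A t y z'
      - (cell p (n + 1) A x y' z' - cell p (n + 1) A t y' z') := hTT.left_mid_right_eq ht y y' z z'
    change cell p (n + 1) A x y z - cell p (n + 1) A t y z
      - (cell p (n + 1) A x y' z - cell p (n + 1) A t y' z) = _ at key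
    have e1 := cell_nonneg (p := p) (n := n + 1) (A := A) t y z'
    have e2 := cell_nonneg (p := p) (n := n + 1) (A := A) t y' z
    have e3 := cell_nonneg (p := p) (n := n + 1) (A := A) t y z
    have e4 := cell_nonneg (p := p) (n := n + 1) (A := A) t y' z'
    have e5 := h.cell_le_one t y z
    have e6 := h.cell_le_one t y' z'
    by_cases hc : cell p (n + 1) A t y z = 1
    · refine h.2.1.vanishes_of_memMod (memMod_of_cell_eq_one hc) (memMod_of_cell_eq_one h1)
        (level_one.2 ⟨by rwa [dvd_sub_comm], htx⟩) (Or.inl one_ne_zero) (by simp) (by simp)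
    · refine h.2.1.vanishes_of_memMod (memMod_of_cell_eq_one (show cell p (n + 1) A t y' z' = 1 by
        omega)) (memMod_of_cell_eq_one h4)
        (level_one.2 ⟨?_, htx'⟩) (Or.inl one_ne_zero) (by simp) (by simp)
      have := dvd_sub hx ht
      rwa [sub_sub_sub_cancel_left] at this
  have hB : B.Nonempty := by
    rw [← Finset.card_pos, ← h.1, Finset.card_pos]
    obtain ⟨a, ha, -⟩ := memMod_of_cell_eq_one h1
    exact ⟨a, ha⟩
  have hocc : ∀ i, ∃ b ∈ B, (p : ℤ) ∣ b.1 - i := fun i => by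
    have hc := hV1.card_dvd_left (by omega) i
    have : mass B (resInd p 1 i) 1 1 ≠ 0 := fun h0 => by
      rw [h0, mul_zero] at hc
      exact hB.card_pos.ne' (by exact_mod_cast hc)
    obtain ⟨b, hb, h1, -⟩ := exists_of_mass_ne_zero (isInd_resInd _ _ _) isInd_one isInd_one this
    exact ⟨b, hb, by simpa using resInd_eq_one.1 h1⟩
  have hcross : ∀ b ∈ B, ∀ b' ∈ B, ¬(p : ℤ) ∣ b.1 - b'.1 → b.2.2 ≠ b'.2.2 := by
    intro b hb b' hb' hd e
    have hV := h.2.2 b hb b' hb' (fun e => hd (by simp [e])) _ (level_top.2 hd)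
    by_cases hy : b.2.1 = b'.2.1
    · exact nFF (hV.congr (by simp [hy]) (by simp [e]))
    · exact nTF (hV.congr (by simp [hy]) (by simp [e]))
  obtain ⟨b0, hb0, hd0⟩ := hocc 0
  obtain ⟨b1, hb1, hd1⟩ := hocc 1
  obtain ⟨b2, hb2, hd2⟩ := hocc 2
  have hn1 : ¬(p : ℤ) ∣ 1 := fun h => by have := Int.le_of_dvd one_pos h; omega
  have hn2 : ¬(p : ℤ) ∣ 2 := fun h => by have := Int.le_of_dvd two_pos h; omega
  have c01 := hcross b1 hb1 b0 hb0 fun hd => hn1 <| by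
    have := dvd_sub (dvd_sub hd hd1) (dvd_neg.2 hd0)
    rwa [show b1.1 - b0.1 - (b1.1 - 1) - -(b0.1 - 0) = 1 by ring] at this
  have c02 := hcross b2 hb2 b0 hb0 fun hd => hn2 <| by
    have := dvd_sub (dvd_sub hd hd2) (dvd_neg.2 hd0)
    rwa [show b2.1 - b0.1 - (b2.1 - 2) - -(b0.1 - 0) = 2 by ring] at this
  have c12 := hcross b2 hb2 b1 hb1 fun hd => hn1 <| by
    have := dvd_sub (dvd_sub hd hd2) (dvd_neg.2 hd1)
    rwa [show b2.1 - b1.1 - (b2.1 - 2) - -(b1.1 - 1) = 1 by ring] at this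
  rcases hZ b0.2.2 with e0 | e0 <;> rcases hZ b1.2.2 with e1 | e1 <;>
    rcases hZ b2.2.2 with e2 | e2 <;> simp_all

/-- Vanishing at full order characters spreads a missing point of a coset to all fibers. -/
theorem CombPair.spread [Nontrivial Z] (hp : 3 ≤ p ∨ 3 ≤ Fintype.card Z)
    (h : CombPair p (n + 1) A B) (hr : ¬Fintype.card Z ∣ A.card)
    (hY : ¬Fintype.card Z ∣ Fintype.card Y) (hTT : Vanishes p A (n + 1) True True) {x x' : ℤ}
    (hx : (p : ℤ) ^ n ∣ x - x') {y : Y} {z : Z} (hm : MemMod p (n + 1) A x y z)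
    (hm' : ¬MemMod p (n + 1) A x' y z) (y' : Y) :
    MemMod p (n + 1) A x y' z ∧ ¬MemMod p (n + 1) A x' y' z := by
  have hle := h.cell_add_le_one hr
  have h0 := cell_nonneg (p := p) (n := n + 1) (A := A)
  have hle1 := h.cell_le_one
  have h1 := h.cell_eq_one hm
  have h2 := cell_eq_zero hm'
  have key : ∀ z', cell p (n + 1) A x y z - cell p (n + 1) A x' y z
      - (cell p (n + 1) A x y' z - cell p (n + 1) A x' y' z)
      = cell p (n + 1) A x y z' - cell p (n + 1) A x' y z'
      - (cell p (n + 1) A x y' z' - cell p (n + 1) A x' y' z') :=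
    fun z' => hTT.left_mid_right_eq hx y y' z z'
  by_cases h3 : cell p (n + 1) A x y' z - cell p (n + 1) A x' y' z = 1
  · have e1 := h0 x y' z; have e2 := h0 x' y' z; have e3 := hle1 x y' z
    exact ⟨memMod_of_cell_eq_one (by omega), not_memMod_of_cell_eq_zero h (by omega)⟩
  exfalso
  have hall : ∀ z' ≠ z, cell p (n + 1) A x' y z' = 0 ∧ cell p (n + 1) A x' y' z' = 1 ∧
      cell p (n + 1) A x y' z = 0 ∧ cell p (n + 1) A x y' z' = 0 := by
    intro z' hz'
    have k := key z'
    have a1 := hle x y hz'; have a2 := hle x' y hz'; have a3 := hle x y' hz'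
    have a4 := hle x' y' hz'
    have b1 := h0 x y z'; have b2 := h0 x' y z'; have b3 := h0 x y' z'; have b4 := h0 x' y' z'
    have b5 := h0 x y' z; have b6 := h0 x' y' z
    omega
  obtain ⟨z', hz'⟩ := exists_ne z
  obtain ⟨c1, c2, c3, c4⟩ := hall z' hz'
  have hZ : ∀ w, w = z ∨ w = z' := by
    intro w
    by_contra hcon
    push Not at hcon
    have := hle x' y' hcon.2
    have := (hall w hcon.1).2.1
    omega
  have hcard : Fintype.card Z = 2 := by
    rw [← Finset.card_univ, show (Finset.univ : Finset Z) = {z, z'} from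
      (Finset.eq_univ_of_forall fun w => by simpa using hZ w).symm, Finset.card_pair hz'.symm]
  rw [hcard] at hp hY
  exact h.false_of_exceptional (by omega) hr hY hTT hx hz'.symm hZ h1 h2 c1 c2 c3 c4

end Boxes

section Packing

variable {Y Z : Type*} [DecidableEq Y] [DecidableEq Z] {p n : ℕ} {A B : Finset (ℤ × Y × Z)}

theorem pow_count_dvd_mass (hp : 0 < p) (P : ℕ → Prop) [DecidablePred P]
    (hP : ∀ k, P k → Vanishes p A (k + 1) False False) (d k : ℕ) (x : ℤ) :
    (p : ℤ) ^ Nat.count (fun i => P (k + i)) d ∣ mass A (resInd p k x) 1 1 := by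
  induction d generalizing k x with
  | zero => simp
  | succ d ih =>
    have e : (fun i => P (k + (i + 1))) = fun i => P (k + 1 + i) := by
      funext i; rw [add_right_comm, add_assoc]
    rw [Nat.count_succ', ← sum_mass_left hp]
    simp only [e, add_zero]
    split_ifs with h
    · rw [Finset.sum_congr rfl fun i _ => (hP k h).left_eq (x := _) (x' := x) (by simp),
        Finset.sum_const, Finset.card_range, nsmul_eq_mul, pow_succ']
      exact mul_dvd_mul_left _ (ih _ _)
    · exact Finset.dvd_sum fun i _ => ih _ _

theorem pow_count_dvd_card (hp : 0 < p) (P : ℕ → Prop) [DecidablePred P]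
    (hP : ∀ k, P k → Vanishes p A (k + 1) False False) (n : ℕ) :
    p ^ Nat.count P n ∣ A.card := by
  have := pow_count_dvd_mass hp P hP n 0 0
  rw [resInd_zero, mass_one] at this
  simp only [zero_add] at this
  exact_mod_cast this

/-- A set of integers all of whose differences have prescribed orders is small. -/
theorem card_le_pow_count (hp : 0 < p) (P : ℕ → Prop) [DecidablePred P] (n : ℕ) (E : Finset ℤ)
    (hE : ∀ x ∈ E, ∀ x' ∈ E, x ≠ x' → ∃ k, Level p n (k + 1) x x' ∧ P k) :
    E.card ≤ p ^ Nat.count P n := by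
  have hp' : (p : ℤ) ≠ 0 := by exact_mod_cast hp.ne'
  induction n generalizing E with
  | zero =>
    simp only [Nat.count_zero, pow_zero]
    refine Finset.card_le_one.2 fun x hx x' hx' => ?_
    by_contra hne
    obtain ⟨k, hk, -⟩ := hE x hx x' hx' hne
    exact absurd hk.le (by omega)
  | succ n ih =>
    have hfib : ∀ i : ℤ, (E.filter fun x => x % p = i).card ≤ p ^ Nat.count P n := by
      intro i
      have hdec : ∀ x ∈ E.filter fun x => x % p = i, x = i + p * (x / p) := fun x hx => by
        have := Int.emod_add_mul_ediv x p
        rw [(Finset.mem_filter.1 hx).2] at this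
        exact this.symm
      have hinj : Set.InjOn (fun x : ℤ => x / p) (E.filter fun x => x % p = i) :=
        fun x hx x' hx' he => by
          have he' : x / p = x' / p := he
          rw [hdec x hx, hdec x' hx', he']
      rw [← Finset.card_image_of_injOn hinj]
      refine ih _ fun t ht t' ht' hne => ?_
      obtain ⟨x, hx, rfl⟩ := Finset.mem_image.1 ht
      obtain ⟨x', hx', rfl⟩ := Finset.mem_image.1 ht'
      obtain ⟨k, hk, hPk⟩ := hE x (Finset.mem_filter.1 hx).1 x' (Finset.mem_filter.1 hx').1
        (fun e => hne (by simp [e]))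
      rw [hdec x hx, hdec x' hx'] at hk
      refine ⟨k, (level_mul hp.ne').1 ⟨hk, ?_⟩, hPk⟩
      by_contra hkn
      obtain rfl : k = n := by have := hk.le; omega
      exact level_top.1 hk ⟨x / p - x' / p, by ring⟩
    have hmain := Finset.card_le_mul_card_image (f := fun x : ℤ => x % p) E (p ^ Nat.count P n)
      fun i _ => hfib i
    refine hmain.trans ?_
    rw [Nat.count_succ, pow_add]
    refine Nat.mul_le_mul_left _ ?_
    split_ifs with h
    · rw [pow_one]
      have : E.image (fun x : ℤ => x % p) ⊆ (Finset.range p).image fun i : ℕ => (i : ℤ) := by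
        intro t ht
        obtain ⟨x, -, rfl⟩ := Finset.mem_image.1 ht
        refine Finset.mem_image.2 ⟨(x % p).toNat, ?_, Int.toNat_of_nonneg (Int.emod_nonneg _ hp')⟩
        have := Int.emod_lt_of_pos x (show (0 : ℤ) < p by omega)
        simp; omega
      exact (Finset.card_le_card this).trans (Finset.card_image_le.trans (by simp))
    · rw [pow_zero]
      refine Finset.card_le_one.2 fun t ht t' ht' => ?_
      obtain ⟨x, hx, rfl⟩ := Finset.mem_image.1 ht
      obtain ⟨x', hx', rfl⟩ := Finset.mem_image.1 ht'
      by_contra hne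
      obtain ⟨k, hk, hPk⟩ := hE x hx x' hx' fun e => hne (by simp [e])
      have hkn : k ≠ n := by rintro rfl; exact h hPk
      have hle := hk.le
      refine hne ((Int.emod_emod_of_dvd x (dvd_refl (p : ℤ))).symm.trans ?_)
      rw [Int.emod_emod_of_dvd x (dvd_refl (p : ℤ))]
      refine Int.emod_eq_emod_iff_emod_sub_eq_zero.2 (Int.emod_eq_zero_of_dvd ?_)
      rw [level_iff (Nat.succ_ne_zero k)] at hk
      exact (dvd_pow_self _ (by omega)).trans hk.2.1

/-- Sets of integers all of whose differences have prescribed orders, of maximal size. -/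
theorem exists_card_eq_pow_count (hp : 0 < p) (P : ℕ → Prop) [DecidablePred P] (n : ℕ) :
    ∃ S : Finset ℤ, S.card = p ^ Nat.count P n ∧
      ∀ x ∈ S, ∀ x' ∈ S, x ≠ x' → ∃ k, Level p n (k + 1) x x' ∧ P k := by
  induction n with
  | zero => exact ⟨{0}, by simp, by simp +contextual⟩
  | succ n ih =>
    obtain ⟨S, hS, hlev⟩ := ih
    have hinj : Set.InjOn (fun u : ℕ × ℤ => (u.1 : ℤ) + p * u.2)
        (Finset.range (if P n then p else 1) ×ˢ S : Finset _) := by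
      rintro ⟨i, s⟩ hi ⟨i', s'⟩ hi' he
      simp only [Finset.coe_product, Set.mem_prod, Finset.mem_coe, Finset.mem_range] at hi hi' he
      have hip : i < p := by have := hi.1; split_ifs at this <;> omega
      have hip' : i' < p := by have := hi'.1; split_ifs at this <;> omega
      have e1 : (i : ℤ) = i' := by
        have := congrArg (· % (p : ℤ)) he
        simpa [Int.emod_eq_of_lt, hip, hip'] using this
      have e2 : (p : ℤ) * s = p * s' := by linarith
      have e3 := mul_left_cancel₀ (show (p : ℤ) ≠ 0 by omega) e2
      exact Prod.ext (by exact_mod_cast e1) e3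
    refine ⟨(Finset.range (if P n then p else 1) ×ˢ S).image fun u => (u.1 : ℤ) + p * u.2, ?_, ?_⟩
    · rw [Finset.card_image_of_injOn hinj, Finset.card_product, hS, Nat.count_succ, pow_add,
        Finset.card_range, mul_comm]
      split_ifs <;> simp
    · intro x hx x' hx' hne
      obtain ⟨⟨i, s⟩, hu, rfl⟩ := Finset.mem_image.1 hx
      obtain ⟨⟨i', s'⟩, hu', rfl⟩ := Finset.mem_image.1 hx'
      simp only [Finset.mem_product, Finset.mem_range] at hu hu' hne ⊢
      by_cases hi : i = i'
      · subst hi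
        obtain ⟨k, hk, hPk⟩ := hlev s hu.2 s' hu'.2 fun e => hne (by rw [e])
        exact ⟨k, ((level_mul hp.ne').2 hk).1, hPk⟩
      · have hP : P n := by
          by_contra hP
          rw [if_neg hP] at hu hu'
          omega
        rw [if_pos hP] at hu hu'
        refine ⟨n, level_top.2 fun hd => hi ?_, hP⟩
        have h1 : (p : ℤ) ∣ i - i' := by
          have := dvd_sub hd (dvd_mul_right (p : ℤ) (s - s'))
          rwa [show (i : ℤ) + p * s - (i' + p * s') - p * (s - s') = i - i' by ring] at this
        have h2 := Int.eq_zero_of_abs_lt_dvd h1 (by rw [abs_lt]; omega)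
        omega

end Packing

section Nondegenerate

variable {Y Z : Type*} [DecidableEq Y] [DecidableEq Z] {p n : ℕ} {A B : Finset (ℤ × Y × Z)}
  [Fintype Y] [Fintype Z]

/-- `A` is a union of fibers in the `Y` direction. -/
def IsYUnion (p n : ℕ) (A : Finset (ℤ × Y × Z)) : Prop :=
  ∀ a ∈ A, ∀ y, MemMod p n A a.1 y a.2.2

theorem Level.of_not_dvd {x x' : ℤ} (h1 : (p : ℤ) ^ n ∣ x - x') (h2 : ¬(p : ℤ) ^ (n + 1) ∣ x - x') :
    Level p (n + 1) 1 x x' := level_one.2 ⟨h1, h2⟩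

theorem Level.symm {k : ℕ} {x x' : ℤ} (h : Level p n k x x') : Level p n k x' x := by
  cases k with
  | zero => exact dvd_sub_comm.1 h
  | succ k => exact ⟨h.1, dvd_sub_comm.1 h.2.1, fun hd => h.2.2 (dvd_sub_comm.1 hd)⟩

/-- Spreading in a set which is not a union of fibers produces a pair of order `p`. -/
theorem CombPair.vanishes_one_of_spread [Nontrivial Z] (hp : 1 < p)
    (h3 : 3 ≤ p ∨ 3 ≤ Fintype.card Z) (h : CombPair p (n + 1) A B)
    (hr : ¬Fintype.card Z ∣ A.card) (hY : ¬Fintype.card Z ∣ Fintype.card Y)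
    (hTT : Vanishes p A (n + 1) True True) (hU : ¬IsYUnion p (n + 1) A) :
    Vanishes p B 1 False False := by
  simp only [IsYUnion, not_forall] at hU
  obtain ⟨a, ha, y, hy⟩ := hU
  have hpn : (p : ℤ) ^ n ≠ 0 := pow_ne_zero _ (by omega)
  have hm : MemMod p (n + 1) A (a.1 + p ^ n) a.2.1 a.2.2 := by
    by_contra hno
    exact hy (h.spread h3 hr hY hTT (by simp) (memMod_of_mem ha) hno y).1
  refine h.2.1.vanishes_of_memMod (memMod_of_mem ha) hm (Level.of_not_dvd (by simp) fun hd => ?_)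
    (Or.inl one_ne_zero) (by simp) (by simp)
  rw [show a.1 - (a.1 + (p : ℤ) ^ n) = p ^ n * -1 by ring, pow_succ, mul_dvd_mul_iff_left hpn] at hd
  have := Int.le_of_dvd one_pos ((dvd_neg (α := ℤ)).1 hd)
  omega

/-- There are no nondegenerate pairs. -/
theorem CombPair.false_of_nondegenerate [Nontrivial Y] [Nontrivial Z] (hp : p.Prime)
    (h : CombPair p (n + 1) A B) (hpY : p.Coprime (Fintype.card Y))
    (h3 : (3 ≤ p ∧ 3 ≤ Fintype.card Y) ∨ (3 ≤ p ∧ 3 ≤ Fintype.card Z) ∨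
      (3 ≤ Fintype.card Y ∧ 3 ≤ Fintype.card Z))
    (hY : ¬Fintype.card Z ∣ Fintype.card Y) (hr : ¬Fintype.card Z ∣ A.card)
    (hAi : ¬∃ i, ∀ a ∈ A, (p : ℤ) ∣ a.1 - i) (hBi : ¬∃ i, ∀ b ∈ B, (p : ℤ) ∣ b.1 - i)
    (hAy : ¬∃ y, ∀ a ∈ A, a.2.1 = y) (hBy : ¬∃ y, ∀ b ∈ B, b.2.1 = y)
    (hAz : ¬∃ z, ∀ a ∈ A, a.2.2 = z) (hBz : ¬∃ z, ∀ b ∈ B, b.2.2 = z)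
    (hAU : ¬IsPUnion p (n + 1) A) (hBU : ¬IsPUnion p (n + 1) B)
    (hBY : ¬IsYUnion p (n + 1) B) : False := by
  have hr' : ¬Fintype.card Z ∣ B.card := h.1 ▸ hr
  have h3' : 3 ≤ p ∨ 3 ≤ Fintype.card Z := by omega
  have hTTA := h.vanishes_top_true_true h3 hY hr hAU hBi hBy hBz
  have hTTB := h.symm.vanishes_top_true_true h3 hY hr' hBU hAi hAy hAz
  have hA1 : Vanishes p A 1 False False :=
    h.symm.vanishes_one_of_spread hp.one_lt h3' hr' hY hTTB hBY
  obtain ⟨x, x', y, z, hx, hm, hm'⟩ := exists_memMod_of_not_isPUnion hAU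
  have hsp := fun y' => h.spread h3' hr hY hTTA hx hm hm' y'
  have nFT : ¬Vanishes p A (n + 1) False True := fun hV => by
    obtain ⟨z', hz'⟩ := exists_ne z
    have key := hV.left_right_eq hx z z'
    simp only [← sum_cell_mid] at key
    rw [Finset.sum_congr rfl fun y' _ => h.cell_eq_one (hsp y').1,
      Finset.sum_congr (f := fun y' => cell p (n + 1) A x' y' z) rfl
        fun y' _ => cell_eq_zero (hsp y').2,
      Finset.sum_congr (f := fun y' => cell p (n + 1) A x y' z') rfl
        fun y' _ => cell_eq_zero fun hc => hz' (h.memMod_right_unique hr hc (hsp y').1)] at key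
    have h0 : 0 ≤ ∑ y', cell p (n + 1) A x' y' z' := Finset.sum_nonneg fun _ _ => cell_nonneg _ _ _
    have := Fintype.card_pos_iff.2 ⟨y⟩
    simp at key
    omega
  have hB0 : Vanishes p B 0 True False := by
    obtain ⟨y', hy'⟩ := exists_ne y
    exact h.2.1.vanishes_of_memMod (hsp y').1 (hsp y).1 (k := 0) (by simp [level_zero])
      (Or.inr (Or.inl hy')) (by simp [hy']) (by simp)
  clear hsp hm hm' hx
  obtain ⟨x₁, x₁', y₁, z₀, hx₁, hm₁, hm₁'⟩ := exists_memMod_of_not_isPUnion hBU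
  have hsp := fun y' => h.symm.spread h3' hr' hY hTTB hx₁ hm₁ hm₁' y'
  obtain ⟨b, hb, hbi⟩ : ∃ b ∈ B, ¬(p : ℤ) ∣ b.1 - x₁ := by
    by_contra hcon
    push Not at hcon
    exact hBi ⟨_, hcon⟩
  obtain ⟨c, hc, hcx, hc2⟩ := (hsp b.2.1).1
  have hcx' : (p : ℤ) ∣ c.1 - x₁ := (dvd_pow_self _ (Nat.succ_ne_zero n)).trans hcx
  have hsame : ∀ u ∈ B, ∀ v ∈ B, ¬(p : ℤ) ∣ u.1 - v.1 → u.2.1 = v.2.1 → u.2.2 = v.2.2 := by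
    intro u hu v hv hd hy
    by_contra hne
    exact nFT ((h.2.2 u hu v hv (fun e => hne (by rw [e])) _ (level_top.2 hd)).congr
      (by simp [hy]) (by simp [hne]))
  have hbz : b.2.2 = z₀ := by
    have := hsame b hb c hc (fun hd => hbi (by simpa using dvd_add hd hcx')) (by rw [hc2])
    rw [this, hc2]
  have hrowz : ∀ u ∈ B, u.2.1 = b.2.1 → u.2.2 = z₀ := by
    intro u hu hy
    by_cases hd : (p : ℤ) ∣ u.1 - x₁
    · rw [← hbz]
      refine hsame u hu b hb (fun hd' => hbi ?_) hy
      have := dvd_sub hd hd'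
      rwa [sub_sub_sub_cancel_left] at this
    · have := hsame u hu c hc (fun hd' => hd (by simpa using dvd_add hd' hcx')) (by rw [hy, hc2])
      rw [this, hc2]
  classical
  set R := B.filter fun u => u.2.1 = b.2.1 with hR
  have hRmem : ∀ u ∈ R, u ∈ B ∧ u.2 = (b.2.1, z₀) := fun u hu => by
    obtain ⟨h1, h2⟩ := Finset.mem_filter.1 hu
    exact ⟨h1, Prod.ext h2 (hrowz u h1 h2)⟩
  set E := R.image Prod.fst with hE
  have hEcard : E.card = R.card := Finset.card_image_of_injOn fun u hu v hv e => by
    exact Prod.ext e ((hRmem u hu).2.trans (hRmem v hv).2.symm)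
  have hcardR : B.card = Fintype.card Y * R.card := by
    have h1 := hB0.card_dvd_mid b.2.1
    have h2 : mass B 1 (ptInd b.2.1) 1 = R.card := by
      simp only [mass, ptInd, hR, Finset.card_eq_sum_ones, Finset.sum_filter]; simp
    rw [h2] at h1
    exact_mod_cast h1
  set P : ℕ → Prop := fun k => Vanishes p A (k + 1) False False with hP
  have hElev : ∀ t ∈ E, ∀ t' ∈ E, t ≠ t' → ∃ k, Level p (n + 1) (k + 1) t t' ∧ P k := by
    intro t ht t' ht' hne
    obtain ⟨u, hu, rfl⟩ := Finset.mem_image.1 ht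
    obtain ⟨v, hv, rfl⟩ := Finset.mem_image.1 ht'
    obtain ⟨hu1, hu2⟩ := hRmem u hu
    obtain ⟨hv1, hv2⟩ := hRmem v hv
    have huv : u ≠ v := fun e => hne (by rw [e])
    obtain ⟨k, -, hk⟩ := exists_level (p := p) (n := n + 1) u.1 v.1
    cases k with
    | zero => exact absurd (h.symm.ext_of_dvd hu1 hv1 hk (hu2.trans hv2.symm)) huv
    | succ k =>
      exact ⟨k, hk, (h.2.2 u hu1 v hv1 huv _ hk).congr (by simp [hu2, hv2]) (by simp [hu2, hv2])⟩
  have hnotE : ∀ t ∈ E, ¬(p : ℤ) ^ (n + 1) ∣ t - x₁' := by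
    intro t ht hd
    obtain ⟨u, hu, rfl⟩ := Finset.mem_image.1 ht
    exact (hsp b.2.1).2 ⟨u, (hRmem u hu).1, hd, (hRmem u hu).2⟩
  have hcE : c.1 ∈ E := Finset.mem_image_of_mem _ (Finset.mem_filter.2 ⟨hc, by rw [hc2]⟩)
  have hcx1 : (p : ℤ) ^ n ∣ c.1 - x₁' := by
    simpa using dvd_add ((pow_dvd_pow _ (Nat.le_succ n)).trans hcx) hx₁
  have hnew : ∀ t ∈ E, ∃ k, Level p (n + 1) (k + 1) t x₁' ∧ P k := by
    intro t ht
    by_cases htc : t = c.1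
    · exact ⟨0, Level.of_not_dvd (htc ▸ hcx1) (hnotE t ht), hA1⟩
    obtain ⟨k, hk, hPk⟩ := hElev t ht _ hcE htc
    cases k with
    | zero =>
      exact ⟨0, Level.of_not_dvd (by simpa using dvd_add (level_one.1 hk).1 hcx1) (hnotE t ht), hA1⟩
    | succ k =>
      have hkn := hk.le
      exact ⟨k + 1, hk.congr (Nat.succ_ne_zero _) (by simp)
        ((pow_dvd_pow _ (by omega)).trans hcx1), hPk⟩
  have hx1E : x₁' ∉ E := fun hmem => hnotE _ hmem (by simp)
  have hle := card_le_pow_count hp.pos P (n + 1) (insert x₁' E) (by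
    intro t ht t' ht' hne
    rcases Finset.mem_insert.1 ht with rfl | hmem <;>
      rcases Finset.mem_insert.1 ht' with rfl | hmem'
    · exact absurd rfl hne
    · obtain ⟨k, hk, hPk⟩ := hnew t' hmem'
      exact ⟨k, hk.symm, hPk⟩
    · exact hnew t hmem
    · exact hElev t hmem t' hmem' hne)
  rw [Finset.card_insert_of_notMem hx1E, hEcard] at hle
  have hdvd := pow_count_dvd_card (A := A) hp.pos P (fun k hk => hk) (n + 1)
  rw [h.1, hcardR] at hdvd
  have := Nat.le_of_dvd (hEcard ▸ Finset.card_pos.2 ⟨_, hcE⟩)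
    (((Nat.Coprime.pow_left _ hpY)).dvd_of_dvd_mul_left hdvd)
  omega

end Nondegenerate

section Main

variable {Y Z : Type*} [DecidableEq Y] [DecidableEq Z] {p n : ℕ} {A B : Finset (ℤ × Y × Z)}

theorem Good.of_swapYZ {C : Z × Y → Z × Y → Prop} (h : Good p n C (swapYZ A) (swapYZ B)) :
    Good p n (fun u v => C u.swap v.swap) A B := by
  intro a ha a' ha' hne hC k hk
  obtain ⟨h1, h2⟩ := h (a.1, a.2.swap) (mem_swapYZ.2 ha) (a'.1, a'.2.swap) (mem_swapYZ.2 ha')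
    (fun e => hne (by
      rw [Prod.mk.injEq, Prod.swap_inj] at e
      exact Prod.ext e.1 e.2)) hC k hk
  exact ⟨h1, vanishes_swapYZ.1 h2⟩

theorem CombPair.good_of_const_mid_left [Nontrivial Y] [Fintype Z] [Nontrivial Z] (hp : 1 < p)
    (h : CombPair p n A B) (hr : ¬Fintype.card Z ∣ A.card) {y : Y} (hA : ∀ a ∈ A, a.2.1 = y) :
    Good p n (fun _ _ => True) A B := by
  intro a ha a' ha' hne hC k hk
  obtain ⟨h1, h2⟩ := (h.symm.flattenY hA y).symm.good_of_const_mid hp hr hA (y' := y)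
    (fun b hb => by obtain ⟨c, -, rfl⟩ := Finset.mem_image.1 hb; rfl) a ha a' ha' hne hC k hk
  exact ⟨h1, (h.symm.vanishes_of_flattenY hA y).1 h2⟩

theorem CombPair.good_of_const_mid_right [Nontrivial Y] [Fintype Z] [Nontrivial Z] (hp : 1 < p)
    (h : CombPair p n A B) (hr : ¬Fintype.card Z ∣ A.card) {y : Y} (hB : ∀ b ∈ B, b.2.1 = y) :
    Good p n (fun _ _ => True) A B := by
  intro a ha a' ha' hne hC k hk
  have hf := h.flattenY hB y
  exact hf.good_of_const_mid hp (by rwa [hf.1, ← h.1]) (y := y)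
    (fun b hb => by obtain ⟨c, -, rfl⟩ := Finset.mem_image.1 hb; rfl) hB _
    (Finset.mem_image_of_mem _ ha) _ (Finset.mem_image_of_mem _ ha')
    (fun e => hne (h.flattenY_injOn hB y ha ha' e)) hC k hk

theorem IsYUnion.mass_eq (hU : IsYUnion p n A) (h : CombPair p n A B) {k : ℕ} (hk : k ≤ n)
    {φ : ℤ → ℤ} (hφ : LevelTest p k φ) (θ : Z → ℤ) (y y' : Y) :
    mass A φ (ptInd y) θ = mass A φ (ptInd y') θ := by
  have hfilter : ∀ y, mass A φ (ptInd y) θ = ∑ a ∈ A with a.2.1 = y, φ a.1 * θ a.2.2 := by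
    intro y
    rw [Finset.sum_filter]
    refine Finset.sum_congr rfl fun a _ => ?_
    by_cases ha : a.2.1 = y <;> simp [ptInd, ha]
  choose f hfA hfd hf2 using hU
  rw [hfilter, hfilter]
  refine Finset.sum_bij (fun a ha => f a (Finset.mem_filter.1 ha).1 y') ?_ ?_ ?_ ?_
  · intro a ha
    exact Finset.mem_filter.2 ⟨hfA _ _ _, by rw [hf2]⟩
  · intro a ha b hb e
    obtain ⟨ha, hay⟩ := Finset.mem_filter.1 ha
    obtain ⟨hb, hby⟩ := Finset.mem_filter.1 hb
    refine h.ext_of_dvd ha hb ?_ (Prod.ext (hay.trans hby.symm) ?_)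
    · have := dvd_sub (hfd b hb y') (hfd a ha y')
      rwa [e, sub_sub_sub_cancel_left] at this
    · have := (hf2 a ha y').symm.trans ((congrArg Prod.snd e).trans (hf2 b hb y'))
      exact (Prod.mk.inj this).2
  · intro b hb
    obtain ⟨hb, hby⟩ := Finset.mem_filter.1 hb
    refine ⟨f b hb y, Finset.mem_filter.2 ⟨hfA _ _ _, by rw [hf2]⟩, ?_⟩
    refine h.ext_of_dvd (hfA _ _ _) hb ?_ ?_
    · simpa using dvd_add (hfd (f b hb y) (hfA _ _ _) y') (hfd b hb y)
    · rw [hf2, hf2, ← hby]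
  · intro a ha
    rw [levelTest_periodic hk hφ _ _ (hfd a (Finset.mem_filter.1 ha).1 y'), hf2]

theorem mass_filter_mid (y : Y) (φ : ℤ → ℤ) (θ : Z → ℤ) :
    mass (A.filter fun a => a.2.1 = y) φ 1 θ = mass A φ (ptInd y) θ := by
  unfold mass
  rw [Finset.sum_filter]
  refine Finset.sum_congr rfl fun a _ => ?_
  by_cases ha : a.2.1 = y <;> simp [ptInd, ha]

theorem vanishes_filter_mid {y : Y} {k : ℕ} {δ : Prop}
    (h : ∀ φ θ, LevelTest p k φ → FiberTest δ θ → mass A φ (ptInd y) θ = 0) :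
    Vanishes p (A.filter fun a => a.2.1 = y) k False δ := by
  intro φ ψ θ hφ hψ hθ
  rw [hψ.2 not_false, mass_filter_mid]
  exact h φ θ hφ hθ

variable [Fintype Y] [Fintype Z]

theorem IsYUnion.mass_one_eq (hU : IsYUnion p n A) (h : CombPair p n A B) {k : ℕ} (hk : k ≤ n)
    {φ : ℤ → ℤ} (hφ : LevelTest p k φ) (θ : Z → ℤ) (y : Y) :
    mass A φ 1 θ = Fintype.card Y * mass A φ (ptInd y) θ := by
  rw [← sum_mass_mid, Finset.sum_congr rfl fun y' _ => hU.mass_eq h hk hφ θ y' y]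
  simp

theorem CombPair.good_of_isYUnion_right [Nontrivial Y] [Nontrivial Z] (hp : 1 < p)
    (h : CombPair p n A B) (hr : ¬Fintype.card Z ∣ A.card) {D : Prop}
    (hD : D → ¬Fintype.card Y ∣ A.card) (hU : IsYUnion p n B) :
    Good p n (fun u v => u.1 = v.1 ∨ D) A B := by
  intro a ha a' ha' hne hC k hk
  have hq : (Fintype.card Y : ℤ) ≠ 0 := by exact_mod_cast Fintype.card_ne_zero
  obtain ⟨b, hb⟩ : B.Nonempty := by
    rw [← Finset.card_pos, ← h.1]; exact Finset.card_pos.2 ⟨a, ha⟩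
  have hA0 : Vanishes p A 0 True False := by
    obtain ⟨y', hy'⟩ := exists_ne b.2.1
    exact h.2.2.vanishes_of_memMod (hU b hb y') (hU b hb b.2.1) (k := 0) (by simp [level_zero])
      (Or.inr (Or.inl hy')) (by simp [hy']) (by simp)
  have hcardA := fun y => hA0.card_dvd_mid y
  have hy : a.2.1 = a'.2.1 := hC.resolve_right fun d => hD d <| by
    exact_mod_cast Dvd.intro _ (hcardA a.2.1).symm
  set y := a.2.1 with hya
  have hcard : ∀ C : Finset (ℤ × Y × Z),
      ((C.filter fun c => c.2.1 = y).card : ℤ) = mass C 1 (ptInd y) 1 := fun C => by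
    rw [← mass_one, mass_filter_mid]
  have hcardB : (B.card : ℤ) = Fintype.card Y * mass B 1 (ptInd y) 1 := by
    rw [← mass_one]; exact hU.mass_one_eq h.symm (Nat.zero_le _) rfl _ _
  have hvB : ∀ {k : ℕ} {δ : Prop}, k ≤ n → Vanishes p B k False δ →
      Vanishes p (B.filter fun c => c.2.1 = y) k False δ := fun hk hV =>
    vanishes_filter_mid fun φ θ hφ hθ => by
      have := hV φ 1 θ hφ (fiberTest_of_not not_false) hθ
      rw [hU.mass_one_eq h.symm hk hφ θ y] at this
      exact (mul_eq_zero.1 this).resolve_left hq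
  have hpair : CombPair p n (A.filter fun c => c.2.1 = y) (B.filter fun c => c.2.1 = y) := by
    refine ⟨?_, ?_, ?_⟩
    · have : (Fintype.card Y : ℤ) * mass A 1 (ptInd y) 1 = Fintype.card Y * mass B 1 (ptInd y) 1 := by
        rw [← hcardA, ← hcardB, h.1]
      have := mul_left_cancel₀ hq this
      rw [← hcard, ← hcard] at this
      exact_mod_cast this
    · intro c hc c' hc' hcc k hk
      obtain ⟨hc, hcy⟩ := Finset.mem_filter.1 hc
      obtain ⟨hc', hcy'⟩ := Finset.mem_filter.1 hc'
      have := hvB hk.le ((h.2.1 c hc c' hc' hcc k hk).congr (ε' := False)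
        (by simp [hcy, hcy']) Iff.rfl)
      exact this.congr (by simp [hcy, hcy']) Iff.rfl
    · intro c hc c' hc' hcc k hk
      obtain ⟨hc, hcy⟩ := Finset.mem_filter.1 hc
      obtain ⟨hc', hcy'⟩ := Finset.mem_filter.1 hc'
      have v1 := (h.2.2 c hc c' hc' hcc k hk).congr (ε' := False) (by simp [hcy, hcy']) Iff.rfl
      obtain ⟨y', hy'⟩ := exists_ne y
      have v2 : Vanishes p A k True (c.2.2 ≠ c'.2.2) :=
        h.2.2.vanishes_of_memMod (hU c hc y') (memMod_of_mem hc') hk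
          (Or.inr (Or.inl (by rw [hcy']; exact hy'))) (by simp [hcy', hy']) Iff.rfl
      refine (vanishes_filter_mid (y := y) (δ := c.2.2 ≠ c'.2.2)
        fun φ θ hφ hθ => ?_).congr (by simp [hcy, hcy']) Iff.rfl
      have w1 := v1 φ 1 θ hφ (fiberTest_of_not not_false) hθ
      rw [← sum_mass_mid, Finset.sum_congr rfl fun y' _ => show mass A φ (ptInd y') θ
        = mass A φ (ptInd y) θ by
          have := v2 φ _ θ hφ (fiberTest_of trivial y' y) hθ
          rw [mass_sub_mid] at this
          linarith] at w1
      simp only [Finset.sum_const, Finset.card_univ, nsmul_eq_mul] at w1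
      exact (mul_eq_zero.1 w1).resolve_left hq
  obtain ⟨h1, h2⟩ := hpair.good_of_const_mid hp (y := y) (y' := y)
    (fun hd => hr (by
      have e := hcardA y
      rw [← hcard] at e
      have e' : A.card = Fintype.card Y * (A.filter fun c => c.2.1 = y).card := by exact_mod_cast e
      rw [e']
      exact hd.mul_left _))
    (fun c hc => (Finset.mem_filter.1 hc).2) (fun c hc => (Finset.mem_filter.1 hc).2)
    a (Finset.mem_filter.2 ⟨ha, rfl⟩) a' (Finset.mem_filter.2 ⟨ha', hy.symm⟩) hne trivial k hk
  refine ⟨h1, fun φ ψ θ hφ hψ hθ => ?_⟩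
  rw [hψ.2 not_false, hU.mass_one_eq h.symm hk.le hφ θ y, ← mass_filter_mid,
    h2 φ 1 θ hφ (fiberTest_of_not not_false) hθ, mul_zero]

theorem CombPair.good_of_exponent_zero {D : Prop} (h : CombPair p 0 A B)
    (hr : ¬Fintype.card Z ∣ A.card) (hD : D → ¬Fintype.card Y ∣ A.card) :
    Good p 0 (fun u v => u.1 = v.1 ∨ D) A B := by
  rintro a ha a' ha' hne hC k hk
  exfalso
  by_cases hy : a.2.1 = a'.2.1
  · exact h.not_level_zero hr ha ha' hne hy (by simp)
  have hq := hD (hC.resolve_left hy)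
  have hyy : ∀ {A B : Finset (ℤ × Y × Z)}, CombPair p 0 A B → ¬Fintype.card Z ∣ A.card →
      ∀ a ∈ A, ∀ a' ∈ A, a ≠ a' → a.2.1 ≠ a'.2.1 := fun h hr a ha a' ha' hne hy =>
    h.not_level_zero hr ha ha' hne hy (by simp)
  have hzz : ∀ {A B : Finset (ℤ × Y × Z)}, CombPair p 0 A B → ¬Fintype.card Y ∣ A.card →
      ∀ a ∈ A, ∀ a' ∈ A, a ≠ a' → a.2.2 ≠ a'.2.2 := fun h hq a ha a' ha' hne hz =>
    h.swapYZ.not_level_zero (by rwa [card_swapYZ]) (a := (a.1, a.2.swap)) (a' := (a'.1, a'.2.swap))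
      (mem_swapYZ.2 ha) (mem_swapYZ.2 ha')
      (fun e => hne (by
        rw [Prod.mk.injEq, Prod.swap_inj] at e
        exact Prod.ext e.1 e.2)) hz (by simp)
  obtain ⟨b, hb, b', hb', hbb⟩ : ∃ b ∈ B, ∃ b' ∈ B, b ≠ b' :=
    Finset.one_lt_card.1 (h.1 ▸ Finset.one_lt_card.2 ⟨a, ha, a', ha', hne⟩)
  have hz := hzz h hq a ha a' ha' hne
  have hV : Vanishes p A 0 True True := (h.2.2 b hb b' hb' hbb 0 (by simp [level_zero])).congr
    (by simpa using hyy h.symm (h.1 ▸ hr) b hb b' hb' hbb)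
    (by simpa using hzz h.symm (h.1 ▸ hq) b hb b' hb' hbb)
  have key := hV.mid_right_eq a.2.1 a'.2.1 a.2.2 a'.2.2
  rw [mass_eq_zero (A := A) (φ := 1) (ψ := ptInd a.2.1) (θ := ptInd a'.2.2) isInd_one
      (isInd_ptInd _) (isInd_ptInd _) fun c hc _ h1 h2 => ?_,
    mass_eq_zero (A := A) (φ := 1) (ψ := ptInd a'.2.1) (θ := ptInd a.2.2) isInd_one
      (isInd_ptInd _) (isInd_ptInd _) fun c hc _ h1 h2 => ?_] at key
  · have := one_le_mass isInd_one (isInd_ptInd a.2.1) (isInd_ptInd a.2.2) ha rfl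
      (by simp [ptInd]) (by simp [ptInd])
    have := mass_nonneg A isInd_one (isInd_ptInd a'.2.1) (isInd_ptInd a'.2.2)
    omega
  · exact hyy h hr c hc a' ha' (fun e => hz (by rw [← ptInd_eq_one.1 h2, e])) (ptInd_eq_one.1 h1)
  · exact hyy h hr c hc a ha (fun e => hz (by rw [← ptInd_eq_one.1 h2, e])) (ptInd_eq_one.1 h1)

theorem CombPair.good (hp : p.Prime) (hq : (Fintype.card Y).Prime) (hr : (Fintype.card Z).Prime)
    (hpq : p ≠ Fintype.card Y) (hpr : p ≠ Fintype.card Z)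
    (hqr : Fintype.card Y ≠ Fintype.card Z) {D : Prop} (h : CombPair p n A B)
    (hrA : ¬Fintype.card Z ∣ A.card) (hD : D → ¬Fintype.card Y ∣ A.card) :
    Good p n (fun u v => u.1 = v.1 ∨ D) A B := by
  have : Nontrivial Y := Fintype.one_lt_card_iff_nontrivial.1 hq.one_lt
  have : Nontrivial Z := Fintype.one_lt_card_iff_nontrivial.1 hr.one_lt
  have h3 : (3 ≤ p ∧ 3 ≤ Fintype.card Y) ∨ (3 ≤ p ∧ 3 ≤ Fintype.card Z) ∨
      (3 ≤ Fintype.card Y ∧ 3 ≤ Fintype.card Z) := by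
    have := hp.two_le; have := hq.two_le; have := hr.two_le
    omega
  induction n generalizing A B with
  | zero => exact h.good_of_exponent_zero hrA hD
  | succ n ih =>
    by_cases hAi : ∃ i, ∀ a ∈ A, (p : ℤ) ∣ a.1 - i
    · obtain ⟨i, hi⟩ := hAi
      exact h.good_of_class_left hp.pos hi fun h' =>
        ih h' (by rwa [h'.1, ← h.1]) (by rwa [h'.1, ← h.1])
    by_cases hBi : ∃ i, ∀ b ∈ B, (p : ℤ) ∣ b.1 - i
    · obtain ⟨i, hi⟩ := hBi
      exact h.good_of_class_right hp.pos hi fun h' => ih h' hrA hD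
    by_cases hAU : IsPUnion p (n + 1) A
    · exact h.good_of_isPUnion_left hp.one_lt hAU fun R _ B' _ hR _ h' =>
        ih h' (fun hd => hrA (hR ▸ hd.mul_left _)) fun d hd => hD d (hR ▸ hd.mul_left _)
    by_cases hBU : IsPUnion p (n + 1) B
    · refine h.good_of_isPUnion_right hp.one_lt hBU fun A' R _ hR h' => ih h' ?_ ?_
      · rw [h'.1]; exact fun hd => hrA (hR ▸ hd.mul_left _)
      · rw [h'.1]; exact fun d hd => hD d (hR ▸ hd.mul_left _)
    by_cases hAy : ∃ y, ∀ a ∈ A, a.2.1 = y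
    · obtain ⟨y, hy⟩ := hAy
      exact fun a ha a' ha' hne _ =>
        h.good_of_const_mid_left hp.one_lt hrA hy a ha a' ha' hne trivial
    by_cases hBy : ∃ y, ∀ b ∈ B, b.2.1 = y
    · obtain ⟨y, hy⟩ := hBy
      exact fun a ha a' ha' hne _ =>
        h.good_of_const_mid_right hp.one_lt hrA hy a ha a' ha' hne trivial
    by_cases hAz : ∃ z, ∀ a ∈ A, a.2.2 = z
    · obtain ⟨z, hz⟩ := hAz
      rintro a ha a' ha' hne (hy | hd) k hk
      · exact h.good_of_snd_eq ha ha' hne (Prod.ext hy ((hz a ha).trans (hz a' ha').symm)) hk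
      · exact (h.swapYZ.good_of_const_mid_left hp.one_lt (by rw [card_swapYZ]; exact hD hd) (y := z)
          fun c hc => hz _ (mem_swapYZ.1 hc)).of_swapYZ a ha a' ha' hne trivial k hk
    by_cases hBz : ∃ z, ∀ b ∈ B, b.2.2 = z
    · obtain ⟨z, hz⟩ := hBz
      rintro a ha a' ha' hne (hy | hd) k hk
      · refine ⟨?_, ((h.2.1 a ha a' ha' hne k hk).of_const_right hz).congr (by simp [hy]) Iff.rfl⟩
        rintro rfl
        exact h.not_level_zero hrA ha ha' hne hy hk
      · exact (h.swapYZ.good_of_const_mid_right hp.one_lt (by rw [card_swapYZ]; exact hD hd) (y := z)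
          fun c hc => hz _ (mem_swapYZ.1 hc)).of_swapYZ a ha a' ha' hne trivial k hk
    by_cases hBY : IsYUnion p (n + 1) B
    · exact h.good_of_isYUnion_right hp.one_lt hrA hD hBY
    exact (h.false_of_nondegenerate hp ((Nat.coprime_primes hp hq).2 hpq) h3
      (fun hd => hqr ((Nat.prime_dvd_prime_iff_eq hr hq).1 hd).symm) hrA hAi hBi hAy hBy hAz hBz
      hAU hBU hBY).elim

/-- Distinct elements of the left hand set, with equal coordinates in the fibers whose size
divides the cardinality, differ by an order at which the right hand set vanishes. -/
theorem CombPair.good_of_dvd (hp : p.Prime) (hq : (Fintype.card Y).Prime)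
    (hr : (Fintype.card Z).Prime) (hpq : p ≠ Fintype.card Y) (hpr : p ≠ Fintype.card Z)
    (hqr : Fintype.card Y ≠ Fintype.card Z) (h : CombPair p n A B) :
    Good p n (fun u v => (Fintype.card Y ∣ A.card → u.1 = v.1) ∧
      (Fintype.card Z ∣ A.card → u.2 = v.2)) A B := by
  rintro a ha a' ha' hne ⟨h1, h2⟩ k hk
  by_cases hrA : Fintype.card Z ∣ A.card
  · by_cases hqA : Fintype.card Y ∣ A.card
    · exact h.good_of_snd_eq ha ha' hne (Prod.ext (h1 hqA) (h2 hrA)) hk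
    · exact (h.swapYZ.good hp hr hq hpr hpq hqr.symm (D := False) (by rwa [card_swapYZ])
        False.elim).of_swapYZ a ha a' ha' hne (Or.inl (h2 hrA)) k hk
  · by_cases hqA : Fintype.card Y ∣ A.card
    · exact h.good hp hq hr hpq hpr hqr (D := False) hrA False.elim a ha a' ha' hne
        (Or.inl (h1 hqA)) k hk
    · exact h.good hp hq hr hpq hpr hqr (D := True) hrA (fun _ => hqA) a ha a' ha' hne
        (Or.inr trivial) k hk

end Main

section Characters

open Polynomial

variable {N : ℕ} [NeZero N]

theorem chi_eq_sum_pow (A : Finset (ZMod N)) (b : ZMod N) :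
    chi N A b = ∑ a ∈ A, ZMod.stdAddChar b ^ a.val := by
  unfold chi
  refine Finset.sum_congr rfl fun a _ => ?_
  rw [← AddChar.map_nsmul_eq_pow, nsmul_eq_mul, ZMod.natCast_zmod_val, ZMod.stdAddChar_apply,
    ZMod.toCircle_apply]

theorem chi_eq_sum (A : Finset (ZMod N)) (b : ZMod N) :
    chi N A b = ∑ a ∈ A, ZMod.stdAddChar (a * b) := by
  rw [chi_eq_sum_pow]
  refine Finset.sum_congr rfl fun a _ => ?_
  rw [← AddChar.map_nsmul_eq_pow, nsmul_eq_mul, ZMod.natCast_zmod_val]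

theorem chi_zero (A : Finset (ZMod N)) : chi N A 0 = A.card := by
  simp [chi_eq_sum]

theorem isPrimitiveRoot_stdAddChar (c : ZMod N) :
    IsPrimitiveRoot (ZMod.stdAddChar c) (addOrderOf c) := by
  refine ⟨?_, fun l hl => ?_⟩
  · rw [← AddChar.map_nsmul_eq_pow, addOrderOf_nsmul_eq_zero, AddChar.map_zero_eq_one]
  · rw [← AddChar.map_nsmul_eq_pow, ← AddChar.map_zero_eq_one (ZMod.stdAddChar (N := N))] at hl
    exact addOrderOf_dvd_of_nsmul_eq_zero (ZMod.injective_stdAddChar hl)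

/-- Vanishing at a character passes to all characters of the same order. -/
theorem sum_pow_eq_zero_of_chi {A : Finset (ZMod N)} {c : ZMod N} (h : chi N A c = 0) {η : ℂ}
    (hη : IsPrimitiveRoot η (addOrderOf c)) : ∑ a ∈ A, η ^ a.val = 0 := by
  have hpos : 0 < addOrderOf c := addOrderOf_pos c
  let f : ℚ[X] := ∑ a ∈ A, X ^ a.val
  have hf : ∀ z : ℂ, aeval z f = ∑ a ∈ A, z ^ a.val := fun z => by simp [f]
  have hd : minpoly ℚ (ZMod.stdAddChar c) ∣ f :=
    minpoly.dvd _ _ (by rw [hf, ← chi_eq_sum_pow, h])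
  rw [← cyclotomic_eq_minpoly_rat (isPrimitiveRoot_stdAddChar c) hpos,
    cyclotomic_eq_minpoly_rat hη hpos] at hd
  rw [← hf]
  exact (minpoly.dvd_iff).1 hd

/-- The span of the characters `t ↦ η ^ t` with `η` a primitive `d`-th root of unity. -/
def charSpan (d : ℕ) : Submodule ℂ (ℤ → ℂ) :=
  Submodule.span ℂ {f | ∃ η : ℂ, IsPrimitiveRoot η d ∧ f = fun t => η ^ t}

theorem resInd_eq_sum {p k : ℕ} {ω : ℂ} (hω : IsPrimitiveRoot ω (p ^ k)) (hp : p ≠ 0) (x t : ℤ) :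
    (resInd p k x t : ℂ) = ((p : ℂ) ^ k)⁻¹ * ∑ j ∈ range (p ^ k), (ω ^ j) ^ (t - x) := by
  have hP : (p : ℂ) ^ k ≠ 0 := by simp [hp]
  have e : ∀ j : ℕ, (ω ^ j) ^ (t - x) = (ω ^ (t - x)) ^ j := fun j => by
    rw [← zpow_natCast, ← zpow_natCast, ← zpow_mul, ← zpow_mul, mul_comm]
  simp only [e]
  unfold resInd
  split_ifs with h
  · have h1 : ω ^ (t - x) = 1 := (hω.zpow_eq_one_iff_dvd _).2 (by exact_mod_cast h)
    simp [h1, hP]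
  · have h1 : ω ^ (t - x) ≠ 1 := fun h1 => h (by exact_mod_cast (hω.zpow_eq_one_iff_dvd _).1 h1)
    have h2 := geom_sum_eq h1 (p ^ k)
    have h3 : (ω ^ (t - x)) ^ (p ^ k) = 1 := by
      rw [← e, hω.pow_eq_one, one_zpow]
    rw [h2, h3]
    simp

theorem LevelTest.mem_charSpan {p k : ℕ} (hp : p.Prime) {φ : ℤ → ℤ} (h : LevelTest p k φ) :
    (fun t => (φ t : ℂ)) ∈ charSpan (p ^ k) := by
  cases k with
  | zero =>
    cases h
    exact Submodule.subset_span ⟨1, by simp, by funext t; simp⟩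
  | succ k =>
    obtain ⟨x, x', hd, rfl⟩ := h
    have hω := Complex.isPrimitiveRoot_exp (p ^ (k + 1)) (pow_ne_zero _ hp.ne_zero)
    set ω := Complex.exp (2 * Real.pi * Complex.I / ((p ^ (k + 1) : ℕ) : ℂ))
    have hω0 : ω ≠ 0 := hω.ne_zero (pow_ne_zero _ hp.ne_zero)
    have e : (fun t => (((resInd p (k + 1) x - resInd p (k + 1) x') t : ℤ) : ℂ)) =
        ∑ j ∈ range (p ^ (k + 1)),
          (((p : ℂ) ^ (k + 1))⁻¹ * ((ω ^ j) ^ (-x) - (ω ^ j) ^ (-x'))) • fun t : ℤ => (ω ^ j) ^ t := by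
      funext t
      rw [Pi.sub_apply, Int.cast_sub, resInd_eq_sum hω hp.ne_zero, resInd_eq_sum hω hp.ne_zero,
        ← mul_sub, ← Finset.sum_sub_distrib, Finset.sum_apply, Finset.mul_sum]
      refine Finset.sum_congr rfl fun j _ => ?_
      have hj : ω ^ j ≠ 0 := pow_ne_zero _ hω0
      rw [Pi.smul_apply, smul_eq_mul, sub_eq_add_neg t, sub_eq_add_neg t, zpow_add₀ hj,
        zpow_add₀ hj]
      ring
    rw [e]
    refine Submodule.sum_mem _ fun j _ => ?_
    by_cases hj : p ∣ j
    · have : (ω ^ j) ^ (-x) = (ω ^ j) ^ (-x') := by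
        have hj0 : ω ^ j ≠ 0 := pow_ne_zero _ hω0
        rw [← div_eq_one_iff_eq (zpow_ne_zero _ hj0), ← zpow_sub₀ hj0, ← zpow_natCast ω j,
          ← zpow_mul, hω.zpow_eq_one_iff_dvd]
        push_cast
        rw [pow_succ']
        refine mul_dvd_mul (by exact_mod_cast hj) ?_
        rw [show -x - -x' = -(x - x') by ring]
        exact (dvd_neg).2 hd
      rw [this, sub_self, mul_zero, zero_smul]
      exact Submodule.zero_mem _
    · refine Submodule.smul_mem _ _ (Submodule.subset_span ⟨_, hω.pow_of_coprime j ?_, rfl⟩)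
      exact Nat.Coprime.pow_right _ ((hp.coprime_iff_not_dvd.2 hj).symm)

theorem FiberTest.mem_charSpan {q : ℕ} (hq : q.Prime) {ε : Prop} [Decidable ε]
    {ψ : ZMod q → ℤ} (h : FiberTest ε ψ) :
    (fun t : ℤ => (ψ (t : ZMod q) : ℂ)) ∈ charSpan (if ε then q else 1) := by
  have : NeZero q := ⟨hq.ne_zero⟩
  split_ifs with hε
  · obtain ⟨y, y', rfl⟩ := h.1 hε
    have key : ∀ y : ZMod q, ∀ t : ℤ, ptInd y (t : ZMod q) = resInd q 1 y.val t := fun y t => by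
      unfold ptInd resInd
      congr 1
      rw [pow_one, ← ZMod.intCast_zmod_eq_zero_iff_dvd, Int.cast_sub, sub_eq_zero]
      simp
    have := LevelTest.mem_charSpan hq
      (levelTest_succ q (k := 0) (x := y.val) (x' := y'.val) (by simp))
    rw [zero_add, pow_one] at this
    simpa [key] using this
  · rw [h.2 hε]
    exact Submodule.subset_span ⟨1, by simp, by funext t; simp⟩

theorem sum_mul_eq_zero_of_mem_charSpan {ι : Type*} {s : Finset ι} {w : ι → ℤ} {d : ℕ}
    {g : ι → ℂ} (h : ∀ η : ℂ, IsPrimitiveRoot η d → ∑ a ∈ s, η ^ w a * g a = 0) {f : ℤ → ℂ}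
    (hf : f ∈ charSpan d) : ∑ a ∈ s, f (w a) * g a = 0 := by
  induction hf using Submodule.span_induction with
  | mem f hf => obtain ⟨η, hη, rfl⟩ := hf; exact h η hη
  | zero => simp
  | add f f' _ _ hf hf' => simp [add_mul, Finset.sum_add_distrib, hf, hf']
  | smul c f _ hf => simp [mul_assoc, ← Finset.mul_sum, hf]

theorem IsPrimitiveRoot.mul_coprime {a b : ℕ} {ζ ξ : ℂ} (hζ : IsPrimitiveRoot ζ a)
    (hξ : IsPrimitiveRoot ξ b) (hab : a.Coprime b) : IsPrimitiveRoot (ζ * ξ) (a * b) := by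
  rw [hζ.eq_orderOf, hξ.eq_orderOf] at hab ⊢
  rw [← (Commute.all ζ ξ).orderOf_mul_eq_mul_orderOf_of_coprime hab]
  exact IsPrimitiveRoot.orderOf _

end Characters

section Transfer

variable {p q r n N : ℕ}

/-- The image of a residue class in `ℤ × ZMod q × ZMod r`. -/
def toTriple (q r : ℕ) (a : ZMod N) : ℤ × ZMod q × ZMod r :=
  ((a.val : ℤ), ((a.val : ℤ) : ZMod q), ((a.val : ℤ) : ZMod r))

theorem toTriple_injective [NeZero N] :
    Function.Injective (toTriple q r : ZMod N → ℤ × ZMod q × ZMod r) := fun _ _ h =>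
  ZMod.val_injective N (Int.natCast_inj.1 (congrArg Prod.fst h))

theorem card_image_toTriple [NeZero N] (A : Finset (ZMod N)) :
    (A.image (toTriple q r)).card = A.card := Finset.card_image_of_injective _ toTriple_injective

theorem Nat.Coprime.mul_dvd_iff_dvd_and_dvd {a b m : ℕ} (h : a.Coprime b) :
    a * b ∣ m ↔ a ∣ m ∧ b ∣ m :=
  ⟨fun hd => ⟨dvd_of_mul_right_dvd hd, dvd_of_mul_left_dvd hd⟩,
    fun hd => h.mul_dvd_of_dvd_of_dvd hd.1 hd.2⟩

theorem coprime_ite {a b : ℕ} (h : a.Coprime b) (ε : Prop) [Decidable ε] :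
    a.Coprime (if ε then b else 1) := by
  split_ifs
  · exact h
  · exact Nat.coprime_one_right a

theorem coprime_parts (hp : p.Prime) (hq : q.Prime) (hr : r.Prime) (hpq : p ≠ q) (hpr : p ≠ r)
    (hqr : q ≠ r) (k : ℕ) (ε δ : Prop) [Decidable ε] [Decidable δ] :
    (p ^ k).Coprime (if ε then q else 1) ∧
      (p ^ k * (if ε then q else 1)).Coprime (if δ then r else 1) := by
  have hpq' := (Nat.coprime_primes hp hq).2 hpq
  have hpr' := (Nat.coprime_primes hp hr).2 hpr
  have hqr' := (Nat.coprime_primes hq hr).2 hqr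
  exact ⟨coprime_ite (hpq'.pow_left k) ε, coprime_ite
    ((hpr'.pow_left k).mul_left (coprime_ite hqr'.symm ε).symm) δ⟩

theorem vanishes_of_chi [NeZero N] (hp : p.Prime) (hq : q.Prime) (hr : r.Prime) (hpq : p ≠ q)
    (hpr : p ≠ r) (hqr : q ≠ r) {A : Finset (ZMod N)} {c : ZMod N} (h : chi N A c = 0) {k : ℕ}
    {ε δ : Prop} [Decidable ε] [Decidable δ]
    (hc : addOrderOf c = p ^ k * (if ε then q else 1) * (if δ then r else 1)) :
    Vanishes p (A.image (toTriple q r)) k ε δ := by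
  intro φ ψ θ hφ hψ hθ
  obtain ⟨hc1, hc2⟩ := coprime_parts hp hq hr hpq hpr hqr k ε δ
  have key : ∑ a ∈ A, (φ (a.val : ℤ) : ℂ) *
      ((ψ ((a.val : ℤ) : ZMod q) : ℂ) * (θ ((a.val : ℤ) : ZMod r) : ℂ)) = 0 := by
    refine sum_mul_eq_zero_of_mem_charSpan (w := fun a : ZMod N => (a.val : ℤ))
      (f := fun t => (φ t : ℂ)) (fun ξ hξ => ?_) (hφ.mem_charSpan hp)
    simp only [mul_left_comm (ξ ^ (_ : ℤ))]
    refine sum_mul_eq_zero_of_mem_charSpan (w := fun a : ZMod N => (a.val : ℤ))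
      (f := fun t => (ψ (t : ZMod q) : ℂ)) (fun ζ hζ => ?_) (hψ.mem_charSpan hq)
    simp only [← mul_assoc, mul_comm _ (θ _ : ℂ)]
    simp only [mul_assoc]
    refine sum_mul_eq_zero_of_mem_charSpan (w := fun a : ZMod N => (a.val : ℤ))
      (f := fun t => (θ (t : ZMod r) : ℂ)) (fun η hη => ?_) (hθ.mem_charSpan hr)
    have hprim := (hξ.mul_coprime hζ hc1).mul_coprime hη hc2
    rw [← hc] at hprim
    rw [← sum_pow_eq_zero_of_chi h hprim]
    refine Finset.sum_congr rfl fun a _ => ?_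
    rw [zpow_natCast, zpow_natCast, zpow_natCast, mul_pow, mul_pow]
    ring
  have : (mass (A.image (toTriple q r)) φ ψ θ : ℂ) = 0 := by
    rw [← key, mass, Finset.sum_image toTriple_injective.injOn]
    simp only [Int.cast_sum, Int.cast_mul]
    exact Finset.sum_congr rfl fun a _ => by simp only [toTriple, mul_assoc]
  exact_mod_cast this

theorem Level.dvd_mul_iff (hp : p.Prime) {k : ℕ} {x x' : ℤ} (h : Level p n k x x') (m : ℕ) :
    (p : ℤ) ^ n ∣ m * (x - x') ↔ p ^ k ∣ m := by
  have hp' : Prime (p : ℤ) := Nat.prime_iff_prime_int.1 hp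
  rcases eq_or_ne k 0 with rfl | hk
  · simp only [pow_zero, one_dvd, iff_true]
    exact (level_zero.1 h).mul_left _
  · obtain ⟨hkn, ⟨w, hw⟩, h2⟩ := (level_iff hk).1 h
    have hw' : ¬(p : ℤ) ∣ w := fun hd => h2 (by
      rw [hw, pow_succ]; exact mul_dvd_mul_left _ hd)
    have e : (p : ℤ) ^ n = (p : ℤ) ^ (n - k) * (p : ℤ) ^ k := by rw [← pow_add]; congr 1; omega
    rw [hw, e, mul_left_comm, mul_dvd_mul_iff_left (pow_ne_zero _ hp'.ne_zero)]
    have e2 : p ^ k ∣ m ↔ (p : ℤ) ^ k ∣ m := by exact_mod_cast Int.natCast_dvd_natCast.symm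
    rw [e2]
    exact ⟨fun hd => hp'.pow_dvd_of_dvd_mul_right k hw' hd, fun hd => hd.mul_right _⟩

theorem dvd_mul_sub_iff (hq : q.Prime) (x x' : ℤ) [Decidable ((x : ZMod q) ≠ (x' : ZMod q))]
    (m : ℕ) : (q : ℤ) ∣ m * (x - x') ↔ (if (x : ZMod q) ≠ (x' : ZMod q) then q else 1) ∣ m := by
  have hq' : Prime (q : ℤ) := Nat.prime_iff_prime_int.1 hq
  have e : (x : ZMod q) = (x' : ZMod q) ↔ (q : ℤ) ∣ x - x' := by
    rw [← sub_eq_zero, ← Int.cast_sub, ZMod.intCast_zmod_eq_zero_iff_dvd]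
  rw [hq'.dvd_mul, Int.natCast_dvd_natCast, ← e]
  split_ifs with h
  · exact or_iff_left h
  · simp [not_not.1 h]

theorem natCast_dvd_iff (hN : N = p ^ n * q * r) (hp : p.Prime) (hq : q.Prime) (hr : r.Prime)
    (hpq : p ≠ q) (hpr : p ≠ r) (hqr : q ≠ r) (D : ℤ) :
    (N : ℤ) ∣ D ↔ (p : ℤ) ^ n ∣ D ∧ (q : ℤ) ∣ D ∧ (r : ℤ) ∣ D := by
  obtain ⟨h1, h2⟩ := coprime_parts hp hq hr hpq hpr hqr n True True
  simp only [if_true] at h1 h2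
  rw [hN, ← Int.natCast_pow, Int.natCast_dvd, Int.natCast_dvd, Int.natCast_dvd, Int.natCast_dvd,
    h2.mul_dvd_iff_dvd_and_dvd, h1.mul_dvd_iff_dvd_and_dvd, and_assoc]

theorem addOrderOf_sub [NeZero N] (hN : N = p ^ n * q * r) (hp : p.Prime) (hq : q.Prime)
    (hr : r.Prime) (hpq : p ≠ q) (hpr : p ≠ r) (hqr : q ≠ r) (b b' : ZMod N) {k : ℕ}
    (hk : Level p n k b.val b'.val) :
    addOrderOf (b - b') = p ^ k *
      (if (toTriple q r b).2.1 ≠ (toTriple q r b').2.1 then q else 1) *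
      (if (toTriple q r b).2.2 ≠ (toTriple q r b').2.2 then r else 1) := by
  refine Nat.dvd_right_iff_eq.1 fun m => ?_
  have e : m • (b - b') = ((m * ((b.val : ℤ) - b'.val) : ℤ) : ZMod N) := by simp
  obtain ⟨h1, h2⟩ := coprime_parts hp hq hr hpq hpr hqr k
    ((toTriple q r b).2.1 ≠ (toTriple q r b').2.1) ((toTriple q r b).2.2 ≠ (toTriple q r b').2.2)
  rw [addOrderOf_dvd_iff_nsmul_eq_zero, e, ZMod.intCast_zmod_eq_zero_iff_dvd,
    natCast_dvd_iff hN hp hq hr hpq hpr hqr, hk.dvd_mul_iff hp, dvd_mul_sub_iff hq,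
    dvd_mul_sub_iff hr, h2.mul_dvd_iff_dvd_and_dvd, h1.mul_dvd_iff_dvd_and_dvd, and_assoc]
  rfl

end Transfer

section SpectralToTile

variable {p q r n N : ℕ}

theorem Level.succ_unique {k j : ℕ} {x x' : ℤ} (hk : Level p n (k + 1) x x')
    (hj : Level p n (j + 1) x x') : k = j := by
  rcases lt_trichotomy k j with h | h | h
  · exact absurd ((pow_dvd_pow _ (by omega)).trans hk.2.1) hj.2.2
  · exact h
  · exact absurd ((pow_dvd_pow _ (by omega)).trans hj.2.1) hk.2.2

theorem IsSpectralPair.symm [NeZero N] {A B : Finset (ZMod N)} (h : IsSpectralPair N A B) :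
    IsSpectralPair N B A := by
  refine ⟨h.1.symm, ?_⟩
  rcases A.eq_empty_or_nonempty with rfl | hA
  · simp
  have hm : (A.card : ℂ) ≠ 0 := by exact_mod_cast hA.card_pos.ne'
  let M : Matrix A B ℂ := fun a b => ZMod.stdAddChar ((a : ZMod N) * (b : ZMod N))
  let M' : Matrix B A ℂ := fun b a => (A.card : ℂ)⁻¹ * ZMod.stdAddChar (-((a : ZMod N) * (b : ZMod N)))
  have hM : M' * M = 1 := by
    ext b b'
    have e : (M' * M) b b' = (A.card : ℂ)⁻¹ * chi N A (b' - b) := by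
      rw [Matrix.mul_apply, chi_eq_sum, Finset.mul_sum, ← Finset.sum_coe_sort A]
      refine Finset.sum_congr rfl fun a _ => ?_
      simp only [M, M']
      rw [mul_assoc, ← AddChar.map_add_eq_mul]
      congr 2
      ring
    rw [e, Matrix.one_apply]
    split_ifs with hb
    · rw [hb, sub_self, chi_zero, inv_mul_cancel₀ hm]
    · rw [h.2 _ b'.2 _ b.2 fun hc => hb (Subtype.ext hc.symm), mul_zero]
  have hM' : M * M' = 1 :=
    (Matrix.mul_eq_one_comm_of_card_eq _ _ _ (by simpa using h.1.symm)).1 hM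
  intro a ha a' ha' hne
  have := congrFun (congrFun hM' ⟨a, ha⟩) ⟨a', ha'⟩
  rw [Matrix.one_apply_ne (fun hc => hne (congrArg Subtype.val hc)), Matrix.mul_apply] at this
  have e : (A.card : ℂ)⁻¹ * chi N B (a - a') = 0 := by
    rw [← this, chi_eq_sum, Finset.mul_sum, ← Finset.sum_coe_sort B]
    refine Finset.sum_congr rfl fun b _ => ?_
    simp only [M, M']
    rw [mul_left_comm, ← AddChar.map_add_eq_mul]
    congr 2
    ring
  exact (mul_eq_zero.1 e).resolve_left (inv_ne_zero hm)

theorem IsSpectralPair.halfPair [NeZero N] (hN : N = p ^ n * q * r) (hp : p.Prime) (hq : q.Prime)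
    (hr : r.Prime) (hpq : p ≠ q) (hpr : p ≠ r) (hqr : q ≠ r) {A B : Finset (ZMod N)}
    (h : IsSpectralPair N A B) :
    HalfPair p n (B.image (toTriple q r)) (A.image (toTriple q r)) := by
  intro b hb b' hb' hne k hk
  obtain ⟨b, hbB, rfl⟩ := Finset.mem_image.1 hb
  obtain ⟨b', hbB', rfl⟩ := Finset.mem_image.1 hb'
  exact vanishes_of_chi hp hq hr hpq hpr hqr (h.2 b hbB b' hbB' fun hc => hne (by rw [hc]))
    (addOrderOf_sub hN hp hq hr hpq hpr hqr b b' hk)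

theorem IsSpectralPair.combPair [NeZero N] (hN : N = p ^ n * q * r) (hp : p.Prime) (hq : q.Prime)
    (hr : r.Prime) (hpq : p ≠ q) (hpr : p ≠ r) (hqr : q ≠ r) {A B : Finset (ZMod N)}
    (h : IsSpectralPair N A B) :
    CombPair p n (A.image (toTriple q r)) (B.image (toTriple q r)) :=
  ⟨by rw [card_image_toTriple, card_image_toTriple, h.1],
    h.symm.halfPair hN hp hq hr hpq hpr hqr, h.halfPair hN hp hq hr hpq hpr hqr⟩

theorem exists_toTriple_eq [NeZero N] (hN : N = p ^ n * q * r) (hp : p.Prime) (hq : q.Prime)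
    (hr : r.Prime) (hpq : p ≠ q) (hpr : p ≠ r) (hqr : q ≠ r) (x : ℤ) (y : ZMod q) (z : ZMod r) :
    ∃ t : ZMod N, (p : ℤ) ^ n ∣ (t.val : ℤ) - x ∧ (toTriple q r t).2 = (y, z) := by
  have : NeZero q := ⟨hq.ne_zero⟩
  have : NeZero r := ⟨hr.ne_zero⟩
  have : NeZero (p ^ n) := ⟨pow_ne_zero _ hp.ne_zero⟩
  let f : ZMod N → ZMod (p ^ n) × ZMod q × ZMod r := fun t =>
    (((t.val : ℤ) : ZMod (p ^ n)), (toTriple q r t).2)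
  have hf : Function.Injective f := by
    intro t t' h
    have h1 : ((t.val : ℤ) : ZMod (p ^ n)) = ((t'.val : ℤ) : ZMod (p ^ n)) := congrArg Prod.fst h
    have h2 : ((t.val : ℤ) : ZMod q) = ((t'.val : ℤ) : ZMod q) := congrArg (fun u => u.2.1) h
    have h3 : ((t.val : ℤ) : ZMod r) = ((t'.val : ℤ) : ZMod r) := congrArg (fun u => u.2.2) h
    rw [← sub_eq_zero, ← Int.cast_sub, ZMod.intCast_zmod_eq_zero_iff_dvd] at h1 h2 h3
    have hd := (natCast_dvd_iff hN hp hq hr hpq hpr hqr _).2 ⟨by exact_mod_cast h1, h2, h3⟩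
    rw [← ZMod.intCast_zmod_eq_zero_iff_dvd, Int.cast_sub, sub_eq_zero] at hd
    simpa using hd
  have hb : Function.Bijective f := (Fintype.bijective_iff_injective_and_card f).2 ⟨hf, by
    simp only [Fintype.card_prod, ZMod.card]; rw [hN, mul_assoc]⟩
  obtain ⟨t, ht⟩ := hb.2 ((x : ZMod (p ^ n)), y, z)
  refine ⟨t, ?_, congrArg Prod.snd ht⟩
  have h1 : ((t.val : ℤ) : ZMod (p ^ n)) = (x : ZMod (p ^ n)) := congrArg Prod.fst ht
  rw [← sub_eq_zero, ← Int.cast_sub, ZMod.intCast_zmod_eq_zero_iff_dvd] at h1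
  exact_mod_cast h1

/-- Subsets of `ZMod N` with prescribed orders of differences. -/
theorem exists_box [NeZero N] (hN : N = p ^ n * q * r) (hp : p.Prime) (hq : q.Prime)
    (hr : r.Prime) (hpq : p ≠ q) (hpr : p ≠ r) (hqr : q ≠ r) (P : ℕ → Prop) [DecidablePred P]
    (ε δ : Prop) [Decidable ε] [Decidable δ] :
    ∃ E : Finset (ZMod N),
      E.card = p ^ Nat.count P n * (if ε then q else 1) * (if δ then r else 1) ∧
      ∀ t ∈ E, ∀ t' ∈ E, (∀ k, Level p n (k + 1) t.val t'.val → P k) ∧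
        (¬ε → (toTriple q r t).2.1 = (toTriple q r t').2.1) ∧
        (¬δ → (toTriple q r t).2.2 = (toTriple q r t').2.2) := by
  have : NeZero q := ⟨hq.ne_zero⟩
  have : NeZero r := ⟨hr.ne_zero⟩
  obtain ⟨S, hS, hSd⟩ := exists_card_eq_pow_count hp.pos P n
  choose g hg1 hg2 using exists_toTriple_eq hN hp hq hr hpq hpr hqr
  let U : Finset (ZMod q) := if ε then univ else {0}
  let V : Finset (ZMod r) := if δ then univ else {0}
  have hU : U.card = if ε then q else 1 := by
    simp only [U]; split_ifs <;> simp [ZMod.card]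
  have hV : V.card = if δ then r else 1 := by
    simp only [V]; split_ifs <;> simp [ZMod.card]
  have hU' : ¬ε → ∀ y ∈ U, y = 0 := fun h y hy => by simpa [U, h] using hy
  have hV' : ¬δ → ∀ y ∈ V, y = 0 := fun h y hy => by simpa [V, h] using hy
  refine ⟨(S ×ˢ U ×ˢ V).image fun s => g s.1 s.2.1 s.2.2, ?_, ?_⟩
  · rw [Finset.card_image_of_injOn, Finset.card_product, Finset.card_product, hS, hU, hV, mul_assoc]
    rintro ⟨s, y, z⟩ hs ⟨s', y', z'⟩ hs' h
    have h : g s y z = g s' y' z' := h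
    have h2 : (y, z) = (y', z') := by rw [← hg2 s y z, h, hg2]
    refine Prod.ext ?_ h2
    by_contra hne
    obtain ⟨k, hk, -⟩ := hSd s (Finset.mem_product.1 hs).1 s' (Finset.mem_product.1 hs').1 hne
    refine hk.2.2 ((pow_dvd_pow _ (Nat.sub_le n k)).trans ?_)
    have := dvd_sub (hg1 s' y' z') (hg1 s y z)
    rwa [h, sub_sub_sub_cancel_left] at this
  · intro t ht t' ht'
    obtain ⟨⟨s, y, z⟩, hs, rfl⟩ := Finset.mem_image.1 ht
    obtain ⟨⟨s', y', z'⟩, hs', rfl⟩ := Finset.mem_image.1 ht'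
    simp only [Finset.mem_product] at hs hs'
    simp only [hg2]
    refine ⟨fun k hk => ?_, fun h => ?_, fun h => ?_⟩
    · have hk' : Level p n (k + 1) s s' := by
        refine hk.congr (Nat.succ_ne_zero k) ?_ ?_
        all_goals exact (pow_dvd_pow _ (by have := hk.le; omega)).trans (hg1 _ _ _)
      obtain ⟨j, hj, hPj⟩ := hSd s hs.1 s' hs'.1 fun hc => hk'.2.2 (by simp [hc])
      rwa [hk'.succ_unique hj]
    · rw [hU' h y hs.2.1, hU' h y' hs'.2.1]
    · rw [hV' h z hs.2.2, hV' h z' hs'.2.2]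

theorem tiles_iff [NeZero N] {A : Finset (ZMod N)} : Tiles N A ↔ ∃ T : Finset (ZMod N),
    Function.Bijective fun x : A × T => (x.1 : ZMod N) + x.2 := by
  refine exists_congr fun T => ?_
  rw [Function.bijective_iff_existsUnique]
  refine forall_congr' fun g => ⟨?_, ?_⟩
  · rintro ⟨⟨a, t⟩, ⟨ha, ht, hg⟩, hu⟩
    refine ⟨(⟨a, ha⟩, ⟨t, ht⟩), hg, ?_⟩
    rintro ⟨⟨a', ha'⟩, ⟨t', ht'⟩⟩ hg'
    have := hu (a', t') ⟨ha', ht', hg'⟩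
    simpa [Prod.ext_iff] using this
  · rintro ⟨⟨⟨a, ha⟩, ⟨t, ht⟩⟩, hg, hu⟩
    refine ⟨(a, t), ⟨ha, ht, hg⟩, ?_⟩
    rintro ⟨a', t'⟩ ⟨ha', ht', hg'⟩
    have := hu (⟨a', ha'⟩, ⟨t', ht'⟩) hg'
    simpa [Prod.ext_iff] using this

theorem count_add_count_not (P : ℕ → Prop) [DecidablePred P] (n : ℕ) :
    Nat.count P n + Nat.count (fun k => ¬P k) n = n := by
  induction n with
  | zero => simp
  | succ n ih =>
    rw [Nat.count_succ, Nat.count_succ]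
    split_ifs <;> omega

theorem ite_mul_ite_not (ε : Prop) [Decidable ε] (a : ℕ) :
    (if ε then a else 1) * (if ¬ε then a else 1) = a := by
  by_cases h : ε <;> simp [h]

theorem box_dvd_card [NeZero N] (hp : p.Prime) (hq : q.Prime)
    (hr : r.Prime) (hpq : p ≠ q) (hpr : p ≠ r) (hqr : q ≠ r) (P : ℕ → Prop) [DecidablePred P]
    {A : Finset (ZMod N)}
    (hP : ∀ k < n, P k → Vanishes p (A.image (toTriple q r)) (k + 1) False False) :
    p ^ Nat.count P n * (if q ∣ A.card then q else 1) * (if r ∣ A.card then r else 1) ∣ A.card := by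
  obtain ⟨h1, h2⟩ := coprime_parts hp hq hr hpq hpr hqr (Nat.count P n) (q ∣ A.card) (r ∣ A.card)
  rw [h2.mul_dvd_iff_dvd_and_dvd, h1.mul_dvd_iff_dvd_and_dvd]
  refine ⟨⟨?_, by split_ifs <;> simp_all⟩, by split_ifs <;> simp_all⟩
  have := pow_count_dvd_card hp.pos (fun k => k < n ∧ P k) (fun k hk => hP k hk.1 hk.2) n
  rw [card_image_toTriple] at this
  convert this using 2
  rw [Nat.count_eq_card_filter_range, Nat.count_eq_card_filter_range]
  exact congrArg Finset.card (Finset.filter_congr fun k hk => by simp [Finset.mem_range.1 hk])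

theorem IsSpectral.tiles [NeZero N] (hN : N = p ^ n * q * r) (hp : p.Prime) (hq : q.Prime)
    (hr : r.Prime) (hpq : p ≠ q) (hpr : p ≠ r) (hqr : q ≠ r) {A : Finset (ZMod N)}
    (hA : A.Nonempty) (h : IsSpectral N A) : Tiles N A := by
  classical
  have : NeZero q := ⟨hq.ne_zero⟩
  have : NeZero r := ⟨hr.ne_zero⟩
  obtain ⟨B, hB⟩ := h
  have hgood := (hB.combPair hN hp hq hr hpq hpr hqr).good_of_dvd hp (by rwa [ZMod.card])
    (by rwa [ZMod.card]) (by rwa [ZMod.card]) (by rwa [ZMod.card]) (by rwa [ZMod.card, ZMod.card])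
  rw [ZMod.card, ZMod.card, card_image_toTriple] at hgood
  let L : ℕ → Prop := fun k => Vanishes p (B.image (toTriple q r)) (k + 1) False False
  obtain ⟨E, hE, hEd⟩ := exists_box hN hp hq hr hpq hpr hqr (fun k => ¬L k) (¬q ∣ A.card)
    (¬r ∣ A.card)
  have hinj : Function.Injective fun x : A × E => (x.1 : ZMod N) + x.2 := by
    rintro ⟨⟨a, ha⟩, ⟨t, ht⟩⟩ ⟨⟨a', ha'⟩, ⟨t', ht'⟩⟩ hsum
    have hsum : a + t = a' + t' := hsum
    suffices haa : a = a' by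
      subst haa
      simpa using hsum
    by_contra hne
    have hd : (N : ℤ) ∣ ((a.val : ℤ) - a'.val) - ((t'.val : ℤ) - t.val) := by
      rw [← ZMod.intCast_zmod_eq_zero_iff_dvd]
      push_cast
      simp only [ZMod.natCast_zmod_val]
      linear_combination hsum
    obtain ⟨hdp, hdq, hdr⟩ := (natCast_dvd_iff hN hp hq hr hpq hpr hqr _).1 hd
    obtain ⟨hE1, hE2, hE3⟩ := hEd t' ht' t ht
    obtain ⟨k, -, hk⟩ := exists_level (p := p) n (a.val : ℤ) a'.val
    have hC : ((q ∣ A.card → (toTriple q r a).2.1 = (toTriple q r a').2.1) ∧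
        (r ∣ A.card → (toTriple q r a).2.2 = (toTriple q r a').2.2)) := by
      rw [← ZMod.intCast_zmod_eq_zero_iff_dvd, Int.cast_sub, Int.cast_sub, Int.cast_sub] at hdq hdr
      refine ⟨fun hdvd => ?_, fun hdvd => ?_⟩
      · have := hE2 (not_not.2 hdvd)
        simp only [toTriple] at this ⊢
        linear_combination hdq + this
      · have := hE3 (not_not.2 hdvd)
        simp only [toTriple] at this ⊢
        linear_combination hdr + this
    obtain ⟨hk0, hv⟩ := hgood _ (Finset.mem_image_of_mem _ ha) _ (Finset.mem_image_of_mem _ ha')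
      (toTriple_injective.ne hne) hC k hk
    obtain ⟨j, rfl⟩ := Nat.exists_eq_succ_of_ne_zero hk0
    refine hE1 j ?_ hv
    have h1 : Level p n (j + 1) ((a.val : ℤ) - a'.val + t.val) (t.val : ℤ) :=
      ⟨hk.1, by simpa using hk.2.1, by simpa using hk.2.2⟩
    have hjn : n - (j + 1) + 1 ≤ n := by have := hk.1; omega
    refine h1.congr (Nat.succ_ne_zero j) ?_ (by simp)
    rw [show (a.val : ℤ) - a'.val + t.val - t'.val =
      ((a.val : ℤ) - a'.val) - ((t'.val : ℤ) - t.val) by ring]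
    exact (pow_dvd_pow _ hjn).trans hdp
  refine tiles_iff.2 ⟨E, (Fintype.bijective_iff_injective_and_card _).2 ⟨hinj, ?_⟩⟩
  refine le_antisymm (Fintype.card_le_of_injective _ hinj) ?_
  have hdvd := box_dvd_card (n := n) hp hq hr hpq hpr hqr L (A := B) fun _ _ hk => hk
  rw [← hB.1] at hdvd
  have hle := Nat.le_of_dvd hA.card_pos hdvd
  rw [Fintype.card_prod, Fintype.card_coe, Fintype.card_coe, ZMod.card]
  refine le_trans (le_of_eq ?_) (Nat.mul_le_mul_right _ hle)
  conv_lhs => rw [hN, ← count_add_count_not L n, pow_add, ← ite_mul_ite_not (q ∣ A.card) q,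
    ← ite_mul_ite_not (r ∣ A.card) r]
  rw [hE]
  ring

end SpectralToTile

section Dilation

open AddMonoidAlgebra

variable {G α β : Type*} [AddCommGroup G] [Fintype G] [Fintype α] [Fintype β]

/-- Dilating one factor of a tiling by a prime not dividing its size preserves the tiling. -/
theorem bijective_add_prime_nsmul {f : α → G} {g : β → G} {l : ℕ} (hl : l.Prime)
    (hlβ : ¬l ∣ Fintype.card β)
    (h : Function.Bijective fun x : α × β => f x.1 + g x.2) :
    Function.Bijective fun x : α × β => f x.1 + l • g x.2 := by
  classical
  have : Fact l.Prime := ⟨hl⟩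
  have : CharP (AddMonoidAlgebra (ZMod l) G) l := charP_of_injective_algebraMap
    (FaithfulSMul.algebraMap_injective (ZMod l) (AddMonoidAlgebra (ZMod l) G)) l
  let σ : AddMonoidAlgebra (ZMod l) G := ∑ i, single (f i) 1
  let τ : AddMonoidAlgebra (ZMod l) G := ∑ j, single (g j) 1
  let γ : AddMonoidAlgebra (ZMod l) G := ∑ x, single x 1
  have h1 : σ * τ = γ := by
    simp only [σ, τ, γ, Finset.sum_mul_sum, single_mul_single, one_mul]
    rw [← Fintype.sum_prod_type']
    exact Fintype.sum_bijective _ h _ _ fun _ => rfl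
  have h2 : γ * τ = (Fintype.card β : AddMonoidAlgebra (ZMod l) G) * γ := by
    have : ∀ y : G, γ * single y 1 = γ := fun y => by
      simp only [γ, Finset.sum_mul, single_mul_single, one_mul]
      exact Fintype.sum_bijective _ (AddGroup.addRight_bijective y) _ _ fun _ => rfl
    simp only [τ, Finset.mul_sum, this, Finset.sum_const, Finset.card_univ, nsmul_eq_mul]
  have h3 : ∀ m : ℕ, γ * τ ^ m = (Fintype.card β : AddMonoidAlgebra (ZMod l) G) ^ m * γ := by
    intro m
    induction m with
    | zero => simp
    | succ m ih => rw [pow_succ, ← mul_assoc, ih, mul_assoc, h2, pow_succ, mul_assoc]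
  have h4 : σ * τ ^ l = γ := by
    rw [← mul_pow_sub_one hl.ne_zero τ, ← mul_assoc, h1, h3]
    have : ((Fintype.card β : ZMod l)) ^ (l - 1) = 1 :=
      ZMod.pow_card_sub_one_eq_one (by rwa [Ne, ZMod.natCast_eq_zero_iff])
    have := congrArg (algebraMap (ZMod l) (AddMonoidAlgebra (ZMod l) G)) this
    rw [map_pow, map_natCast, map_one] at this
    rw [this, one_mul]
  have h5 : τ ^ l = ∑ j, single (l • g j) 1 := by
    simp only [τ]
    rw [sum_pow_char]
    simp [single_pow]
  have hsurj : Function.Surjective fun x : α × β => f x.1 + l • g x.2 := by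
    intro x
    by_contra hx
    push Not at hx
    rw [h5] at h4
    simp only [σ, γ, Finset.sum_mul_sum, single_mul_single, one_mul] at h4
    have := congrArg (fun z => z.coeff x) h4
    simp only [coeff_sum, Finsupp.finsetSum_apply, coeff_single] at this
    rw [Finset.sum_eq_zero fun i _ => Finset.sum_eq_zero fun j _ =>
      Finsupp.single_eq_of_ne' (hx (i, j)),
      Finset.sum_eq_single x (fun y _ hy => Finsupp.single_eq_of_ne' hy) (by simp)] at this
    simp at this
  exact (Fintype.bijective_iff_surjective_and_card _).2 ⟨hsurj, Fintype.card_of_bijective h⟩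

theorem bijective_add_ite_nsmul {f : α → G} {g : β → G} {l : ℕ} (hl : l.Prime) {ε : Prop}
    [Decidable ε] (hlβ : ε → ¬l ∣ Fintype.card β)
    (h : Function.Bijective fun x : α × β => f x.1 + g x.2) :
    Function.Bijective fun x : α × β => f x.1 + (if ε then l else 1) • g x.2 := by
  split_ifs with hε
  · exact bijective_add_prime_nsmul hl (hlβ hε) h
  · simpa using h

end Dilation

section TileToSpectral

variable {p q r n N : ℕ}

theorem chi_mul_chi_eq_zero [NeZero N] {A T : Finset (ZMod N)} {u : ℕ}
    (h : Function.Bijective fun x : A × T => (x.1 : ZMod N) + u • (x.2 : ZMod N)) {c : ZMod N}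
    (hc : c ≠ 0) : chi N A c * chi N T (u • c) = 0 := by
  have h0 := AddChar.sum_mulShift c (ZMod.isPrimitive_stdAddChar N)
  rw [if_neg hc, Nat.cast_zero] at h0
  rw [chi_eq_sum, chi_eq_sum, ← Finset.sum_coe_sort A, ← Finset.sum_coe_sort T,
    Finset.sum_mul_sum, ← Fintype.sum_prod_type', ← h0]
  refine Fintype.sum_bijective _ h _ _ fun x => ?_
  rw [← AddChar.map_add_eq_mul]
  congr 1
  simp only [nsmul_eq_mul]
  ring

theorem exists_addOrderOf_eq [NeZero N] (hN : N = p ^ n * q * r) {k : ℕ} (hk : k ≤ n) :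
    ∃ c : ZMod N, addOrderOf c = p ^ k := by
  have hN0 : 0 < N := NeZero.pos N
  have e : N = p ^ k * (p ^ (n - k) * q * r) := by
    rw [hN, ← Nat.add_sub_cancel' hk, pow_add, Nat.add_sub_cancel' hk]; ring
  have hpos : 0 < p ^ (n - k) * q * r := Nat.pos_of_ne_zero fun h => by
    rw [h, mul_zero] at e; omega
  refine ⟨((p ^ (n - k) * q * r : ℕ) : ZMod N), ?_⟩
  rw [ZMod.addOrderOf_coe _ hN0.ne', Nat.gcd_eq_right (Dvd.intro_left _ e.symm)]
  exact Nat.div_eq_of_eq_mul_left hpos e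

theorem le_ite_mul_ite (hq : q.Prime) {a b : ℕ} (h : q ∣ a * b) :
    q ≤ (if q ∣ a then q else 1) * (if q ∣ b then q else 1) := by
  have := hq.pos
  rcases hq.dvd_mul.1 h with h | h <;> rw [if_pos h] <;> split_ifs <;> nlinarith

theorem not_dvd_of_mul_eq (hq : q.Prime) {a b m : ℕ} (hm : ¬q ∣ m) (h : a * b = m * q)
    (ha : q ∣ a) : ¬q ∣ b := fun hb => hm <| by
  have := mul_dvd_mul ha hb
  rw [h] at this
  exact Nat.dvd_of_mul_dvd_mul_right hq.pos this

theorem Tiles.isSpectral [NeZero N] (hN : N = p ^ n * q * r) (hp : p.Prime) (hq : q.Prime)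
    (hr : r.Prime) (hpq : p ≠ q) (hpr : p ≠ r) (hqr : q ≠ r) {A : Finset (ZMod N)}
    (h : Tiles N A) : IsSpectral N A := by
  classical
  obtain ⟨T, hT⟩ := tiles_iff.1 h
  have hcard : A.card * T.card = N := by
    simpa [ZMod.card] using Fintype.card_of_bijective hT
  have hN0 : 0 < N := NeZero.pos N
  have hApos : 0 < A.card := Nat.pos_of_ne_zero fun h0 => by rw [h0, zero_mul] at hcard; omega
  have hTpos : 0 < T.card := Nat.pos_of_ne_zero fun h0 => by rw [h0, mul_zero] at hcard; omega
  let P : ℕ → Prop := fun k => ¬Vanishes p (T.image (toTriple q r)) (k + 1) False False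
  have hPA : ∀ k < n, P k → Vanishes p (A.image (toTriple q r)) (k + 1) False False := by
    intro k hk hPk
    obtain ⟨c, hc⟩ := exists_addOrderOf_eq hN (Nat.succ_le_of_lt hk)
    have hc0 : c ≠ 0 := by
      rintro rfl
      rw [addOrderOf_zero] at hc
      exact absurd hc.symm (Nat.one_lt_pow (Nat.succ_ne_zero k) hp.one_lt).ne'
    have hc' : addOrderOf c = p ^ (k + 1) * (if False then q else 1) * (if False then r else 1) := by
      simpa using hc
    have hT1 : Function.Bijective fun x : A × T => (x.1 : ZMod N) + 1 • (x.2 : ZMod N) := by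
      simpa using hT
    have hz := chi_mul_chi_eq_zero hT1 hc0
    rw [one_smul] at hz
    rcases mul_eq_zero.1 hz with hz | hz
    · exact vanishes_of_chi hp hq hr hpq hpr hqr hz hc'
    · exact absurd (vanishes_of_chi hp hq hr hpq hpr hqr hz hc') hPk
  have hdA := box_dvd_card (n := n) hp hq hr hpq hpr hqr P hPA
  have hdT := box_dvd_card (n := n) (A := T) hp hq hr hpq hpr hqr (fun k => ¬P k)
    fun k _ hk => not_not.1 hk
  have hqN : q ∣ A.card * T.card := by
    rw [hcard, hN]; exact (dvd_mul_left q _).mul_right _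
  have hrN : r ∣ A.card * T.card := by
    rw [hcard, hN]; exact dvd_mul_left r _
  have hAeq : p ^ Nat.count P n * (if q ∣ A.card then q else 1) * (if r ∣ A.card then r else 1)
      = A.card := by
    refine le_antisymm (Nat.le_of_dvd hApos hdA) (Nat.le_of_mul_le_mul_right ?_ hTpos)
    rw [hcard]
    refine le_trans ?_ (Nat.mul_le_mul_left _ (Nat.le_of_dvd hTpos hdT))
    conv_lhs => rw [hN, ← count_add_count_not P n, pow_add]
    refine le_trans (Nat.mul_le_mul (Nat.mul_le_mul_left _ (le_ite_mul_ite hq hqN))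
      (le_ite_mul_ite hr hrN)) (le_of_eq ?_)
    ring
  obtain ⟨B, hB, hBd⟩ := exists_box hN hp hq hr hpq hpr hqr P (q ∣ A.card) (r ∣ A.card)
  refine ⟨B, by rw [hB, hAeq], fun b hb b' hb' hne => ?_⟩
  obtain ⟨hB1, hB2, hB3⟩ := hBd b hb b' hb'
  have hqm : ¬q ∣ p ^ n * r := fun hd => by
    rcases hq.dvd_mul.1 hd with hd | hd
    · exact hpq ((Nat.prime_dvd_prime_iff_eq hq hp).1 (hq.dvd_of_dvd_pow hd)).symm
    · exact hqr ((Nat.prime_dvd_prime_iff_eq hq hr).1 hd)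
  have hrm : ¬r ∣ p ^ n * q := fun hd => by
    rcases hr.dvd_mul.1 hd with hd | hd
    · exact hpr ((Nat.prime_dvd_prime_iff_eq hr hp).1 (hr.dvd_of_dvd_pow hd)).symm
    · exact hqr ((Nat.prime_dvd_prime_iff_eq hr hq).1 hd).symm
  have hbij := bijective_add_ite_nsmul (f := fun a : A => (a : ZMod N))
    (g := fun t : T => (t : ZMod N)) (ε := q ∣ A.card) hq
    (by rw [Fintype.card_coe]; exact not_dvd_of_mul_eq hq hqm (by rw [hcard, hN]; ring)) hT
  have hbij := bijective_add_ite_nsmul (f := fun a : A => (a : ZMod N))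
    (g := fun t : T => (if q ∣ A.card then q else 1) • (t : ZMod N)) (ε := r ∣ A.card) hr
    (by rw [Fintype.card_coe]; exact not_dvd_of_mul_eq hr hrm (by rw [hcard, hN])) hbij
  simp only [← mul_smul] at hbij
  obtain ⟨k, -, hk⟩ := exists_level (p := p) n (b.val : ℤ) b'.val
  have hord := addOrderOf_sub hN hp hq hr hpq hpr hqr b b' hk
  have hu : addOrderOf (((if r ∣ A.card then r else 1) * (if q ∣ A.card then q else 1)) • (b - b'))
      = p ^ k := by
    have hcop : (p ^ k).Coprime ((if r ∣ A.card then r else 1) * (if q ∣ A.card then q else 1)) :=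
      Nat.Coprime.mul_right (coprime_ite (((Nat.coprime_primes hp hr).2 hpr).pow_left k) _)
        (coprime_ite (((Nat.coprime_primes hp hq).2 hpq).pow_left k) _)
    have hdvd : (if (toTriple q r b).2.1 ≠ (toTriple q r b').2.1 then q else 1) *
        (if (toTriple q r b).2.2 ≠ (toTriple q r b').2.2 then r else 1) ∣
        (if r ∣ A.card then r else 1) * (if q ∣ A.card then q else 1) := by
      rw [mul_comm]
      refine mul_dvd_mul ?_ ?_
      · split_ifs <;> simp_all
      · split_ifs <;> simp_all
    rw [addOrderOf_nsmul, hord, mul_assoc, hcop.gcd_mul_left_cancel, Nat.gcd_eq_left hdvd]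
    refine Nat.mul_div_cancel _ (Nat.mul_pos ?_ ?_) <;> split_ifs
    all_goals first | exact one_pos | exact hq.pos | exact hr.pos
  refine (mul_eq_zero.1 (chi_mul_chi_eq_zero hbij (sub_ne_zero.2 hne))).resolve_right fun hz => ?_
  cases k with
  | zero =>
    rw [pow_zero, AddMonoid.addOrderOf_eq_one_iff] at hu
    rw [hu, chi_zero] at hz
    exact hTpos.ne' (by exact_mod_cast hz)
  | succ k =>
    exact hB1 k hk (vanishes_of_chi hp hq hr hpq hpr hqr hz (by simpa using hu))

end TileToSpectral

theorem fuglede_Zpnqr (p q r n : ℕ) (hp : p.Prime) (hq : q.Prime) (hr : r.Prime)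
    (hpq : p ≠ q) (hpr : p ≠ r) (hqr : q ≠ r) (hn : 0 < n)
    (N : ℕ) (hN : N = p ^ n * q * r)
    (A : Finset (ZMod N)) (hA : A.Nonempty) :
    IsSpectral N A ↔ Tiles N A := by
  have : NeZero N := ⟨hN ▸ mul_ne_zero (mul_ne_zero (pow_ne_zero _ hp.ne_zero) hq.ne_zero)
    hr.ne_zero⟩
  exact ⟨fun h => h.tiles hN hp hq hr hpq hpr hqr hA, fun h => h.isSpectral hN hp hq hr hpq hpr hqr⟩
end

section
/- Let p be a prime divisor of N and let A be a nonempty spectral subset of Z_N. Assume that every nonempty spectral subset of Z_{N/p} tiles Z_{N/p}. If A is a union of cosets of the unique subgroup of Z_N of order p, then A tiles Z_N. -/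
open Finset

theorem chi_eq_sum_stdAddChar (N : ℕ) [NeZero N] (A : Finset (ZMod N)) (b : ZMod N) :
    chi N A b = ∑ a ∈ A, ZMod.stdAddChar (a * b) := by
  refine Finset.sum_congr rfl fun a _ => ?_
  have h := ZMod.stdAddChar_coe (N := N) ((a * b).val : ℤ)
  rw [Int.cast_natCast, ZMod.natCast_zmod_val, Int.cast_natCast] at h
  exact h.symm

theorem mul_eq_zero_iff_castHom_eq_zero {p M : ℕ} [NeZero p] [NeZero M] (x : ZMod (p * M)) :
    (p : ZMod (p * M)) * x = 0 ↔ ZMod.castHom (dvd_mul_left M p) (ZMod M) x = 0 := by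
  obtain ⟨n, rfl⟩ := ZMod.natCast_zmod_surjective x
  rw [map_natCast, ← Nat.cast_mul, ZMod.natCast_eq_zero_iff, ZMod.natCast_eq_zero_iff]
  exact Nat.mul_dvd_mul_iff_left (NeZero.pos p)

theorem stdAddChar_mul_eq_stdAddChar_castHom {p M : ℕ} [NeZero p] [NeZero M]
    (x : ZMod (p * M)) :
    (ZMod.stdAddChar ((p : ZMod (p * M)) * x) : ℂ) =
      ZMod.stdAddChar (ZMod.castHom (dvd_mul_left M p) (ZMod M) x) := by
  obtain ⟨n, rfl⟩ := ZMod.natCast_zmod_surjective x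
  have h₁ := ZMod.stdAddChar_coe (N := p * M) ((p * n : ℕ) : ℤ)
  have h₂ := ZMod.stdAddChar_coe (N := M) (n : ℤ)
  rw [map_natCast]
  push_cast at h₁ h₂
  rw [h₁, h₂]
  have hp : (p : ℂ) ≠ 0 := NeZero.ne _
  have hM : (M : ℂ) ≠ 0 := NeZero.ne _
  congr 1
  field_simp

theorem card_fiber_castHom {p M : ℕ} [NeZero p] [NeZero M] (y : ZMod M) :
    #{x : ZMod (p * M) | ZMod.castHom (dvd_mul_left M p) (ZMod M) x = y} = p := by
  set π := ZMod.castHom (dvd_mul_left M p) (ZMod M)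
  have hπ : Function.Surjective π := ZMod.castHom_surjective _
  have hfib (z : ZMod M) : #{x | π x = z} = #{x | π x = y} :=
    AddMonoidHom.card_fiber_eq_of_mem_range π.toAddMonoidHom (hπ z) (hπ y)
  have h := Finset.card_eq_sum_card_fiberwise (f := π) (s := univ) (t := univ) (by simp)
  simp only [hfib, sum_const, card_univ, ZMod.card, smul_eq_mul] at h
  exact Nat.eq_of_mul_eq_mul_left (NeZero.pos M) (h.symm.trans (mul_comm p M))

theorem mem_iff_castHom_mem_image {p M : ℕ} [NeZero p] [NeZero M] {A : Finset (ZMod (p * M))}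
    (hA : ∀ a ∈ A, ∀ x : ZMod (p * M), (p : ZMod (p * M)) * x = 0 → a + x ∈ A)
    (a : ZMod (p * M)) :
    ZMod.castHom (dvd_mul_left M p) (ZMod M) a ∈
      A.image (ZMod.castHom (dvd_mul_left M p) (ZMod M)) ↔ a ∈ A := by
  refine ⟨fun h => ?_, mem_image_of_mem _⟩
  obtain ⟨a', ha', h⟩ := mem_image.1 h
  have := hA a' ha' (a - a') ((mul_eq_zero_iff_castHom_eq_zero _).2 (by rw [map_sub, h, sub_self]))
  rwa [add_sub_cancel] at this

theorem sum_castHom_of_union_cosets {R : Type*} [AddCommMonoid R] {p M : ℕ} [NeZero p] [NeZero M]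
    {A : Finset (ZMod (p * M))}
    (hA : ∀ a ∈ A, ∀ x : ZMod (p * M), (p : ZMod (p * M)) * x = 0 → a + x ∈ A)
    (f : ZMod M → R) :
    ∑ a ∈ A, f (ZMod.castHom (dvd_mul_left M p) (ZMod M) a) =
      p • ∑ y ∈ A.image (ZMod.castHom (dvd_mul_left M p) (ZMod M)), f y := by
  rw [Finset.sum_comp f, Finset.smul_sum]
  refine Finset.sum_congr rfl fun y hy => ?_
  congr 1
  refine Eq.trans (congrArg Finset.card ?_) (card_fiber_castHom (p := p) y)
  ext x
  simp only [mem_filter, mem_univ, true_and, and_iff_right_iff_imp]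
  rintro rfl
  exact (mem_iff_castHom_mem_image hA x).1 hy

theorem card_eq_mul_card_image_castHom {p M : ℕ} [NeZero p] [NeZero M]
    {A : Finset (ZMod (p * M))}
    (hA : ∀ a ∈ A, ∀ x : ZMod (p * M), (p : ZMod (p * M)) * x = 0 → a + x ∈ A) :
    #A = p * #(A.image (ZMod.castHom (dvd_mul_left M p) (ZMod M))) := by
  simpa using sum_castHom_of_union_cosets hA (fun _ => (1 : ℕ))

theorem chi_mul_eq_mul_chi_image_castHom {p M : ℕ} [NeZero p] [NeZero M]
    {A : Finset (ZMod (p * M))}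
    (hA : ∀ a ∈ A, ∀ x : ZMod (p * M), (p : ZMod (p * M)) * x = 0 → a + x ∈ A)
    (x : ZMod (p * M)) :
    chi (p * M) A (p * x) = p * chi M (A.image (ZMod.castHom (dvd_mul_left M p) (ZMod M)))
      (ZMod.castHom (dvd_mul_left M p) (ZMod M) x) := by
  rw [chi_eq_sum_stdAddChar, chi_eq_sum_stdAddChar]
  refine Eq.trans ?_ ((sum_castHom_of_union_cosets hA _).trans (nsmul_eq_mul _ _))
  refine Finset.sum_congr rfl fun a _ => ?_
  rw [mul_left_comm, stdAddChar_mul_eq_stdAddChar_castHom, map_mul]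

theorem IsSpectral.image_castHom {p M : ℕ} [NeZero p] [NeZero M] {A : Finset (ZMod (p * M))}
    (hspec : IsSpectral (p * M) A)
    (hA : ∀ a ∈ A, ∀ x : ZMod (p * M), (p : ZMod (p * M)) * x = 0 → a + x ∈ A) :
    IsSpectral M (A.image (ZMod.castHom (dvd_mul_left M p) (ZMod M))) := by
  obtain ⟨B, hcard, hB⟩ := hspec
  set π := ZMod.castHom (dvd_mul_left M p) (ZMod M)
  obtain ⟨i, -, hi⟩ := Finset.exists_le_card_fiber_of_mul_le_card_of_maps_to
    (s := B) (t := (univ : Finset (ZMod p))) (f := fun b => (b.val : ZMod p)) (n := #(A.image π))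
    (by simp) univ_nonempty
    (by rw [card_univ, ZMod.card, ← hcard, card_eq_mul_card_image_castHom hA])
  obtain ⟨C, hCB, hC⟩ := Finset.exists_subset_card_eq hi
  let q : ZMod (p * M) → ZMod (p * M) := fun b => (b.val / p : ℕ)
  have hq {b b'} (hb : b ∈ C) (hb' : b' ∈ C) : b - b' = p * (q b - q b') := by
    have h : b.val % p = b'.val % p := (ZMod.natCast_eq_natCast_iff' _ _ _).1
      ((mem_filter.1 (hCB hb)).2.trans (mem_filter.1 (hCB hb')).2.symm)
    have hdiv (c : ZMod (p * M)) : c = p * q c + (c.val % p : ℕ) := by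
      rw [← Nat.cast_mul, ← Nat.cast_add, Nat.div_add_mod, ZMod.natCast_zmod_val]
    linear_combination hdiv b - hdiv b' + congrArg (Nat.cast (R := ZMod (p * M))) h
  have hinj : Set.InjOn (π ∘ q) C := fun b hb b' hb' h => by
    rw [← sub_eq_zero, hq hb hb', mul_eq_zero_iff_castHom_eq_zero, map_sub]
    exact sub_eq_zero.2 h
  refine ⟨C.image (π ∘ q), by rw [card_image_of_injOn hinj, hC], ?_⟩
  simp only [mem_image]
  rintro _ ⟨b, hb, rfl⟩ _ ⟨b', hb', rfl⟩ hne
  have h := hB b (mem_filter.1 (hCB hb)).1 b' (mem_filter.1 (hCB hb')).1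
    (fun h => hne (by rw [h]))
  rw [hq hb hb', chi_mul_eq_mul_chi_image_castHom hA, map_sub] at h
  exact (mul_eq_zero.1 h).resolve_left (NeZero.ne _)

theorem Tiles.of_image_castHom {p M : ℕ} [NeZero p] [NeZero M] {A : Finset (ZMod (p * M))}
    (hA : ∀ a ∈ A, ∀ x : ZMod (p * M), (p : ZMod (p * M)) * x = 0 → a + x ∈ A)
    (hT : Tiles M (A.image (ZMod.castHom (dvd_mul_left M p) (ZMod M)))) :
    Tiles (p * M) A := by
  obtain ⟨T, hT⟩ := hT
  have hmem := mem_iff_castHom_mem_image hA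
  set π := ZMod.castHom (dvd_mul_left M p) (ZMod M)
  obtain ⟨s, hs⟩ : ∃ s : ZMod M → ZMod (p * M), ∀ y, π (s y) = y :=
    (ZMod.castHom_surjective _).hasRightInverse
  refine ⟨T.image s, fun g => ?_⟩
  obtain ⟨⟨y, t⟩, ⟨hy, ht, hyt⟩, huniq⟩ := hT (π g)
  refine ⟨(g - s t, s t), ⟨?_, mem_image_of_mem _ ht, sub_add_cancel _ _⟩, ?_⟩
  · rwa [← hmem, map_sub, hs, ← hyt, add_sub_cancel_right]
  · rintro ⟨a, u⟩ ⟨ha, hu, rfl⟩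
    obtain ⟨t', ht', rfl⟩ := mem_image.1 hu
    have h := huniq (π a, t') ⟨(hmem a).2 ha, ht', by simp [hs]⟩
    obtain rfl : t' = t := congrArg Prod.snd h
    simp

/-- If `A` is a nonempty spectral set in `Z_N` which is a union of cosets of the
(`p`-torsion) subgroup of order `p`, and `S-T(Z_{N/p})` holds, then `A` tiles `Z_N`. -/
theorem spectral_union_of_p_cosets_tiles (N p : ℕ) (hN : 0 < N) (hp : p.Prime)
    (hpN : p ∣ N) (A : Finset (ZMod N)) (hA : A.Nonempty) (hspec : IsSpectral N A)
    (hind : ∀ A' : Finset (ZMod (N / p)), A'.Nonempty →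
      IsSpectral (N / p) A' → Tiles (N / p) A')
    (hcoset : ∀ a ∈ A, ∀ x : ZMod N, (p : ZMod N) * x = 0 → a + x ∈ A) :
    Tiles N A := by
  obtain ⟨M, rfl⟩ := hpN
  have : NeZero p := ⟨hp.ne_zero⟩
  have : NeZero M := ⟨(Nat.pos_of_mul_pos_left hN).ne'⟩
  rw [Nat.mul_div_cancel_left M hp.pos] at hind
  exact Tiles.of_image_castHom hcoset (hind _ (hA.image _) (hspec.image_castHom hcoset))
end

section
/- Let T ⊆ Z_N with 0 ∈ T and suppose T generates Z_N. Let p and q be distinct prime divisors of N. Then there exist t1, t2 ∈ T with t1 ≠ t2 such that t1 − t2 has nonzero image under the natural projection Z_N → Z_p and nonzero image under the natural projection Z_N → Z_q (i.e., p ∤ (t1 − t2) and q ∤ (t1 − t2)). -/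
open Finset

theorem AddMonoidHom.exists_mem_ne_zero_of_closure_eq_top {G H : Type*} [AddGroup G] [AddGroup H]
    {f : G →+ H} (hf : f ≠ 0) {s : Set G} (hs : AddSubgroup.closure s = ⊤) :
    ∃ t ∈ s, f t ≠ 0 := by
  by_contra! h
  exact hf (AddMonoidHom.eq_of_eqOn_dense hs h)

theorem RingHom.exists_mem_ne_zero_of_closure_eq_top {R S : Type*} [Ring R] [Ring S]
    [Nontrivial S] (f : R →+* S) {s : Set R} (hs : AddSubgroup.closure s = ⊤) :
    ∃ t ∈ s, f t ≠ 0 :=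
  AddMonoidHom.exists_mem_ne_zero_of_closure_eq_top (f := (f : R →+ S))
    (fun h => one_ne_zero (f.map_one.symm.trans (DFunLike.congr_fun h 1))) hs

theorem exists_diff_coprime_to_two_primes (N p q : ℕ) (hp : p.Prime) (hq : q.Prime)
    (hpq : p ≠ q) (hpN : p ∣ N) (hqN : q ∣ N)
    (T : Finset (ZMod N)) (h0 : (0 : ZMod N) ∈ T)
    (hgen : AddSubgroup.closure (T : Set (ZMod N)) = ⊤) :
    ∃ t1 ∈ T, ∃ t2 ∈ T, t1 ≠ t2 ∧
      ZMod.castHom hpN (ZMod p) (t1 - t2) ≠ 0 ∧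
      ZMod.castHom hqN (ZMod q) (t1 - t2) ≠ 0 := by
  have : Fact p.Prime := ⟨hp⟩
  have : Fact q.Prime := ⟨hq⟩
  set f := ZMod.castHom hpN (ZMod p)
  set g := ZMod.castHom hqN (ZMod q)
  suffices h : ∃ t1 ∈ T, ∃ t2 ∈ T, f (t1 - t2) ≠ 0 ∧ g (t1 - t2) ≠ 0 by
    obtain ⟨t1, h1, t2, h2, hf, hg⟩ := h
    refine ⟨t1, h1, t2, h2, ?_, hf, hg⟩
    rintro rfl
    exact hf (by simp)
  obtain ⟨a, ha, hfa⟩ := f.exists_mem_ne_zero_of_closure_eq_top hgen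
  obtain ⟨b, hb, hgb⟩ := g.exists_mem_ne_zero_of_closure_eq_top hgen
  by_cases hga : g a = 0
  · by_cases hfb : f b = 0
    · exact ⟨a, ha, b, hb, by simpa [map_sub, hfb] using hfa, by simpa [map_sub, hga] using hgb⟩
    · exact ⟨b, hb, 0, h0, by rwa [sub_zero], by rwa [sub_zero]⟩
  · exact ⟨a, ha, 0, h0, by rwa [sub_zero], by rwa [sub_zero]⟩
end
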